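/- arXiv:2305.06009 — 4 statements merged into one kernel-verified Lean document; each statement's English description precedes it below -/
import Mathlib

section
/- Fix d ≥ 1 and m ≥ 1. For (A_1,…,A_m) ∈ GL(d,ℝ)^m and (p_1,…,p_m) in the open simplex Δ_m = {p ∈ ℝ^m : p_i > 0 for all i and ∑_{i=1}^m p_i = 1}, let ν = ∑_{i=1}^m p_i δ_{A_i}. Then for every 1 ≤ j ≤ d the j-th Lyapunov exponent λ_j(ν) = L_j(ν) − L_{j−1}(ν) depends continuously on (A_1,…,A_m,p_1,…,p_m) at every point of GL(d,ℝ)^m × Δ_m. -/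
open Filter Topology

noncomputable section

/-- The `l`-th compound matrix of `g`: the matrix of the linear map `Λˡ g` induced by `g` on the
`l`-th exterior power `Λˡ ℝ^d`, written in the standard basis indexed by `l`-element subsets of
`Fin d`; its entries are the `l × l` minors of `g`. -/
def compound (d l : ℕ) (g : Matrix (Fin d) (Fin d) ℝ) :
    Matrix {s : Finset (Fin d) // s.card = l} {s : Finset (Fin d) // s.card = l} ℝ :=
  fun s t =>
    Matrix.det (Matrix.of fun i j : Fin l =>
      g ((s.1.orderIsoOfFin s.2 i : Fin d)) ((t.1.orderIsoOfFin t.2 j : Fin d)))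

/-- The operator norm of a matrix, viewed as a linear map between Euclidean spaces. -/
def matOpNorm {ι κ : Type*} [Fintype ι] [Fintype κ] [DecidableEq κ] (g : Matrix ι κ ℝ) : ℝ :=
  ‖LinearMap.toContinuousLinearMap (Matrix.toEuclideanLin g)‖

/-- The basis of the exterior power of `ℝ^d` indexed by the `l`-element subsets of `Fin d`. -/
def wedgeBasis (d l : ℕ) :
    Module.Basis {s : Finset (Fin d) // s.card = l} ℝ (⋀[ℝ]^l (Fin d → ℝ)) :=
  ((Pi.basisFun ℝ (Fin d)).exteriorPower l).reindex (Equiv.subtypeEquivRight fun _ => Iff.rfl)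

theorem compound_eq_toMatrix (d l : ℕ) (g : Matrix (Fin d) (Fin d) ℝ) :
    compound d l g = LinearMap.toMatrix (wedgeBasis d l) (wedgeBasis d l)
      (exteriorPower.map l (Matrix.toLin' g)) := by
  ext s t
  rw [LinearMap.toMatrix_apply, wedgeBasis, Module.Basis.reindex_apply,
    Module.Basis.repr_reindex_apply, exteriorPower.basis_apply,
    exteriorPower.map_apply_ιMulti_family, exteriorPower.basis_repr_apply,
    exteriorPower.ιMulti_family, exteriorPower.ιMultiDual_apply_ιMulti, ← Matrix.det_transpose]
  unfold compound
  congr 1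
  ext i j
  simp only [Matrix.transpose_apply, Matrix.of_apply, Function.comp_apply, Pi.basisFun_apply,
    Module.Basis.coord_apply, Pi.basisFun_repr, Matrix.toLin'_apply, Matrix.mulVec_single_one]
  rfl

theorem compound_mul (d l : ℕ) (g h : Matrix (Fin d) (Fin d) ℝ) :
    compound d l (g * h) = compound d l g * compound d l h := by
  simp only [compound_eq_toMatrix, Matrix.toLin'_mul, exteriorPower.map_comp]
  exact LinearMap.toMatrix_comp _ _ _ _ _

theorem compound_one (d l : ℕ) : compound d l 1 = 1 := by
  simp only [compound_eq_toMatrix, Matrix.toLin'_one, exteriorPower.map_id]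
  exact LinearMap.toMatrix_id _

theorem continuous_compound (d l : ℕ) : Continuous (compound d l) := by
  refine continuous_pi fun s => continuous_pi fun t => ?_
  unfold compound
  exact Continuous.matrix_det (by fun_prop)

/-- The `l`-th compound matrix acting on a Euclidean space. -/
def compoundMap (d l : ℕ) : Matrix (Fin d) (Fin d) ℝ →*
    (EuclideanSpace ℝ {s : Finset (Fin d) // s.card = l} →L[ℝ]
      EuclideanSpace ℝ {s : Finset (Fin d) // s.card = l}) where
  toFun g := LinearMap.toContinuousLinearMap (Matrix.toEuclideanLin (compound d l g))
  map_one' := by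
    ext v
    simp [compound_one]
  map_mul' g h := by
    ext v
    simp [compound_mul, Matrix.toLpLin_apply]

theorem continuous_compoundMap (d l : ℕ) : Continuous (compoundMap d l) := by
  let T : Matrix {s : Finset (Fin d) // s.card = l} {s : Finset (Fin d) // s.card = l} ℝ →ₗ[ℝ]
      (EuclideanSpace ℝ {s : Finset (Fin d) // s.card = l} →L[ℝ]
        EuclideanSpace ℝ {s : Finset (Fin d) // s.card = l}) :=
    (LinearMap.toContinuousLinearMap.toLinearMap ∘ₗ Matrix.toEuclideanLin.toLinearMap)
  have hT : Continuous T := T.continuous_of_finiteDimensional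
  exact hT.comp (continuous_compound d l)

/-- A strictly positive probability vector. -/
structure IsWeight {ι : Type*} [Fintype ι] (p : ι → ℝ) : Prop where
  pos : ∀ i, 0 < p i
  sum_eq : ∑ i, p i = 1

section Walk

variable {ι V W : Type*} [Fintype ι] [NormedAddCommGroup V] [NormedSpace ℝ V]
  [NormedAddCommGroup W] [NormedSpace ℝ W]

/-- The expectation of `f` at time `n` of the random walk on `V` that starts at `v` and applies
the operator `A i` with probability `p i` at each step. -/
def walk (p : ι → ℝ) (A : ι → V →L[ℝ] V) : ℕ → (V → ℝ) → V → ℝ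
  | 0, f, v => f v
  | n + 1, f, v => ∑ i, p i * walk p A n f (A i v)

/-- The product `A (ω (n-1)) ⋯ A (ω 0)`. -/
def word {n : ℕ} (A : ι → V →L[ℝ] V) (ω : Fin n → ι) : V →L[ℝ] V :=
  (List.ofFn fun i => A (ω i)).reverse.prod

variable {p : ι → ℝ} {A : ι → V →L[ℝ] V} {B : ι → W →L[ℝ] W}

@[simp] theorem walk_zero (f : V → ℝ) (v : V) : walk p A 0 f v = f v := rfl

theorem walk_succ (n : ℕ) (f : V → ℝ) (v : V) :
    walk p A (n + 1) f v = ∑ i, p i * walk p A n f (A i v) := rfl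

theorem walk_one (f : V → ℝ) (v : V) : walk p A 1 f v = ∑ i, p i * f (A i v) := rfl

theorem walk_add_time (m n : ℕ) (f : V → ℝ) (v : V) :
    walk p A (m + n) f v = walk p A m (walk p A n f) v := by
  induction m generalizing v with
  | zero => simp
  | succ m ih => rw [Nat.succ_add, walk_succ, walk_succ]; simp only [ih]

theorem walk_add_fun (n : ℕ) (f g : V → ℝ) (v : V) :
    walk p A n (fun x => f x + g x) v = walk p A n f v + walk p A n g v := by
  induction n generalizing v with
  | zero => simp
  | succ n ih => simp only [walk_succ, ih, mul_add, Finset.sum_add_distrib]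

theorem walk_const_mul (n : ℕ) (c : ℝ) (f : V → ℝ) (v : V) :
    walk p A n (fun x => c * f x) v = c * walk p A n f v := by
  induction n generalizing v with
  | zero => simp
  | succ n ih =>
    simp only [walk_succ, ih, Finset.mul_sum]
    exact Finset.sum_congr rfl fun i _ => by ring

theorem walk_const (hp : IsWeight p) (n : ℕ) (c : ℝ) (v : V) :
    walk p A n (fun _ => c) v = c := by
  induction n generalizing v with
  | zero => simp
  | succ n ih => simp only [walk_succ, ih, ← Finset.sum_mul, hp.sum_eq, one_mul]

theorem walk_mono_on (hp : IsWeight p) {T : Set V} (hT : ∀ i, ∀ v ∈ T, A i v ∈ T) {f g : V → ℝ}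
    (h : ∀ v ∈ T, f v ≤ g v) (n : ℕ) {v : V} (hv : v ∈ T) :
    walk p A n f v ≤ walk p A n g v := by
  induction n generalizing v with
  | zero => exact h v hv
  | succ n ih =>
    exact Finset.sum_le_sum fun i _ => mul_le_mul_of_nonneg_left (ih (hT i v hv)) (hp.pos i).le

theorem walk_mono (hp : IsWeight p) {f g : V → ℝ} (h : ∀ v, f v ≤ g v) (n : ℕ) (v : V) :
    walk p A n f v ≤ walk p A n g v :=
  walk_mono_on hp (T := Set.univ) (by simp) (fun v _ => h v) n (Set.mem_univ v)

theorem walk_semiconj_on {h : V → W} {T : Set V} (hT : ∀ i, ∀ v ∈ T, A i v ∈ T)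
    (hh : ∀ i, ∀ v ∈ T, h (A i v) = B i (h v)) (f : W → ℝ) (n : ℕ) {v : V} (hv : v ∈ T) :
    walk p A n (fun x => f (h x)) v = walk p B n f (h v) := by
  induction n generalizing v with
  | zero => rfl
  | succ n ih =>
    exact Finset.sum_congr rfl fun i _ => by rw [ih (hT i v hv), hh i v hv]

theorem walk_semiconj {h : V → W} (hh : ∀ i v, h (A i v) = B i (h v)) (f : W → ℝ) (n : ℕ)
    (v : V) : walk p A n (fun x => f (h x)) v = walk p B n f (h v) :=
  walk_semiconj_on (T := Set.univ) (by simp) (fun i v _ => hh i v) f n (Set.mem_univ v)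

theorem walk_eq_sum_word (n : ℕ) (f : V → ℝ) (v : V) :
    walk p A n f v = ∑ ω : Fin n → ι, (∏ i, p (ω i)) * f (word A ω v) := by
  induction n generalizing v with
  | zero => simp [word]
  | succ n ih =>
    rw [walk_succ, ← (Fin.consEquiv fun _ => ι).sum_comp, Fintype.sum_prod_type]
    refine Finset.sum_congr rfl fun i _ => ?_
    rw [ih, Finset.mul_sum]
    refine Finset.sum_congr rfl fun ω _ => ?_
    simp [word, Fin.prod_univ_succ, mul_assoc]

theorem sum_weight_word (hp : IsWeight p) (n : ℕ) :
    ∑ ω : Fin n → ι, ∏ i, p (ω i) = 1 := by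
  have := walk_const (A := fun _ => (0 : ℝ →L[ℝ] ℝ)) hp n 1 0
  rw [walk_eq_sum_word] at this
  simpa using this

end Walk

theorem word_mem {ι V : Type*} [NormedAddCommGroup V] [NormedSpace ℝ V]
    {A : ι → V →L[ℝ] V} {T : Set V} (hT : ∀ i, ∀ v ∈ T, A i v ∈ T) {n : ℕ} (ω : Fin n → ι) {v : V}
    (hv : v ∈ T) : word A ω v ∈ T := by
  induction n generalizing v with
  | zero => simpa [word] using hv
  | succ n ih =>
    have := ih (fun i => ω i.succ) (hT (ω 0) v hv)
    simpa [word] using this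

section Slow

open Real

theorem posLog_norm_le_add {ι V : Type*} [NormedAddCommGroup V] [NormedSpace ℝ V]
    {A : ι → V →L[ℝ] V} {K : ℝ} (hK : ∀ i v, ‖A i v‖ ≤ K * ‖v‖) (i : ι) (v : V) :
    log⁺ ‖A i v‖ ≤ log⁺ ‖v‖ + log⁺ K := by
  rw [add_comm]
  exact (posLog_le_posLog (norm_nonneg _) (hK i v)).trans posLog_mul

variable {ι V : Type*} [Fintype ι] [NormedAddCommGroup V] [NormedSpace ℝ V]

/-- The walk started at `v` does not grow exponentially fast, in mean logarithmic size. -/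
def IsSlow (p : ι → ℝ) (A : ι → V →L[ℝ] V) (v : V) : Prop :=
  ∀ τ > 0, ∃ C, ∀ n : ℕ, walk p A n (fun x => log⁺ ‖x‖) v ≤ τ * n + C

variable {p : ι → ℝ} {A : ι → V →L[ℝ] V}

theorem exists_norm_le (A : ι → V →L[ℝ] V) :
    ∃ K : ℝ, 1 ≤ K ∧ ∀ i v, ‖A i v‖ ≤ K * ‖v‖ := by
  refine ⟨1 + ∑ i, ‖A i‖, le_add_of_nonneg_right (Finset.sum_nonneg fun _ _ => norm_nonneg _),
    fun i v => (A i).le_of_opNorm_le ?_ v⟩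
  have := Finset.single_le_sum (f := fun i => ‖A i‖) (fun _ _ => norm_nonneg _)
    (Finset.mem_univ i)
  linarith

theorem walk_le_of_step (hp : IsWeight p) {f : V → ℝ} {c : ℝ} (h : ∀ i v, f (A i v) ≤ f v + c)
    (n r : ℕ) (v : V) : walk p A (n + r) f v ≤ walk p A n f v + r * c := by
  induction r with
  | zero => simp
  | succ r ih =>
    rw [← add_assoc, walk_add_time]
    have h1 : ∀ x, walk p A 1 f x ≤ f x + c := fun x => by
      rw [walk_one]
      calc ∑ i, p i * f (A i x) ≤ ∑ i, p i * (f x + c) :=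
            Finset.sum_le_sum fun i _ => mul_le_mul_of_nonneg_left (h i x) (hp.pos i).le
        _ = f x + c := by rw [← Finset.sum_mul, hp.sum_eq, one_mul]
    have h2 := walk_mono (A := A) hp h1 (n + r) v
    rw [walk_add_fun, walk_const hp] at h2
    push_cast
    linarith

/-- Slowness can be tested along an arithmetic progression of times. -/
theorem isSlow_of_multiples (hp : IsWeight p) {v : V}
    (h : ∀ τ > 0, ∃ q : ℕ, 1 ≤ q ∧ ∃ C, ∀ N : ℕ,
      walk p A (q * N) (fun x => log⁺ ‖x‖) v ≤ τ * (q * N : ℕ) + C) : IsSlow p A v := by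
  obtain ⟨K, -, hK⟩ := exists_norm_le A
  intro τ hτ
  obtain ⟨q, hq, C, hC⟩ := h τ hτ
  refine ⟨C + q * log⁺ K, fun n => ?_⟩
  have h1 := walk_le_of_step (A := A) (f := fun x => log⁺ ‖x‖) hp
    (posLog_norm_le_add hK) (q * (n / q)) (n % q) v
  rw [Nat.div_add_mod] at h1
  have h2 := hC (n / q)
  have h3 : ((q * (n / q) : ℕ) : ℝ) ≤ n := by exact_mod_cast Nat.mul_div_le n q
  have h4 : ((n % q : ℕ) : ℝ) ≤ q := by exact_mod_cast (Nat.mod_lt n hq).le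
  have h5 := mul_le_mul_of_nonneg_right h4 (posLog_nonneg (x := K))
  have h6 := mul_le_mul_of_nonneg_left h3 hτ.le
  linarith

theorem IsSlow.add (hp : IsWeight p) {v w : V} (hv : IsSlow p A v) (hw : IsSlow p A w) :
    IsSlow p A (v + w) := by
  intro τ hτ
  obtain ⟨C, hC⟩ := hv (τ / 2) (by positivity)
  obtain ⟨D, hD⟩ := hw (τ / 2) (by positivity)
  refine ⟨log 2 + C + D, fun n => ?_⟩
  have h1 := hC n
  have h2 := hD n
  have h3 : walk p A n (fun x => log⁺ ‖x‖) (v + w) ≤ log 2 + walk p A n (fun x => log⁺ ‖x‖) v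
      + walk p A n (fun x => log⁺ ‖x‖) w := by
    have h0 := sum_weight_word hp n
    simp only [walk_eq_sum_word]
    calc _ ≤ ∑ ω : Fin n → ι, ((∏ i, p (ω i)) * log 2 + (∏ i, p (ω i)) * log⁺ ‖word A ω v‖ +
          (∏ i, p (ω i)) * log⁺ ‖word A ω w‖) := by
          refine Finset.sum_le_sum fun ω _ => ?_
          rw [← mul_add, ← mul_add, map_add]
          refine mul_le_mul_of_nonneg_left ?_ (Finset.prod_nonneg fun i _ => (hp.pos _).le)
          have := posLog_norm_add_le (word A ω v) (word A ω w)
          linarith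
      _ = _ := by rw [Finset.sum_add_distrib, Finset.sum_add_distrib, ← Finset.sum_mul, h0, one_mul]
  linarith

theorem IsSlow.smul (hp : IsWeight p) (c : ℝ) {v : V} (hv : IsSlow p A v) :
    IsSlow p A (c • v) := by
  intro τ hτ
  obtain ⟨C, hC⟩ := hv τ hτ
  refine ⟨log⁺ c + C, fun n => ?_⟩
  have h1 := walk_semiconj (p := p) (A := A) (B := A) (h := fun x => c • x)
    (fun i v => by simp) (fun x => log⁺ ‖x‖) n v
  have h2 := walk_mono (A := A) hp (f := fun x => log⁺ ‖c • x‖) (g := fun x => log⁺ c + log⁺ ‖x‖)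
    (fun x => by rw [norm_smul, norm_eq_abs, ← posLog_abs c]; exact posLog_mul) n v
  rw [walk_add_fun, walk_const hp] at h2
  have := hC n
  linarith

theorem isSlow_zero : IsSlow p A (0 : V) := by
  refine fun τ hτ => ⟨0, fun n => ?_⟩
  rw [walk_eq_sum_word]
  simp only [map_zero, norm_zero, posLog_zero, mul_zero, Finset.sum_const_zero, add_zero]
  positivity

/-- The subspace of vectors along which the walk does not grow exponentially fast. -/
def slow (hp : IsWeight p) (A : ι → V →L[ℝ] V) : Submodule ℝ V where
  carrier := {v | IsSlow p A v}
  add_mem' := fun hv hw => hv.add hp hw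
  zero_mem' := isSlow_zero
  smul_mem' := fun c _ hv => hv.smul hp c

theorem apply_mem_slow (hp : IsWeight p) (i : ι) {v : V} (hv : v ∈ slow hp A) :
    A i v ∈ slow hp A := by
  obtain ⟨K, -, hK⟩ := exists_norm_le A
  intro τ hτ
  obtain ⟨C, hC⟩ := hv (τ * p i) (mul_pos hτ (hp.pos i))
  refine ⟨(τ * p i + C) / p i, fun n => ?_⟩
  have h1 := hC (n + 1)
  rw [walk_succ] at h1
  have h0 : ∀ w, 0 ≤ walk p A n (fun x => log⁺ ‖x‖) w := fun w => by
    have := walk_mono (A := A) hp (f := fun _ => (0 : ℝ)) (g := fun x => log⁺ ‖x‖)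
      (fun x => posLog_nonneg) n w
    rwa [walk_const hp] at this
  have h2 := Finset.single_le_sum (f := fun i => p i * walk p A n (fun x => log⁺ ‖x‖) (A i v))
    (fun j _ => mul_nonneg (hp.pos j).le (h0 _)) (Finset.mem_univ i)
  have h3 : τ * n + (τ * p i + C) / p i = (τ * p i * (n + 1 : ℕ) + C) / p i := by
    have := (hp.pos i).ne'
    push_cast
    field_simp
    ring
  rw [h3, le_div_iff₀ (hp.pos i)]
  linarith

theorem exists_spanning_bound [FiniteDimensional ℝ V] (E : Submodule ℝ V) :
    ∃ (r : ℕ) (e : Fin r → V) (C : ℝ), (∀ i, e i ∈ E) ∧ 0 ≤ C ∧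
      ∀ T : V →L[ℝ] V, ∀ x ∈ E, ‖T x‖ ≤ C * (∑ i, ‖T (e i)‖) * ‖x‖ := by
  let b := Module.finBasis ℝ E
  let L : E →L[ℝ] (Fin (Module.finrank ℝ E) → ℝ) :=
    LinearMap.toContinuousLinearMap b.equivFun.toLinearMap
  refine ⟨_, fun i => (b i : V), ‖L‖, fun i => (b i).2, L.opNorm_nonneg, fun T x hx => ?_⟩
  have h1 : x = ∑ i, L ⟨x, hx⟩ i • (b i : V) := by
    have := congrArg Subtype.val (b.sum_equivFun ⟨x, hx⟩)
    simp only [Submodule.coe_sum, Submodule.coe_smul] at this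
    exact this.symm
  have h2 : T x = ∑ i, L ⟨x, hx⟩ i • T (b i : V) := by
    conv_lhs => rw [h1]
    simp
  rw [h2, mul_right_comm, Finset.mul_sum]
  refine (norm_sum_le _ _).trans (Finset.sum_le_sum fun i _ => ?_)
  rw [norm_smul]
  refine mul_le_mul_of_nonneg_right ?_ (norm_nonneg _)
  exact (norm_le_pi_norm (L ⟨x, hx⟩) i).trans (L.le_opNorm _)

theorem exists_word_bound_on_slow [FiniteDimensional ℝ V] (hp : IsWeight p) {E : Submodule ℝ V}
    (hE : E ≤ slow hp A) (τ : ℝ) (hτ : 0 < τ) : ∃ C, 0 ≤ C ∧ ∀ n : ℕ, ∃ ρ : (Fin n → ι) → ℝ,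
      (∀ ω, 0 ≤ ρ ω) ∧ (∀ ω, ∀ x ∈ E, ‖word A ω x‖ ≤ ρ ω * ‖x‖) ∧
      ∑ ω : Fin n → ι, (∏ i, p (ω i)) * log⁺ (ρ ω) ≤ τ * n + C := by
  obtain ⟨r, e, C₀, he, hC₀, hb⟩ := exists_spanning_bound E
  have : ∀ i, ∃ C, ∀ n : ℕ, walk p A n (fun x => log⁺ ‖x‖) (e i) ≤ τ / (r + 1) * n + C :=
    fun i => hE (he i) _ (by positivity)
  choose C hC using this
  refine ⟨|log⁺ C₀ + log r + ∑ i, C i|, abs_nonneg _, fun n =>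
    ⟨fun ω => C₀ * ∑ i, ‖word A ω (e i)‖,
    fun ω => by positivity, fun ω x hx => hb _ x hx, ?_⟩⟩
  calc ∑ ω : Fin n → ι, (∏ i, p (ω i)) * log⁺ (C₀ * ∑ i, ‖word A ω (e i)‖)
      ≤ ∑ ω : Fin n → ι, ((∏ i, p (ω i)) * (log⁺ C₀ + log r) +
          ∑ i, (∏ i, p (ω i)) * log⁺ ‖word A ω (e i)‖) := by
        refine Finset.sum_le_sum fun ω _ => ?_
        rw [← Finset.mul_sum, ← mul_add]
        refine mul_le_mul_of_nonneg_left ?_ (Finset.prod_nonneg fun i _ => (hp.pos _).le)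
        have h1 := posLog_mul (x := C₀) (y := ∑ i, ‖word A ω (e i)‖)
        have h2 := posLog_sum Finset.univ (fun i => ‖word A ω (e i)‖)
        simp only [Finset.card_univ, Fintype.card_fin] at h2
        linarith
    _ = log⁺ C₀ + log r + ∑ i, walk p A n (fun x => log⁺ ‖x‖) (e i) := by
        rw [Finset.sum_add_distrib, ← Finset.sum_mul, sum_weight_word hp, one_mul,
          Finset.sum_comm]
        simp only [walk_eq_sum_word]
    _ ≤ log⁺ C₀ + log r + ∑ i, (τ / (r + 1) * n + C i) := by
        gcongr with i
        exact hC i n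
    _ = log⁺ C₀ + log r + ∑ i, C i + r / (r + 1) * (τ * n) := by
        rw [Finset.sum_add_distrib]
        simp
        ring
    _ ≤ |log⁺ C₀ + log r + ∑ i, C i| + 1 * (τ * n) := by
        gcongr
        · exact le_abs_self _
        · rw [div_le_one (by positivity)]; linarith
    _ = _ := by ring

end Slow

open Real in
theorem norm_word_le {ι V : Type*} [NormedAddCommGroup V] [NormedSpace ℝ V]
    {A : ι → V →L[ℝ] V} {K : ℝ} (hK0 : 0 ≤ K) (hK : ∀ i v, ‖A i v‖ ≤ K * ‖v‖) {n : ℕ}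
    (ω : Fin n → ι) (v : V) : ‖word A ω v‖ ≤ K ^ n * ‖v‖ := by
  induction n generalizing v with
  | zero => simp [word]
  | succ n ih =>
    have h1 := ih (fun i => ω i.succ) (A (ω 0) v)
    have h2 := mul_le_mul_of_nonneg_left (hK (ω 0) v) (pow_nonneg hK0 n)
    have h3 : word A ω v = word A (fun i => ω i.succ) (A (ω 0) v) := by simp [word]
    rw [h3, pow_succ, mul_assoc]
    exact h1.trans h2

section SlowExtension

open Real

variable {ι V : Type*} [Fintype ι] [NormedAddCommGroup V] [NormedSpace ℝ V]
  {p : ι → ℝ} {A : ι → V →L[ℝ] V}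

theorem walk_block_le (hp : IsWeight p) {E : Submodule ℝ V} {P : V →L[ℝ] V}
    (hP : ∀ x, x - P x ∈ E) {K : ℝ} (hK1 : 1 ≤ K) (hK : ∀ i v, ‖A i v‖ ≤ K * ‖v‖) {N : ℕ}
    {ρ : (Fin N → ι) → ℝ} (hρ0 : ∀ ω, 0 ≤ ρ ω)
    (hρ : ∀ ω, ∀ x ∈ E, ‖word A ω x‖ ≤ ρ ω * ‖x‖) (x : V) :
    walk p A N (fun x => log⁺ ((K ^ N)⁻¹ * ‖x‖)) x ≤
      log⁺ ((K ^ N)⁻¹ * ‖x‖) + log⁺ ‖P x‖ +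
        (log 2 + log⁺ (1 + ‖P‖) + ∑ ω : Fin N → ι, (∏ i, p (ω i)) * log⁺ (ρ ω)) := by
  have hR : 0 < K ^ N := by positivity
  rw [walk_eq_sum_word]
  have key : ∀ ω : Fin N → ι, log⁺ ((K ^ N)⁻¹ * ‖word A ω x‖) ≤
      (log⁺ ((K ^ N)⁻¹ * ‖x‖) + log⁺ ‖P x‖ + (log 2 + log⁺ (1 + ‖P‖))) + log⁺ (ρ ω) := fun ω => by
    have h1 : ‖word A ω x‖ ≤ ρ ω * ((1 + ‖P‖) * ‖x‖) + K ^ N * ‖P x‖ := by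
      have e1 : word A ω x = word A ω (x - P x) + word A ω (P x) := by rw [map_sub]; abel
      have e2 : ‖x - P x‖ ≤ (1 + ‖P‖) * ‖x‖ := by
        have := norm_sub_le x (P x)
        have := P.le_opNorm x
        linarith
      rw [e1]
      refine (norm_add_le _ _).trans (add_le_add ((hρ ω _ (hP x)).trans ?_)
        (norm_word_le (by linarith) hK ω _))
      exact mul_le_mul_of_nonneg_left e2 (hρ0 ω)
    have h2 : (K ^ N)⁻¹ * ‖word A ω x‖ ≤
        ρ ω * ((1 + ‖P‖) * ((K ^ N)⁻¹ * ‖x‖)) + ‖P x‖ := by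
      calc _ ≤ (K ^ N)⁻¹ * (ρ ω * ((1 + ‖P‖) * ‖x‖) + K ^ N * ‖P x‖) := by gcongr
        _ = _ := by field_simp
    have h3 := posLog_le_posLog (by positivity) h2
    have h4 := posLog_add (x := ρ ω * ((1 + ‖P‖) * ((K ^ N)⁻¹ * ‖x‖))) (y := ‖P x‖)
    have h5 := posLog_mul (x := ρ ω) (y := (1 + ‖P‖) * ((K ^ N)⁻¹ * ‖x‖))
    have h6 := posLog_mul (x := 1 + ‖P‖) (y := (K ^ N)⁻¹ * ‖x‖)
    linarith
  calc _ ≤ ∑ ω : Fin N → ι, ((∏ i, p (ω i)) *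
        (log⁺ ((K ^ N)⁻¹ * ‖x‖) + log⁺ ‖P x‖ + (log 2 + log⁺ (1 + ‖P‖))) +
        (∏ i, p (ω i)) * log⁺ (ρ ω)) := by
        refine Finset.sum_le_sum fun ω _ => ?_
        rw [← mul_add]
        exact mul_le_mul_of_nonneg_left (key ω) (Finset.prod_nonneg fun i _ => (hp.pos _).le)
    _ = _ := by rw [Finset.sum_add_distrib, ← Finset.sum_mul, sum_weight_word hp]; ring

/-- If the walk is slow along `ker P` and its projection by `P` is slow, then it is slow. -/
theorem mem_slow_of_proj [FiniteDimensional ℝ V] (hp : IsWeight p) {P : V →L[ℝ] V}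
    (hP : ∀ x, x - P x ∈ slow hp A) {v : V}
    (hv : ∀ τ > 0, ∃ C, ∀ n : ℕ, walk p A n (fun x => log⁺ ‖P x‖) v ≤ τ * n + C) :
    v ∈ slow hp A := by
  obtain ⟨K, hK1, hK⟩ := exists_norm_le A
  refine isSlow_of_multiples hp fun σ hσ => ?_
  obtain ⟨q, hq⟩ := exists_nat_ge (log⁺ K / (σ / 3) + 1)
  have hq1 : (1 : ℝ) ≤ q := by
    have : 0 ≤ log⁺ K / (σ / 3) := div_nonneg posLog_nonneg (by positivity)
    linarith
  have hqK : log⁺ K ≤ σ / 3 * q := by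
    rw [← div_le_iff₀' (by positivity)]
    linarith
  obtain ⟨C, hC0, hC⟩ := exists_word_bound_on_slow hp (le_refl (slow hp A)) (σ / 3) (by positivity)
  obtain ⟨D, hD⟩ := hv (σ / (3 * q)) (by positivity)
  refine ⟨q, by exact_mod_cast hq1, log⁺ ‖v‖ + q * (log 2 + log⁺ (1 + ‖P‖) + C + D),
    fun N => ?_⟩
  obtain ⟨ρ, hρ0, hρ, hρs⟩ := hC N
  have hR : 1 ≤ K ^ N := one_le_pow₀ hK1
  set F : V → ℝ := fun x => log⁺ ((K ^ N)⁻¹ * ‖x‖) with hF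
  have hblock := walk_block_le hp hP hK1 hK hρ0 hρ
  have hind : ∀ j : ℕ, j ≤ q → walk p A (j * N) F v ≤ F v + j *
      (log 2 + log⁺ (1 + ‖P‖) + (σ / 3 * N + C) + (σ / (3 * q) * (q * N) + D)) := by
    intro j
    induction j with
    | zero => intro _; simp
    | succ j ih =>
      intro hj
      have h1 := walk_mono (A := A) hp hblock (j * N) v
      rw [← walk_add_time, walk_add_fun, walk_const hp, walk_add_fun] at h1
      have h2 := hD (j * N)
      have h3 := ih (by omega)
      have h4 : σ / (3 * q) * ((j * N : ℕ) : ℝ) ≤ σ / (3 * q) * (q * N) := by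
        have : (j : ℝ) ≤ q := by exact_mod_cast (by omega : j ≤ q)
        push_cast
        gcongr
      rw [Nat.succ_mul]
      push_cast
      have h5 : walk p A (j * N + N) F v ≤ walk p A (j * N) F v +
        walk p A (j * N) (fun x => log⁺ ‖P x‖) v +
        (log 2 + log⁺ (1 + ‖P‖) + ∑ ω : Fin N → ι, (∏ i, p (ω i)) * log⁺ (ρ ω)) := h1
      linarith
  have h1 := hind q le_rfl
  have h2 : walk p A (q * N) (fun x => log⁺ ‖x‖) v ≤ N * log⁺ K + walk p A (q * N) F v := by
    have := walk_mono (A := A) hp (f := fun x => log⁺ ‖x‖) (g := fun x => N * log⁺ K + F x)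
      (fun x => by
        have := posLog_mul (x := K ^ N) (y := (K ^ N)⁻¹ * ‖x‖)
        rw [mul_inv_cancel_left₀ (by positivity), posLog_pow] at this
        exact this) (q * N) v
    rwa [walk_add_fun, walk_const hp] at this
  have h3 : F v ≤ log⁺ ‖v‖ := posLog_le_posLog (by positivity)
    (mul_le_of_le_one_left (norm_nonneg _) (inv_le_one_of_one_le₀ hR))
  have h4 : (N : ℝ) * log⁺ K ≤ N * (σ / 3 * q) := by gcongr
  have h5 : (q : ℝ) * (log 2 + log⁺ (1 + ‖P‖) + (σ / 3 * N + C) + (σ / (3 * q) * (q * N) + D)) =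
      q * (log 2 + log⁺ (1 + ‖P‖) + C + D) + 2 * (N * (σ / 3 * q)) := by
    field_simp
    ring
  have h6 : σ * ((q * N : ℕ) : ℝ) = 3 * (N * (σ / 3 * q)) := by push_cast; ring
  linarith

end SlowExtension

section Drift

open Real

theorem exists_abs_log_norm_sub_le {ι V : Type*} [Fintype ι] [NormedAddCommGroup V]
    [NormedSpace ℝ V] [FiniteDimensional ℝ V] {A : ι → V →L[ℝ] V}
    (hA : ∀ i, Function.Injective (A i)) :
    ∃ κ : ℝ, 1 ≤ κ ∧ ∀ i v, v ≠ 0 → |log ‖A i v‖ - log ‖v‖| ≤ κ := by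
  have h1 : ∀ i, ∃ K : NNReal, 0 < K ∧ AntilipschitzWith K (A i) := fun i =>
    (A i).toLinearMap.exists_antilipschitzWith (LinearMap.ker_eq_bot.2 (hA i))
  choose K hK0 hK using h1
  obtain ⟨L, hL1, hL⟩ := exists_norm_le A
  have hs : ∀ i, |log (K i)| ≤ ∑ i, |log (K i)| := fun i =>
    Finset.single_le_sum (f := fun i => |log (K i : ℝ)|) (fun _ _ => abs_nonneg _)
      (Finset.mem_univ i)
  have hLl := log_nonneg hL1
  have hs0 : 0 ≤ ∑ i, |log (K i : ℝ)| := Finset.sum_nonneg fun _ _ => abs_nonneg _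
  refine ⟨1 + log L + ∑ i, |log (K i)|, by linarith, fun i v hv => ?_⟩
  have hv0 : 0 < ‖v‖ := norm_pos_iff.2 hv
  have hAv : 0 < ‖A i v‖ := norm_pos_iff.2 fun h => hv (hA i (h.trans (map_zero _).symm))
  have h2 : ‖v‖ ≤ K i * ‖A i v‖ := by
    simpa [dist_eq_norm] using (hK i).le_mul_dist v 0
  have h3 := log_le_log hv0 h2
  have hKi : (0 : ℝ) < K i := hK0 i
  rw [log_mul hKi.ne' hAv.ne'] at h3
  have h4 := log_le_log hAv (hL i v)
  rw [log_mul (by positivity) hv0.ne'] at h4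
  have := le_abs_self (log (K i : ℝ))
  have := hs i
  rw [abs_le]
  constructor <;> linarith

theorem abs_log_norm_word_sub_le {ι V : Type*} [NormedAddCommGroup V] [NormedSpace ℝ V]
    {A : ι → V →L[ℝ] V} (hA : ∀ i, Function.Injective (A i)) {κ : ℝ}
    (hκ : ∀ i v, v ≠ 0 → |log ‖A i v‖ - log ‖v‖| ≤ κ) {n : ℕ} (ω : Fin n → ι) {v : V}
    (hv : v ≠ 0) : |log ‖word A ω v‖ - log ‖v‖| ≤ n * κ := by
  induction n generalizing v with
  | zero => simp [word]
  | succ n ih =>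
    have h0 : A (ω 0) v ≠ 0 := fun h => hv (hA _ (h.trans (map_zero _).symm))
    have h1 := ih (fun i => ω i.succ) h0
    have h2 := hκ (ω 0) v hv
    have h3 : word A ω v = word A (fun i => ω i.succ) (A (ω 0) v) := by simp [word]
    rw [h3]
    push_cast
    rw [abs_le] at *
    constructor <;> linarith [h1.1, h1.2, h2.1, h2.2]

theorem apply_ne_zero_of_injective {ι V : Type*} [NormedAddCommGroup V] [NormedSpace ℝ V]
    {A : ι → V →L[ℝ] V} (hA : ∀ i, Function.Injective (A i)) (i : ι) (v : V)
    (hv : v ∈ {v : V | v ≠ 0}) : A i v ∈ {v : V | v ≠ 0} :=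
  fun h => hv (hA i (h.trans (map_zero _).symm))

variable {ι V : Type*} [Fintype ι] [NormedAddCommGroup V] [NormedSpace ℝ V]
  {p : ι → ℝ} {A : ι → V →L[ℝ] V}

theorem walk_exp_log_le (hp : IsWeight p) {N : ℕ} {M s ε : ℝ} (hs : 0 ≤ s) (hsM : s * M ≤ 1) {v : V}
    (hM : ∀ ω : Fin N → ι, |log ‖word A ω v‖ - log ‖v‖| ≤ M)
    (hlow : log ‖v‖ - N * ε ≤ walk p A N (fun x => log ‖x‖) v) :
    walk p A N (fun x => exp (-s * log ‖x‖)) v ≤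
      exp (s * N * ε + (s * M) ^ 2) * exp (-s * log ‖v‖) := by
  rw [walk_eq_sum_word] at hlow ⊢
  have h1 : ∀ ω : Fin N → ι, exp (-s * log ‖word A ω v‖) ≤
      exp (-s * log ‖v‖) * ((1 + s * log ‖v‖ + (s * M) ^ 2) + -s * log ‖word A ω v‖) := fun ω => by
    have e1 : exp (-s * log ‖word A ω v‖) = exp (-s * log ‖v‖) *
        exp (-s * (log ‖word A ω v‖ - log ‖v‖)) := by rw [← exp_add]; ring_nf
    have e2 : |-s * (log ‖word A ω v‖ - log ‖v‖)| ≤ s * M := by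
      rw [abs_mul, abs_neg, abs_of_nonneg hs]
      exact mul_le_mul_of_nonneg_left (hM ω) hs
    have e3 := abs_exp_sub_one_sub_id_le (e2.trans hsM)
    have e4 := (abs_le.1 e3).2
    have e5 : (-s * (log ‖word A ω v‖ - log ‖v‖)) ^ 2 ≤ (s * M) ^ 2 := by
      rw [← sq_abs]
      exact pow_le_pow_left₀ (abs_nonneg _) e2 2
    rw [e1]
    refine mul_le_mul_of_nonneg_left ?_ (exp_pos _).le
    linarith
  calc _ ≤ ∑ ω : Fin N → ι, (∏ i, p (ω i)) * (exp (-s * log ‖v‖) *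
        ((1 + s * log ‖v‖ + (s * M) ^ 2) + -s * log ‖word A ω v‖)) :=
        Finset.sum_le_sum fun ω _ => mul_le_mul_of_nonneg_left (h1 ω)
          (Finset.prod_nonneg fun i _ => (hp.pos _).le)
    _ = exp (-s * log ‖v‖) * ((∑ ω : Fin N → ι, ∏ i, p (ω i)) *
        (1 + s * log ‖v‖ + (s * M) ^ 2) +
        -s * ∑ ω : Fin N → ι, (∏ i, p (ω i)) * log ‖word A ω v‖) := by
        rw [Finset.sum_mul, Finset.mul_sum, ← Finset.sum_add_distrib, Finset.mul_sum]
        exact Finset.sum_congr rfl fun ω _ => by ring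
    _ ≤ exp (-s * log ‖v‖) * exp (s * N * ε + (s * M) ^ 2) := by
        rw [sum_weight_word hp]
        refine mul_le_mul_of_nonneg_left ?_ (exp_pos _).le
        have := add_one_le_exp (s * N * ε + (s * M) ^ 2)
        have := mul_le_mul_of_nonneg_left hlow hs
        linarith
    _ = _ := mul_comm _ _

theorem walk_iterate_le (hp : IsWeight p) {T : Set V} (hT : ∀ i, ∀ v ∈ T, A i v ∈ T) {N : ℕ}
    {f : V → ℝ} {c : ℝ} (hf : ∀ v ∈ T, walk p A N f v ≤ exp c * f v) (j : ℕ) {v : V} (hv : v ∈ T) :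
    walk p A (N * j) f v ≤ exp (j * c) * f v := by
  induction j with
  | zero => simp
  | succ j ih =>
    have h1 := walk_mono_on hp hT hf (N * j) hv
    rw [← walk_add_time, walk_const_mul] at h1
    refine h1.trans ((mul_le_mul_of_nonneg_left ih (exp_pos _).le).trans_eq ?_)
    rw [← mul_assoc, ← exp_add]
    push_cast
    ring_nf

theorem mul_posLog_sub_log_le {s b x : ℝ} (hb : 0 ≤ b) :
    s * (log⁺ x - log x) ≤ exp (-b) * exp (-s * log x) + b := by
  rw [show log⁺ x = max 0 (log x) from rfl, ← exp_add]
  have h1 := add_one_le_exp (-b + -s * log x)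
  have h2 := exp_pos (-b + -s * log x)
  rcases max_cases 0 (log x) with ⟨h, _⟩ | ⟨h, _⟩ <;> rw [h] <;> linarith

/-- If the mean logarithmic size of the walk never exceeds its initial value and there is
asymptotically no negative drift from any position, then the walk is slow. -/
theorem isSlow_of_drift [FiniteDimensional ℝ V] (hp : IsWeight p)
    (hA : ∀ i, Function.Injective (A i)) {v : V} (hv : v ≠ 0)
    (hup : ∀ k : ℕ, walk p A k (fun x => log ‖x‖) v ≤ log ‖v‖)
    (hlow : ∀ ε > 0, ∃ N : ℕ, 1 ≤ N ∧ ∀ w, w ≠ 0 →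
      log ‖w‖ - N * ε ≤ walk p A N (fun x => log ‖x‖) w) : IsSlow p A v := by
  obtain ⟨κ, hκ1, hκ⟩ := exists_abs_log_norm_sub_le hA
  refine isSlow_of_multiples hp fun τ hτ => ?_
  obtain ⟨N, hN1, hN⟩ := hlow (τ / 2) (by positivity)
  have hN0 : (0 : ℝ) < N := by exact_mod_cast hN1
  set M := N * κ with hM
  have hM0 : 0 < M := by positivity
  obtain ⟨s, hs0, hs1, hs2⟩ : ∃ s : ℝ, 0 < s ∧ s * M ≤ 1 ∧ s * M ^ 2 ≤ N * (τ / 2) := by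
    refine ⟨min (1 / M) (N * (τ / 2) / M ^ 2), by positivity, ?_, ?_⟩
    · rw [← le_div_iff₀ hM0]; exact min_le_left _ _
    · rw [← le_div_iff₀ (by positivity)]; exact min_le_right _ _
  refine ⟨N, hN1, log ‖v‖ + s⁻¹ * exp (-s * log ‖v‖), fun j => ?_⟩
  have hT := apply_ne_zero_of_injective hA
  set c := s * N * (τ / 2) + (s * M) ^ 2 with hc
  have hc0 : 0 ≤ c := by positivity
  have h1 := walk_iterate_le (A := A) (p := p) hp hT (N := N) (f := fun x => exp (-s * log ‖x‖))
    (c := c) (fun w hw => walk_exp_log_le hp hs0.le hs1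
      (fun ω => abs_log_norm_word_sub_le hA hκ ω hw) (hN w hw)) j hv
  have h2 := walk_mono (A := A) hp (fun x : V => mul_posLog_sub_log_le (s := s) (x := ‖x‖)
    (by positivity : 0 ≤ j * c)) (N * j) v
  rw [walk_const_mul, walk_add_fun, walk_const_mul, walk_const hp] at h2
  simp only [sub_eq_add_neg, ← neg_one_mul (log ‖_‖)] at h2
  rw [walk_add_fun, walk_const_mul] at h2
  have h3 := mul_le_mul_of_nonneg_left h1 (exp_pos (-(j * c))).le
  rw [← mul_assoc, ← exp_add, neg_add_cancel, exp_zero, one_mul] at h3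
  have h4 := hup (N * j)
  have h5 : s * walk p A (N * j) (fun x => log⁺ ‖x‖) v ≤
      s * (τ * (N * j : ℕ) + (log ‖v‖ + s⁻¹ * exp (-s * log ‖v‖))) := by
    have e1 : (j : ℝ) * c ≤ s * (τ * (N * j)) := by
      have := mul_le_mul_of_nonneg_left hs2 (by positivity : 0 ≤ j * s)
      rw [hc]
      linarith
    have e2 := mul_le_mul_of_nonneg_left h4 hs0.le
    rw [mul_add, mul_add, mul_inv_cancel_left₀ hs0.ne']
    push_cast
    linarith
  exact le_of_mul_le_mul_left h5 hs0

end Drift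

theorem word_smul {ι V : Type*} [NormedAddCommGroup V] [NormedSpace ℝ V] (A : ι → V →L[ℝ] V)
    (c : ℝ) {n : ℕ} (ω : Fin n → ι) (v : V) :
    word (fun i => c • A i) ω v = c ^ n • word A ω v := by
  induction n generalizing v with
  | zero => simp [word]
  | succ n ih =>
    have h : ∀ B : ι → V →L[ℝ] V, word B ω v = word B (fun i => ω i.succ) (B (ω 0) v) :=
      fun B => by simp [word]
    rw [h, h, ih, smul_apply, map_smul, smul_smul, pow_succ]

section PositiveDrift

open Real

variable {ι V : Type*} [Fintype ι] [NormedAddCommGroup V] [NormedSpace ℝ V]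
  {p : ι → ℝ} {A : ι → V →L[ℝ] V}

theorem walk_log_norm_smul (hp : IsWeight p) (hA : ∀ i, Function.Injective (A i)) {c : ℝ}
    (hc : c ≠ 0) (n : ℕ) {v : V} (hv : v ≠ 0) :
    walk p A n (fun x => log ‖x‖) (c • v) = walk p A n (fun x => log ‖x‖) v + log |c| := by
  induction n generalizing v with
  | zero =>
    simp only [walk_zero, norm_smul, norm_eq_abs]
    rw [log_mul (abs_ne_zero.2 hc) (norm_ne_zero_iff.2 hv), add_comm]
  | succ n ih =>
    simp only [walk_succ, map_smul]
    rw [← one_mul (log |c|), ← hp.sum_eq, Finset.sum_mul, ← Finset.sum_add_distrib]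
    refine Finset.sum_congr rfl fun i _ => ?_
    rw [ih (apply_ne_zero_of_injective hA i v hv), mul_add]

theorem walk_smul_log_norm (hp : IsWeight p) (hA : ∀ i, Function.Injective (A i)) {c : ℝ}
    (hc : c ≠ 0) (n : ℕ) {v : V} (hv : v ≠ 0) :
    walk p (fun i => c • A i) n (fun x => log ‖x‖) v =
      walk p A n (fun x => log ‖x‖) v + n * log |c| := by
  induction n generalizing v with
  | zero => simp
  | succ n ih =>
    simp only [walk_succ, smul_apply]
    rw [← one_mul (((n + 1 : ℕ) : ℝ) * log |c|), ← hp.sum_eq, Finset.sum_mul,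
      ← Finset.sum_add_distrib]
    refine Finset.sum_congr rfl fun i _ => ?_
    have h := apply_ne_zero_of_injective hA i v hv
    rw [ih (smul_ne_zero hc h), walk_log_norm_smul hp hA hc n h]
    push_cast
    ring

theorem abs_walk_log_norm_sub_le (hp : IsWeight p) (hA : ∀ i, Function.Injective (A i)) {κ : ℝ}
    (hκ : ∀ i v, v ≠ 0 → |log ‖A i v‖ - log ‖v‖| ≤ κ) (n : ℕ) {v : V} (hv : v ≠ 0) :
    |walk p A n (fun x => log ‖x‖) v - log ‖v‖| ≤ n * κ := by
  have h0 := sum_weight_word hp n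
  rw [walk_eq_sum_word, ← one_mul (log ‖v‖), ← one_mul (n * κ), ← h0, Finset.sum_mul,
    ← Finset.sum_sub_distrib, Finset.sum_mul]
  refine (Finset.abs_sum_le_sum_abs _ _).trans (Finset.sum_le_sum fun ω _ => ?_)
  have hnn : 0 ≤ ∏ i, p (ω i) := Finset.prod_nonneg fun i _ => (hp.pos _).le
  rw [← mul_sub, abs_mul, abs_of_nonneg hnn]
  exact mul_le_mul_of_nonneg_left (abs_log_norm_word_sub_le hA hκ ω hv) hnn

theorem tendsto_walk_log_norm {α : Type*} {F : Filter α} {p' : α → ι → ℝ}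
    {A' : α → ι → V →L[ℝ] V} {v' : α → V} {v : V} (hA : ∀ i, Function.Injective (A i))
    (hp' : Tendsto p' F (𝓝 p)) (hA' : Tendsto A' F (𝓝 A)) (hv' : Tendsto v' F (𝓝 v))
    (hv : v ≠ 0) (n : ℕ) :
    Tendsto (fun a => walk (p' a) (A' a) n (fun x => log ‖x‖) (v' a)) F
      (𝓝 (walk p A n (fun x => log ‖x‖) v)) := by
  induction n generalizing v v' with
  | zero => exact hv'.norm.log (norm_ne_zero_iff.2 hv)
  | succ n ih =>
    refine tendsto_finsetSum _ fun i _ => ((tendsto_pi_nhds.1 hp' i).mul ?_)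
    exact ih ((isBoundedBilinearMap_apply.continuous.tendsto (A i, v)).comp
      ((tendsto_pi_nhds.1 hA' i).prodMk_nhds hv')) (apply_ne_zero_of_injective hA i v hv)

theorem walk_log_norm_ge_of_stopping (hp : IsWeight p)
    (hA : ∀ i, Function.Injective (A i)) {κ : ℝ} (hκ0 : 0 ≤ κ)
    (hκ : ∀ i v, v ≠ 0 → |log ‖A i v‖ - log ‖v‖| ≤ κ) {K : ℕ} {r : ℝ}
    (h : ∀ v : V, v ≠ 0 → ∃ k, 1 ≤ k ∧ k ≤ K ∧
      log ‖v‖ + k * r ≤ walk p A k (fun x => log ‖x‖) v) (n : ℕ) {v : V} (hv : v ≠ 0) :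
    log ‖v‖ + n * r - K * (κ + |r|) ≤ walk p A n (fun x => log ‖x‖) v := by
  induction n using Nat.strong_induction_on generalizing v with
  | _ n ih =>
    obtain ⟨k, hk1, hkK, hk⟩ := h v hv
    rcases lt_or_ge n k with hn | hn
    · have h1 := (abs_le.1 (abs_walk_log_norm_sub_le hp hA hκ n hv)).1
      have h2 : (n : ℝ) ≤ K := by exact_mod_cast (hn.le.trans hkK)
      have h3 : (n : ℝ) * (κ + r) ≤ K * (κ + |r|) :=
        (mul_le_mul_of_nonneg_left (by linarith [le_abs_self r]) n.cast_nonneg).trans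
          (mul_le_mul_of_nonneg_right h2 (by positivity))
      linarith
    · obtain ⟨m, rfl⟩ := Nat.exists_eq_add_of_le hn
      have h1 := walk_mono_on (p := p) hp (apply_ne_zero_of_injective hA)
        (f := fun x => log ‖x‖ + (m * r - K * (κ + |r|))) (fun w hw => by
          have := ih m (by omega) hw
          linarith) k hv
      rw [walk_add_fun, walk_const hp, ← walk_add_time] at h1
      push_cast
      linarith

/-- If no direction grows slowly, the mean logarithmic size increases uniformly, after some fixed
number of steps. -/
theorem exists_positive_drift [FiniteDimensional ℝ V] (hp : IsWeight p)
    (hA : ∀ i, Function.Injective (A i)) (hslow : slow hp A = ⊥) :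
    ∃ N : ℕ, 1 ≤ N ∧ ∃ c > 0, ∀ v, v ≠ 0 → log ‖v‖ + c ≤ walk p A N (fun x => log ‖x‖) v := by
  by_cases hex : ∃ v : V, v ≠ 0
  swap
  · push Not at hex
    exact ⟨1, le_rfl, 1, one_pos, fun v hv => (hv (hex v)).elim⟩
  obtain ⟨κ, hκ1, hκ⟩ := exists_abs_log_norm_sub_le hA
  set S : Set ℝ := {r | ∃ N : ℕ, 1 ≤ N ∧ ∀ v : V, v ≠ 0 →
    log ‖v‖ + N * r ≤ walk p A N (fun x => log ‖x‖) v} with hS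
  have hSne : S.Nonempty := ⟨-κ, 1, le_rfl, fun v hv => by
    have := (abs_le.1 (abs_walk_log_norm_sub_le hp hA hκ 1 hv)).1
    linarith⟩
  have hSbdd : BddAbove S := by
    obtain ⟨v, hv⟩ := hex
    refine ⟨κ, ?_⟩
    rintro r ⟨N, hN, h⟩
    have h1 := h v hv
    have h2 := (abs_le.1 (abs_walk_log_norm_sub_le hp hA hκ N hv)).2
    have h3 : (0 : ℝ) < N := by exact_mod_cast hN
    exact le_of_mul_le_mul_left (by linarith) h3
  by_contra! hcon
  have hS0 : ∀ r ∈ S, r ≤ 0 := by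
    rintro r ⟨N, hN, h⟩
    by_contra! hr
    obtain ⟨v, hv, h'⟩ := hcon N hN (N * r) (by
      have h3 : (0 : ℝ) < N := by exact_mod_cast hN
      positivity)
    exact (h v hv).not_gt h'
  set ℓ := sSup S with hℓ
  have hℓ0 : ℓ ≤ 0 := csSup_le hSne hS0
  obtain ⟨v, hv, hvk⟩ : ∃ v : V, v ≠ 0 ∧ ∀ k : ℕ,
      walk p A k (fun x => log ‖x‖) v ≤ log ‖v‖ + k * ℓ := by
    by_contra! hno
    have hloc : ∃ K : ℕ, ∃ ε > 0, ∀ v ∈ Metric.sphere (0 : V) 1, ∃ k : ℕ, 1 ≤ k ∧ k ≤ K ∧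
        k * (ℓ + ε) ≤ walk p A k (fun x => log ‖x‖) v := by
      refine (isCompact_sphere (0 : V) 1).induction_on
        (p := fun U => ∃ K : ℕ, ∃ ε > 0, ∀ v ∈ U, ∃ k : ℕ, 1 ≤ k ∧ k ≤ K ∧
          k * (ℓ + ε) ≤ walk p A k (fun x => log ‖x‖) v) ⟨0, 1, one_pos, by simp⟩ ?_ ?_ ?_
      · rintro s t hst ⟨K, ε, hε, h⟩
        exact ⟨K, ε, hε, fun v hv => h v (hst hv)⟩
      · rintro s t ⟨K, ε, hε, h⟩ ⟨K', ε', hε', h'⟩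
        refine ⟨max K K', min ε ε', lt_min hε hε', fun v hv => ?_⟩
        rcases hv with hv | hv
        · obtain ⟨k, hk1, hk2, hk3⟩ := h v hv
          refine ⟨k, hk1, hk2.trans (le_max_left _ _), le_trans ?_ hk3⟩
          gcongr
          exact min_le_left _ _
        · obtain ⟨k, hk1, hk2, hk3⟩ := h' v hv
          refine ⟨k, hk1, hk2.trans (le_max_right _ _), le_trans ?_ hk3⟩
          gcongr
          exact min_le_right _ _
      · intro v hv
        have hv1 : ‖v‖ = 1 := by simpa using hv
        have hv0 : v ≠ 0 := norm_ne_zero_iff.1 (by rw [hv1]; exact one_ne_zero)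
        obtain ⟨k, hk⟩ := hno v hv0
        rw [hv1, log_one, zero_add] at hk
        have hk1 : 1 ≤ k := by
          rw [Nat.one_le_iff_ne_zero]
          rintro rfl
          simp [hv1] at hk
        have hk0 : (0 : ℝ) < k := by exact_mod_cast hk1
        set φ := walk p A k (fun x => log ‖x‖) with hφ
        have hφc : ContinuousAt φ v :=
          tendsto_walk_log_norm (p' := fun _ => p) (A' := fun _ => A) (v' := fun w => w)
            hA tendsto_const_nhds tendsto_const_nhds tendsto_id hv0 k
        set ε := (φ v - k * ℓ) / (2 * k) with hε
        have hε0 : 0 < ε := div_pos (by linarith) (by positivity)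
        have hεv : k * (ℓ + ε) < φ v := by
          have : k * ε = (φ v - k * ℓ) / 2 := by rw [hε]; field_simp
          rw [mul_add, this]
          linarith
        refine ⟨{w | k * (ℓ + ε) ≤ φ w}, mem_nhdsWithin_of_mem_nhds
          ((hφc.eventually_const_le hεv)), k, ε, hε0, fun w hw => ⟨k, hk1, le_rfl, hw⟩⟩
    obtain ⟨K, ε, hε, hK⟩ := hloc
    have hst : ∀ v : V, v ≠ 0 → ∃ k, 1 ≤ k ∧ k ≤ K ∧
        log ‖v‖ + k * (ℓ + ε) ≤ walk p A k (fun x => log ‖x‖) v := by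
      intro v hv
      have hn : ‖v‖ ≠ 0 := norm_ne_zero_iff.2 hv
      obtain ⟨k, hk1, hk2, hk3⟩ := hK (‖v‖⁻¹ • v) (by
        rw [mem_sphere_zero_iff_norm, norm_smul, norm_inv, norm_norm, inv_mul_cancel₀ hn])
      refine ⟨k, hk1, hk2, ?_⟩
      rw [walk_log_norm_smul hp hA (inv_ne_zero hn) k hv, abs_inv, abs_norm, log_inv] at hk3
      linarith
    obtain ⟨n, hn⟩ := exists_nat_ge (max 1 (K * (κ + |ℓ + ε|) / (ε / 2)))
    have hn1 : 1 ≤ n := by exact_mod_cast (le_max_left _ _).trans hn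
    have hn2 : K * (κ + |ℓ + ε|) ≤ n * (ε / 2) := by
      rw [← div_le_iff₀ (by positivity)]
      exact (le_max_right _ _).trans hn
    have hmem : ℓ + ε / 2 ∈ S := ⟨n, hn1, fun v hv => by
      have := walk_log_norm_ge_of_stopping hp hA (by linarith) hκ hst n hv
      linarith⟩
    have := le_csSup hSbdd hmem
    linarith
  have hc : exp (-ℓ) ≠ 0 := (exp_pos _).ne'
  have hB : ∀ i, Function.Injective (exp (-ℓ) • A i) := fun i =>
    (smul_right_injective V hc).comp (hA i)
  have hwB : ∀ (n : ℕ) (w : V), w ≠ 0 → walk p (fun i => exp (-ℓ) • A i) n (fun x => log ‖x‖) w =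
      walk p A n (fun x => log ‖x‖) w - n * ℓ := fun n w hw => by
    rw [walk_smul_log_norm hp hA hc n hw, abs_of_pos (exp_pos _), log_exp]
    ring
  have hvB : IsSlow p (fun i => exp (-ℓ) • A i) v := by
    refine isSlow_of_drift hp hB hv (fun k => ?_) fun ε hε => ?_
    · rw [hwB k v hv]
      linarith [hvk k]
    · obtain ⟨r, ⟨N, hN1, hN⟩, hr⟩ := exists_lt_of_lt_csSup hSne (by linarith : ℓ - ε < sSup S)
      refine ⟨N, hN1, fun w hw => ?_⟩
      rw [hwB N w hw]
      have := hN w hw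
      have := mul_le_mul_of_nonneg_left hr.le N.cast_nonneg (α := ℝ)
      linarith
  have hvA : IsSlow p A v := by
    intro τ hτ
    obtain ⟨C, hC⟩ := hvB τ hτ
    refine ⟨C, fun n => le_trans ?_ (hC n)⟩
    rw [walk_eq_sum_word, walk_eq_sum_word]
    refine Finset.sum_le_sum fun ω _ => mul_le_mul_of_nonneg_left ?_
      (Finset.prod_nonneg fun i _ => (hp.pos _).le)
    refine posLog_le_posLog (norm_nonneg _) ?_
    rw [word_smul, norm_smul]
    refine le_mul_of_one_le_left (norm_nonneg _) ?_
    rw [norm_pow, norm_eq_abs, abs_of_pos (exp_pos _)]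
    exact one_le_pow₀ (one_le_exp (by linarith))
  have : v ∈ slow hp A := hvA
  rw [hslow] at this
  exact hv this

end PositiveDrift

theorem bijective_of_injective {V : Type*} [NormedAddCommGroup V] [NormedSpace ℝ V]
    [FiniteDimensional ℝ V] {T : V →L[ℝ] V} (hT : Function.Injective T) : Function.Bijective T :=
  ⟨hT, (LinearMap.injective_iff_surjective (f := T.toLinearMap)).1 hT⟩

theorem eventually_injective {α ι V : Type*} [Fintype ι] [NormedAddCommGroup V] [NormedSpace ℝ V]
    [FiniteDimensional ℝ V] {A : ι → V →L[ℝ] V} (hA : ∀ i, Function.Injective (A i))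
    {F : Filter α} {A' : α → ι → V →L[ℝ] V} (hA' : Tendsto A' F (𝓝 A)) :
    ∀ᶠ a in F, ∀ i, Function.Injective (A' a i) := by
  have : CompleteSpace V := FiniteDimensional.complete ℝ V
  rw [eventually_all]
  intro i
  have h1 : IsUnit (A i) := ContinuousLinearMap.isUnit_iff_bijective.2
    (bijective_of_injective (hA i))
  filter_upwards [(tendsto_pi_nhds.1 hA' i).eventually (Units.isOpen.mem_nhds h1)] with a ha
  exact (ContinuousLinearMap.isUnit_iff_bijective.1 ha).1

section Grow

open Real

variable {ι V W : Type*} [Fintype ι] [NormedAddCommGroup V] [NormedSpace ℝ V]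
  [NormedAddCommGroup W] [NormedSpace ℝ W]

/-- From some starting point, the mean logarithmic size of the walk stays bounded below along an
arithmetic progression of times. -/
def Grow (p : ι → ℝ) (A : ι → V →L[ℝ] V) : Prop :=
  ∃ v : V, v ≠ 0 ∧ ∃ N : ℕ, 1 ≤ N ∧ ∃ C : ℝ, ∀ j : ℕ,
    -C ≤ walk p A (N * j) (fun x => log ‖x‖) v

variable {p : ι → ℝ} {A : ι → V →L[ℝ] V} {B : ι → W →L[ℝ] W}

theorem Grow.of_semiconj (hp : IsWeight p) (hB : ∀ i, Function.Injective (B i)) {h : V →L[ℝ] W}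
    (hh : ∀ i v, h (A i v) = B i (h v)) (hsurj : Function.Surjective h) (hG : Grow p B) :
    Grow p A := by
  obtain ⟨w, hw, N, hN, C, hC⟩ := hG
  obtain ⟨v, rfl⟩ := hsurj w
  refine ⟨v, fun h0 => hw (by rw [h0, map_zero]), N, hN, C + log (1 + ‖h‖), fun j => ?_⟩
  have h1 := walk_semiconj (p := p) hh (fun x => log ‖x‖) (N * j) v
  have h2 := walk_mono_on (A := A) hp (T := {x | h x ≠ 0})
    (fun i x hx => by
      change h (A i x) ≠ 0
      rw [hh]
      exact apply_ne_zero_of_injective hB i _ hx)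
    (f := fun x => log ‖h x‖) (g := fun x => log (1 + ‖h‖) + log ‖x‖)
    (fun x hx => by
      have hx0 : x ≠ 0 := fun h0 => hx (by rw [h0, map_zero])
      have e : (0 : ℝ) < 1 + ‖h‖ := by positivity
      rw [← log_mul e.ne' (norm_ne_zero_iff.2 hx0)]
      refine log_le_log (norm_pos_iff.2 hx) ((h.le_opNorm x).trans ?_)
      gcongr
      linarith) (N * j) hw
  rw [walk_add_fun, walk_const hp] at h2
  have := hC j
  linarith

theorem eventually_grow_of_slow_eq_bot [FiniteDimensional ℝ V] [Nontrivial V] (hp : IsWeight p)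
    (hA : ∀ i, Function.Injective (A i)) (hslow : slow hp A = ⊥)
    {α : Type*} {F : Filter α} {p' : α → ι → ℝ} {A' : α → ι → V →L[ℝ] V}
    (hw : ∀ a, IsWeight (p' a)) (hp' : Tendsto p' F (𝓝 p)) (hA' : Tendsto A' F (𝓝 A)) :
    ∀ᶠ a in F, Grow (p' a) (A' a) := by
  obtain ⟨N, hN1, c, hc, hN⟩ := exists_positive_drift hp hA hslow
  have h1 : ∀ᶠ x : (ι → ℝ) × (ι → V →L[ℝ] V) in 𝓝 (p, A), ∀ v ∈ Metric.sphere (0 : V) 1,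
      0 < walk x.1 x.2 N (fun x => log ‖x‖) v := by
    refine (isCompact_sphere (0 : V) 1).eventually_forall_of_forall_eventually fun v hv => ?_
    have hv1 : ‖v‖ = 1 := by simpa using hv
    have hv0 : v ≠ 0 := norm_ne_zero_iff.1 (by rw [hv1]; exact one_ne_zero)
    have h2 := tendsto_walk_log_norm (F := 𝓝 ((p, A), v)) (p' := fun z => z.1.1)
      (A' := fun z => z.1.2) (v' := fun z => z.2) hA
      (continuous_fst.fst.tendsto _) (continuous_fst.snd.tendsto _) (continuous_snd.tendsto _)
      hv0 N
    refine h2.eventually_const_lt ?_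
    have := hN v hv0
    rw [hv1, log_one] at this
    linarith
  filter_upwards [(hp'.prodMk_nhds hA').eventually h1, eventually_injective hA hA'] with a ha hinj
  have h2 : ∀ v : V, v ≠ 0 → log ‖v‖ ≤ walk (p' a) (A' a) N (fun x => log ‖x‖) v := by
    intro v hv
    have hn : ‖v‖ ≠ 0 := norm_ne_zero_iff.2 hv
    have h3 := ha (‖v‖⁻¹ • v) (by
      rw [mem_sphere_zero_iff_norm, norm_smul, norm_inv, norm_norm, inv_mul_cancel₀ hn])
    rw [walk_log_norm_smul (hw a) hinj (inv_ne_zero hn) N hv, abs_inv, abs_norm, log_inv] at h3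
    linarith
  obtain ⟨v, hv⟩ := exists_ne (0 : V)
  refine ⟨v, hv, N, hN1, -log ‖v‖, fun j => ?_⟩
  rw [neg_neg]
  induction j with
  | zero => simp
  | succ j ih =>
    have h3 := walk_mono_on (hw a) (apply_ne_zero_of_injective hinj) h2 (N * j) hv
    rw [← walk_add_time] at h3
    exact ih.trans h3

end Grow

section Compression

open Real

variable {ι V : Type*} [NormedAddCommGroup V] [NormedSpace ℝ V]

/-- A projection, as a map onto its range. -/
def toRange (P : V →L[ℝ] V) : V →L[ℝ] LinearMap.range P.toLinearMap :=
  P.codRestrict _ fun v => LinearMap.mem_range_self P.toLinearMap v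

/-- The compression of an operator to the range of a projection. -/
def compress (P T : V →L[ℝ] V) :
    LinearMap.range P.toLinearMap →L[ℝ] LinearMap.range P.toLinearMap :=
  toRange P ∘L T ∘L (LinearMap.range P.toLinearMap).subtypeL

theorem continuous_compress (P : V →L[ℝ] V) : Continuous (compress P) := by
  unfold compress
  fun_prop

theorem toRange_surjective (P : V →L[ℝ] V) : Function.Surjective (toRange P) := by
  rintro ⟨_, v, rfl⟩
  exact ⟨v, rfl⟩

theorem apply_coe_range {P : V →L[ℝ] V} (hP : P * P = P)
    (y : LinearMap.range P.toLinearMap) : P y = y := by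
  obtain ⟨_, v, rfl⟩ := y
  exact DFunLike.congr_fun hP v

theorem exists_projection_ker [FiniteDimensional ℝ V] (E : Submodule ℝ V) :
    ∃ P : V →L[ℝ] V, P * P = P ∧ ∀ v, P v = 0 ↔ v ∈ E := by
  obtain ⟨F, hF⟩ := E.exists_isCompl
  refine ⟨LinearMap.toContinuousLinearMap (F.projection E hF.symm), ?_, fun v => ?_⟩
  · ext v
    exact DFunLike.congr_fun (F.isIdempotentElem_projection hF.symm) v
  · exact F.projection_apply_eq_zero_iff hF.symm

variable [Fintype ι] {p : ι → ℝ} {A : ι → V →L[ℝ] V}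

theorem mem_slow_of_apply_mem [FiniteDimensional ℝ V] (hp : IsWeight p)
    (hA : ∀ i, Function.Injective (A i)) (i : ι) {v : V} (hv : A i v ∈ slow hp A) :
    v ∈ slow hp A := by
  let T : slow hp A →ₗ[ℝ] slow hp A :=
    (A i).toLinearMap.restrict fun v hv => apply_mem_slow hp i hv
  have hT : Function.Injective T := fun x y h => Subtype.ext (hA i (congrArg Subtype.val h))
  obtain ⟨w, hw⟩ := LinearMap.injective_iff_surjective.1 hT ⟨A i v, hv⟩
  have : (w : V) = v := hA i (congrArg Subtype.val hw)
  exact this ▸ w.2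

variable {P : V →L[ℝ] V}

theorem proj_apply_eq (hp : IsWeight p) (hP : P * P = P) (hker : ∀ v, P v = 0 ↔ v ∈ slow hp A)
    (i : ι) (v : V) : P (A i v) = P (A i (P v)) := by
  have h1 : v - P v ∈ slow hp A := by
    rw [← hker, map_sub, sub_eq_zero]
    exact (DFunLike.congr_fun hP v).symm
  have h2 := (hker _).2 (apply_mem_slow hp i h1)
  rwa [map_sub, map_sub, sub_eq_zero] at h2

theorem compress_injective [FiniteDimensional ℝ V] (hp : IsWeight p)
    (hA : ∀ i, Function.Injective (A i)) (hP : P * P = P)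
    (hker : ∀ v, P v = 0 ↔ v ∈ slow hp A) (i : ι) : Function.Injective (compress P (A i)) := by
  rw [injective_iff_map_eq_zero]
  intro y hy
  have h1 : P (A i y) = 0 := congrArg Subtype.val hy
  have h2 := (hker _).2 (mem_slow_of_apply_mem hp hA i ((hker _).1 h1))
  rw [apply_coe_range hP] at h2
  exact Subtype.ext h2

theorem slow_compress_eq_bot [FiniteDimensional ℝ V] (hp : IsWeight p) (hP : P * P = P)
    (hker : ∀ v, P v = 0 ↔ v ∈ slow hp A) : slow hp (fun i => compress P (A i)) = ⊥ := by
  rw [Submodule.eq_bot_iff]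
  intro y hy
  have h1 : (y : V) ∈ slow hp A := by
    refine mem_slow_of_proj hp (P := P) (fun x => ?_) fun τ hτ => ?_
    · rw [← hker, map_sub, sub_eq_zero]
      exact (DFunLike.congr_fun hP x).symm
    · obtain ⟨C, hC⟩ := hy τ hτ
      refine ⟨C, fun n => le_of_eq_of_le ?_ (hC n)⟩
      have h2 := walk_semiconj (p := p) (A := A) (B := fun i => compress P (A i))
        (h := toRange P) (fun i v => Subtype.ext (proj_apply_eq hp hP hker i v))
        (fun x => log⁺ ‖x‖) n y
      have h3 : toRange P y = y := Subtype.ext (apply_coe_range hP y)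
      rw [h3] at h2
      exact h2
  have h2 := (hker _).2 h1
  rw [apply_coe_range hP] at h2
  exact Subtype.ext h2

/-- An operator system agreeing with `A` on the range of `P`, up to compression, has no slow
vector there. -/
theorem slow_disjoint_range [FiniteDimensional ℝ V] (hp : IsWeight p) (hP : P * P = P)
    (hker : ∀ v, P v = 0 ↔ v ∈ slow hp A) {B : ι → V →L[ℝ] V} (hB : ∀ i, B i * P = P * A i * P) :
    Disjoint (slow hp B) (LinearMap.range P.toLinearMap) := by
  rw [Submodule.disjoint_def]
  intro y hyB hy
  have h1 : (⟨y, hy⟩ : LinearMap.range P.toLinearMap) ∈ slow hp (fun i => compress P (A i)) := by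
    intro τ hτ
    obtain ⟨C, hC⟩ := hyB τ hτ
    refine ⟨C, fun n => le_of_eq_of_le ?_ (hC n)⟩
    refine walk_semiconj (p := p) (A := fun i => compress P (A i)) (B := B)
        (h := fun x : LinearMap.range P.toLinearMap => (x : V)) (fun i v => ?_)
        (fun x => log⁺ ‖x‖) n ⟨y, hy⟩
    have h2 := DFunLike.congr_fun (hB i) (v : V)
    simp only [mul_apply_eq_comp, apply_coe_range hP] at h2
    exact h2.symm
  rw [slow_compress_eq_bot hp hP hker] at h1
  exact congrArg Subtype.val h1

end Compression

theorem exists_penalized_minimizer {X Y : Type*} [NormedAddCommGroup X] [ProperSpace X]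
    [NormedAddCommGroup Y] {f : X → Y} (hf : Continuous f) :
    ∃ u, ‖u‖ ≤ √‖f 0‖ ∧ ∀ u', ‖u'‖ ≤ 1 → ‖f u‖ + √‖f 0‖ * ‖u‖ ≤ ‖f u'‖ + √‖f 0‖ * ‖u'‖ := by
  rcases eq_or_ne (f 0) 0 with h0 | h0
  · exact ⟨0, by simp, fun u' _ => by simp [h0]⟩
  have h1 : 0 < √‖f 0‖ := Real.sqrt_pos.2 (norm_pos_iff.2 h0)
  obtain ⟨u, hu, hmin⟩ := (isCompact_closedBall (0 : X) 1).exists_isMinOn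
    ⟨0, by simp⟩ (f := fun u => ‖f u‖ + √‖f 0‖ * ‖u‖) (by fun_prop)
  refine ⟨u, ?_, fun u' hu' => hmin (by simpa using hu')⟩
  have h2 : ‖f u‖ + √‖f 0‖ * ‖u‖ ≤ ‖f 0‖ := by
    simpa using hmin (show (0 : X) ∈ Metric.closedBall 0 1 by simp)
  have h3 : √‖f 0‖ * ‖u‖ ≤ √‖f 0‖ * √‖f 0‖ := by
    rw [Real.mul_self_sqrt (norm_nonneg _)]
    linarith [norm_nonneg (f u)]
  exact le_of_mul_le_mul_left h3 h1

section ProjectionAlgebra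

variable {R : Type*} [Ring R]

theorem sheared_corner_eq {P X Z A : R} (hX : P * X = X) (hXP : X * P = 0)
    (hZ : P * Z = Z) (hZP : Z * P = 0) :
    P * ((1 - (X + Z)) * A * (1 + (X + Z))) * (1 - P) =
      (P - Z) * ((1 - X) * A * (1 + X)) * ((1 - P) + Z) := by
  have hXZ : X * Z = 0 := by rw [← hZ, ← mul_assoc, hXP, zero_mul]
  have hZX : Z * X = 0 := by rw [← hX, ← mul_assoc, hZP, zero_mul]
  have h1 : P * (1 - (X + Z)) = (P - Z) * (1 - X) := by
    simp only [mul_sub, sub_mul, mul_add, mul_one, hX, hZ, hZX]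
    abel
  have h2 : (1 + (X + Z)) * (1 - P) = (1 + X) * ((1 - P) + Z) := by
    simp only [mul_sub, add_mul, mul_add, mul_one, one_mul, hXP, hZP, hXZ]
    abel
  rw [mul_assoc P, mul_assoc _ A, mul_assoc _ _ (1 - P), mul_assoc A, h2, ← mul_assoc P, h1]
  simp only [mul_assoc]

theorem cohomological_eq {P A β Y : R} (hP : P * P = P) (hβ : P * β = β) (hβP : β * P = 0)
    (hY : P * Y = Y) (hYP : Y * P = 0)
    (h : P * ((1 - P) * A * (1 - P) + P * A * P + β) * ((1 - P) + Y) =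
      Y * ((1 - P) * A * (1 - P) + P * A * P + β) * ((1 - P) + Y)) :
    β + P * A * Y - Y * A * (1 - P) = 0 := by
  have hYY : Y * Y = 0 := by rw [← hY, ← mul_assoc, mul_assoc P, hYP, mul_zero, zero_mul]
  have hYβ : Y * β = 0 := by rw [← hβ, ← mul_assoc, hYP, zero_mul]
  have hβY : β * Y = 0 := by rw [← hY, ← mul_assoc, hβP, zero_mul]
  have hP' : ∀ x, P * (P * x) = P * x := fun x => by rw [← mul_assoc, hP]
  have hYP' : ∀ x, Y * (P * x) = 0 := fun x => by rw [← mul_assoc, hYP, zero_mul]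
  simp only [mul_add, add_mul, mul_sub, sub_mul, mul_one, one_mul, mul_assoc, hP, hβ, hβP, hY,
    hYβ, hβY, hP', hYP', sub_zero, sub_self, zero_add, add_zero] at h ⊢
  rw [← sub_eq_zero] at h
  rw [← h]
  abel

theorem diag_conj_eq [Algebra ℝ R] {P A : R} {s : ℝ} (hs : s ≠ 0) :
    ((1 - P) + s⁻¹ • P) * A * ((1 - P) + s • P) =
      (1 - P) * A * (1 - P) + P * A * P + s • ((1 - P) * A * P) + s⁻¹ • (P * A * (1 - P)) := by
  generalize 1 - P = Q
  simp only [add_mul, mul_add, smul_add, smul_mul_assoc, mul_smul_comm, smul_smul,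
    mul_inv_cancel₀ hs, one_smul]
  abel

theorem diag_mul_eq_one [Algebra ℝ R] {P : R} (hP : P * P = P) {s : ℝ} (hs : s ≠ 0) :
    ((1 - P) + s • P) * ((1 - P) + s⁻¹ • P) = 1 := by
  simp only [add_mul, mul_add, sub_mul, mul_sub, smul_add, smul_mul_assoc, mul_smul_comm, smul_smul,
    hP, inv_mul_cancel₀ hs, one_smul, mul_one, one_mul, smul_sub]
  abel

end ProjectionAlgebra

/-- The block-diagonal part of `A` with respect to the projection `P`, plus `β`. -/
def sheared {ι V : Type*} [NormedAddCommGroup V] [NormedSpace ℝ V] (P : V →L[ℝ] V)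
    (β A : ι → V →L[ℝ] V) (i : ι) : V →L[ℝ] V :=
  (1 - P) * A i * (1 - P) + P * A i * P + β i

theorem sheared_apply {ι V : Type*} [NormedAddCommGroup V] [NormedSpace ℝ V]
    {A : ι → V →L[ℝ] V} {P : V →L[ℝ] V} {β : ι → V →L[ℝ] V} (i : ι) (v : V) : sheared P β A i v =
    A i (v - P v) - P (A i (v - P v)) + P (A i (P v)) + β i v := by
  simp [sheared]

section Reduction

variable {ι V : Type*} [Fintype ι] [NormedAddCommGroup V] [NormedSpace ℝ V]
  {p : ι → ℝ} {A : ι → V →L[ℝ] V} {P : V →L[ℝ] V} {β : ι → V →L[ℝ] V}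

variable [FiniteDimensional ℝ V]

theorem injective_sheared (hp : IsWeight p) (hA : ∀ i, Function.Injective (A i)) (hP : P * P = P)
    (hker : ∀ v, P v = 0 ↔ v ∈ slow hp A) (hβ : ∀ i, P * β i = β i) (hβP : ∀ i, β i * P = 0)
    (i : ι) : Function.Injective (sheared P β A i) := by
  rw [injective_iff_map_eq_zero]
  intro v hv
  have hP' : ∀ x, P (P x) = P x := DFunLike.congr_fun hP
  have hβ' : ∀ x, P (β i x) = β i x := DFunLike.congr_fun (hβ i)
  have hβP' : ∀ x, β i (P x) = 0 := DFunLike.congr_fun (hβP i)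
  have hq : P (A i (v - P v)) = 0 := by
    rw [proj_apply_eq hp hP hker, map_sub P, hP', sub_self, map_zero, map_zero]
  rw [sheared_apply, hq, sub_zero] at hv
  have h1 := congrArg P hv
  rw [map_add, map_add, hq, hP', hβ', map_zero, zero_add] at h1
  rw [add_assoc, h1, add_zero] at hv
  have h2 : v = P v := sub_eq_zero.1 (hA i (hv.trans (map_zero _).symm))
  rw [h2, hβP', add_zero, hP'] at h1
  have h3 := (hker _).2 (mem_slow_of_apply_mem hp hA i ((hker _).1 h1))
  rw [hP'] at h3
  rw [h2, h3]

theorem disjoint_slow_sheared (hp : IsWeight p) (hP : P * P = P)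
    (hker : ∀ v, P v = 0 ↔ v ∈ slow hp A) (hβP : ∀ i, β i * P = 0) :
    Disjoint (slow hp (sheared P β A)) (LinearMap.range P.toLinearMap) := by
  refine slow_disjoint_range hp hP hker fun i => ?_
  rw [sheared, add_mul, add_mul, hβP, mul_assoc _ (1 - P), sub_mul 1 P P, one_mul, hP, sub_self,
    mul_zero, mul_assoc _ P P, hP, zero_add, add_zero]

theorem slow_sheared_ne_top (hp : IsWeight p) (hP : P * P = P)
    (hker : ∀ v, P v = 0 ↔ v ∈ slow hp A) (hβP : ∀ i, β i * P = 0) (hslow : slow hp A ≠ ⊤) :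
    slow hp (sheared P β A) ≠ ⊤ := by
  intro htop
  have h1 := disjoint_slow_sheared hp hP hker hβP
  rw [htop, top_disjoint, LinearMap.range_eq_bot] at h1
  refine hslow (Submodule.eq_top_iff'.2 fun v => (hker v).1 ?_)
  exact LinearMap.congr_fun h1 v

/-- Either the slow space of the sheared system has smaller dimension, or the corner `β` is a
coboundary. -/
theorem finrank_slow_sheared_lt_or (hp : IsWeight p) (hP : P * P = P)
    (hker : ∀ v, P v = 0 ↔ v ∈ slow hp A) (hβ : ∀ i, P * β i = β i) (hβP : ∀ i, β i * P = 0) :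
    Module.finrank ℝ (slow hp (sheared P β A)) < Module.finrank ℝ (slow hp A) ∨
    ∃ Y : V →L[ℝ] V, P * Y = Y ∧ Y * P = 0 ∧
      ∀ i, β i + P * A i * Y - Y * A i * (1 - P) = 0 := by
  rw [or_iff_not_imp_left, not_lt]
  intro hle
  have hP' : ∀ x, P (P x) = P x := DFunLike.congr_fun hP
  set E' := slow hp (sheared P β A) with hE'
  set F := LinearMap.range P.toLinearMap with hF
  have hdisj : Disjoint E' F := disjoint_slow_sheared hp hP hker hβP
  have hkerE : LinearMap.ker P.toLinearMap = slow hp A := by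
    ext v
    exact hker v
  have hdim := LinearMap.finrank_range_add_finrank_ker P.toLinearMap
  rw [hkerE, ← hF] at hdim
  have hcompl : IsCompl E' F := by
    refine ⟨hdisj, codisjoint_iff.2 (Submodule.eq_top_of_disjoint _ _ ?_ hdisj)⟩
    omega
  set R := E'.projection F hcompl with hR
  have hRE : ∀ x ∈ E', R x = x := fun x hx =>
    Submodule.projection_apply_of_mem_left hcompl hx
  have hRF : ∀ x, R (P x) = 0 := fun x =>
    (Submodule.projection_apply_eq_zero_iff hcompl).2 ⟨x, rfl⟩
  have hRmem : ∀ x, R x ∈ E' := fun x => Submodule.projection_apply_mem hcompl x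
  have hPfix : ∀ x ∈ F, P x = x := by
    rintro _ ⟨x, rfl⟩
    exact hP' x
  let Y : V →L[ℝ] V := LinearMap.toContinuousLinearMap (R - LinearMap.id) * (1 - P)
  have hYapp : ∀ v, Y v = R v - (v - P v) := fun v => by
    change R (v - P v) - (v - P v) = _
    rw [map_sub, hRF, sub_zero]
  have hPY : P * Y = Y := by
    ext v
    refine hPfix _ ?_
    change Y v ∈ F
    rw [hYapp]
    have h1 : R v - (v - P v) = -(v - R v) + P v := by abel
    rw [h1]
    exact F.add_mem (F.neg_mem (Submodule.sub_projection_mem hcompl v)) ⟨v, rfl⟩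
  have hYP : Y * P = 0 := by
    ext v
    change Y (P v) = 0
    rw [hYapp, hRF, hP', sub_self, sub_zero]
  refine ⟨Y, hPY, hYP, fun i => cohomological_eq hP (hβ i) (hβP i) hPY hYP ?_⟩
  ext v
  have h1 : ((1 - P) + Y) v ∈ E' := by
    change (v - P v) + Y v ∈ E'
    rw [hYapp, add_sub_cancel]
    exact hRmem v
  have h2 : ∀ w ∈ E', P w = Y w := fun w hw => by
    rw [hYapp, hRE w hw, sub_sub_cancel]
  exact h2 _ (apply_mem_slow hp i h1)

end Reduction

theorem mul_shear_eq_one {R : Type*} [Ring R] {X : R} (hX : X * X = 0) :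
    (1 + X) * (1 - X) = 1 ∧ (1 - X) * (1 + X) = 1 := by
  constructor <;> simp [mul_add, add_mul, mul_sub, sub_mul, hX]

theorem corner_smul_eq {R : Type*} [Ring R] [Algebra ℝ R] {P Y A : R} (s : ℝ) (hs : s ≠ 0) :
    (P - s • Y) * A * ((1 - P) + s • Y) =
      s • (s⁻¹ • (P * A * (1 - P)) + P * A * Y - Y * A * (1 - P) - s • (Y * A * Y)) := by
  generalize 1 - P = Q
  simp only [sub_mul, mul_add, smul_add, smul_sub, smul_mul_assoc, mul_smul_comm, smul_smul,
    mul_inv_cancel₀ hs, one_smul]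
  abel

theorem surjective_of_mul_eq_one {V : Type*} [NormedAddCommGroup V] [NormedSpace ℝ V]
    {S T : V →L[ℝ] V} (h : S * T = 1) : Function.Surjective S :=
  fun v => ⟨T v, DFunLike.congr_fun h v⟩

section Main

variable {ι V : Type*} [Fintype ι] [NormedAddCommGroup V] [NormedSpace ℝ V]
  {p : ι → ℝ} {P : V →L[ℝ] V}

theorem grow_of_corner_eq_zero (hp : IsWeight p) {A A'' : ι → V →L[ℝ] V}
    {X : V →L[ℝ] V} (hX : X * X = 0) (hA'' : ∀ i, A'' i = (1 - X) * A i * (1 + X))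
    (hz : ∀ i, P * A'' i * (1 - P) = 0) (hc : ∀ i, Function.Injective (compress P (A'' i)))
    (hG : Grow p (fun i => compress P (A'' i))) : Grow p A := by
  obtain ⟨h1, h2⟩ := mul_shear_eq_one hX
  refine hG.of_semiconj hp hc (h := toRange P ∘L (1 - X)) (fun i v => Subtype.ext ?_)
    ((toRange_surjective P).comp (surjective_of_mul_eq_one h2))
  have h3 : P * A'' i = P * A'' i * P := by
    have := hz i
    rwa [mul_sub, mul_one, sub_eq_zero] at this
  have h4 : P * ((1 - X) * A i) = P * A'' i * P * (1 - X) := by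
    rw [← h3, hA'', mul_assoc P, mul_assoc _ (1 + X), h1, mul_one]
  exact DFunLike.congr_fun h4 v

theorem grow_of_diag_conj (hp : IsWeight p) (hP : P * P = P) {A A'' B : ι → V →L[ℝ] V}
    {X : V →L[ℝ] V} (hX : X * X = 0) (hA'' : ∀ i, A'' i = (1 - X) * A i * (1 + X))
    {s : ℝ} (hs : s ≠ 0) (hB : ∀ i, B i = ((1 - P) + s⁻¹ • P) * A'' i * ((1 - P) + s • P))
    (hBi : ∀ i, Function.Injective (B i)) (hG : Grow p B) : Grow p A := by
  obtain ⟨h1, h2⟩ := mul_shear_eq_one hX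
  have h3 := diag_mul_eq_one hP hs
  have h4 := diag_mul_eq_one hP (inv_ne_zero hs)
  rw [inv_inv] at h4
  refine hG.of_semiconj hp hBi (h := ((1 - P) + s⁻¹ • P) * (1 - X)) (fun i v => ?_)
    ((surjective_of_mul_eq_one h4).comp (surjective_of_mul_eq_one h2))
  generalize (1 - P) + s⁻¹ • P = D' at *
  generalize (1 - P) + s • P = D at *
  have h5 : D' * (1 - X) * A i = B i * (D' * (1 - X)) := by
    rw [hB, hA'']
    calc _ = D' * ((1 - X) * A i) * ((1 + X) * (1 - X)) := by rw [h1, mul_one, mul_assoc]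
      _ = D' * ((1 - X) * A i) * (1 + X) * (D * D') * (1 - X) := by
        rw [h3, mul_one, mul_assoc _ (1 + X)]
      _ = _ := by simp only [mul_assoc]
  exact DFunLike.congr_fun h5 v

variable [FiniteDimensional ℝ V]

theorem eventually_grow {α : Type*} {U : Ultrafilter α} {p' : α → ι → ℝ} (hp : IsWeight p)
    (hw : ∀ a, IsWeight (p' a)) (hp' : Tendsto p' U (𝓝 p)) {A : ι → V →L[ℝ] V}
    {A' : α → ι → V →L[ℝ] V} (hA : ∀ i, Function.Injective (A i)) (hslow : slow hp A ≠ ⊤)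
    (hA' : Tendsto A' U (𝓝 A)) : ∀ᶠ a in U, Grow (p' a) (A' a) := by
  induction hn : Module.finrank ℝ (slow hp A) using Nat.strong_induction_on
    generalizing A A' with
  | _ n ih =>
  subst hn
  obtain ⟨P, hP, hker⟩ := exists_projection_ker (slow hp A)
  have hQP : (1 - P) * P = 0 := by rw [sub_mul, one_mul, hP, sub_self]
  let Ξ : α → (V →L[ℝ] V) → ι → V →L[ℝ] V := fun a u i =>
    P * ((1 - P * u * (1 - P)) * A' a i * (1 + P * u * (1 - P))) * (1 - P)
  have hΞc : ∀ a, Continuous (Ξ a) := fun a => continuous_pi fun i => by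
    simp only [Ξ]
    fun_prop
  have hΞ0 : Tendsto (fun a => Ξ a 0) U (𝓝 0) := by
    rw [tendsto_pi_nhds]
    intro i
    have h1 : Tendsto (fun a => P * A' a i * (1 - P)) U (𝓝 (P * A i * (1 - P))) :=
      ((tendsto_pi_nhds.1 hA' i).const_mul P).mul_const (1 - P)
    have h2 : P * A i * (1 - P) = 0 := by
      ext v
      change P (A i (v - P v)) = 0
      rw [map_sub, map_sub, ← proj_apply_eq hp hP hker, sub_self]
    rw [h2] at h1
    refine h1.congr fun a => ?_
    simp [Ξ]
  choose u hu humin using fun a => exists_penalized_minimizer (hΞc a)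
  have ht : Tendsto (fun a => √‖Ξ a 0‖) U (𝓝 0) := by
    simpa using hΞ0.norm.sqrt
  have hu0 : Tendsto u U (𝓝 0) := squeeze_zero_norm hu ht
  let X : α → V →L[ℝ] V := fun a => P * u a * (1 - P)
  have hPX : ∀ a, P * X a = X a := fun a => by simp only [X, ← mul_assoc, hP]
  have hXP : ∀ a, X a * P = 0 := fun a => by simp only [X, mul_assoc, hQP, mul_zero]
  have hXX : ∀ a, X a * X a = 0 := fun a => by
    rw [← hPX, ← mul_assoc, mul_assoc P, hXP, mul_zero, zero_mul]
  have hX0 : Tendsto X U (𝓝 0) := by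
    simpa using (hu0.const_mul P).mul_const (1 - P)
  let A'' : α → ι → V →L[ℝ] V := fun a i => (1 - X a) * A' a i * (1 + X a)
  have hA'' : Tendsto A'' U (𝓝 A) := by
    rw [tendsto_pi_nhds]
    intro i
    simpa using ((hX0.const_sub 1).mul (tendsto_pi_nhds.1 hA' i)).mul (hX0.const_add 1)
  have hA''i := tendsto_pi_nhds.1 hA''
  let s : α → ℝ := fun a => ‖Ξ a (u a)‖
  have hs0 : Tendsto s U (𝓝 0) := by
    have h1 : Tendsto (fun a => Ξ a (u a)) U (𝓝 fun i => P * A i * (1 - P)) := by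
      rw [tendsto_pi_nhds]
      exact fun i => ((hA''i i).const_mul P).mul_const (1 - P)
    have h2 := tendsto_nhds_unique
      (tendsto_pi_nhds.2 fun i => ((tendsto_pi_nhds.1 hA' i).const_mul P).mul_const (1 - P))
      (hΞ0.congr fun a => by simp [Ξ])
    rw [h2] at h1
    simpa using h1.norm
  by_cases hs : ∀ᶠ a in U, s a = 0
  · have hnt : Nontrivial (LinearMap.range P.toLinearMap) := by
      rw [Submodule.nontrivial_iff_ne_bot, Ne, LinearMap.range_eq_bot]
      exact fun h => hslow (Submodule.eq_top_iff'.2 fun v => (hker v).1 (LinearMap.congr_fun h v))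
    have hcA : Tendsto (fun a i => compress P (A'' a i)) U (𝓝 fun i => compress P (A i)) := by
      rw [tendsto_pi_nhds]
      exact fun i => ((continuous_compress P).tendsto _).comp (hA''i i)
    have hci := compress_injective hp hA hP hker
    filter_upwards [hs, eventually_injective hci hcA, eventually_grow_of_slow_eq_bot hp hci
      (slow_compress_eq_bot hp hP hker) hw hp' hcA] with a hsa hinj hG
    exact grow_of_corner_eq_zero (hw a) (hXX a) (fun i => rfl)
      (fun i => congrFun (norm_eq_zero.1 hsa) i) hinj hG
  · replace hs : ∀ᶠ a in U, s a ≠ 0 := Ultrafilter.eventually_not.2 hs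
    let g : α → ι → V →L[ℝ] V := fun a => (s a)⁻¹ • Ξ a (u a)
    have hg1 : ∀ a, g a ∈ Metric.closedBall (0 : ι → V →L[ℝ] V) 1 := fun a => by
      rw [mem_closedBall_zero_iff, norm_smul, norm_inv, norm_norm]
      exact inv_mul_le_one
    obtain ⟨β, -, hβU⟩ := (isCompact_closedBall (0 : ι → V →L[ℝ] V) 1).ultrafilter_le_nhds
      (U.map g) (le_principal_iff.2 (Filter.mem_map.2 (Filter.Eventually.of_forall hg1)))
    have hgβ : Tendsto g U (𝓝 β) := hβU
    have hgβi := tendsto_pi_nhds.1 hgβ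
    have hgi : ∀ a i, g a i = (s a)⁻¹ • (P * A'' a i * (1 - P)) := fun a i => rfl
    have hβ : ∀ i, P * β i = β i := fun i =>
      tendsto_nhds_unique (((hgβi i).const_mul P).congr fun a => by
        rw [hgi, mul_smul_comm, ← mul_assoc, ← mul_assoc, hP]) (hgβi i)
    have hβP : ∀ i, β i * P = 0 := fun i =>
      tendsto_nhds_unique ((hgβi i).mul_const P) (tendsto_const_nhds.congr fun a => by
        rw [hgi, smul_mul_assoc, mul_assoc _ (1 - P), hQP, mul_zero, smul_zero])
    rcases finrank_slow_sheared_lt_or hp hP hker hβ hβP with hlt | ⟨Y, hPY, hYP, hY⟩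
    · let B : α → ι → V →L[ℝ] V := fun a i =>
        ((1 - P) + (s a)⁻¹ • P) * A'' a i * ((1 - P) + s a • P)
      have hB : Tendsto B U (𝓝 (sheared P β A)) := by
        rw [tendsto_pi_nhds]
        intro i
        have h1 : Tendsto (fun a => (1 - P) * A'' a i * (1 - P) + P * A'' a i * P +
            s a • ((1 - P) * A'' a i * P) + g a i) U (𝓝 ((1 - P) * A i * (1 - P) + P * A i * P +
            (0 : ℝ) • ((1 - P) * A i * P) + β i)) :=
          (((((hA''i i).const_mul _).mul_const _).add (((hA''i i).const_mul _).mul_const _)).add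
            (hs0.smul (((hA''i i).const_mul _).mul_const _))).add (hgβi i)
        rw [zero_smul, add_zero] at h1
        refine h1.congr' ?_
        filter_upwards [hs] with a ha
        exact (diag_conj_eq ha).symm
      have hBi := injective_sheared hp hA hP hker hβ hβP
      filter_upwards [hs, eventually_injective hBi hB,
        ih _ hlt hBi (slow_sheared_ne_top hp hP hker hβP hslow) hB rfl] with a hsa hinj hG
      exact grow_of_diag_conj (hw a) hP (hXX a) (fun i => rfl) hsa (fun i => rfl) hinj hG
    · exfalso
      let G : α → ι → V →L[ℝ] V := fun a i =>
        g a i + P * A'' a i * Y - Y * A'' a i * (1 - P) - s a • (Y * A'' a i * Y)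
      have hG : Tendsto G U (𝓝 0) := by
        rw [tendsto_pi_nhds]
        intro i
        have h1 : Tendsto (fun a => G a i) U (𝓝 (β i + P * A i * Y - Y * A i * (1 - P) -
            (0 : ℝ) • (Y * A i * Y))) :=
          (((hgβi i).add (((hA''i i).const_mul _).mul_const _)).sub
            (((hA''i i).const_mul _).mul_const _)).sub
            (hs0.smul (((hA''i i).const_mul _).mul_const _))
        rwa [hY, zero_smul, sub_zero] at h1
      have hu' : Tendsto (fun a => ‖u a + s a • Y‖) U (𝓝 0) := by
        simpa using (hu0.add (hs0.smul_const Y)).norm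
      have h1 : ∀ᶠ a in U, 1 ≤ ‖G a‖ + √‖Ξ a 0‖ * ‖Y‖ := by
        filter_upwards [hs, hu'.eventually_lt_const one_pos] with a hsa hua
        have hspos : 0 < s a := lt_of_le_of_ne (norm_nonneg _) (Ne.symm hsa)
        have h2 := humin a _ hua.le
        have h3 : Ξ a (u a + s a • Y) = s a • G a := by
          funext i
          have h4 : P * (u a + s a • Y) * (1 - P) = X a + s a • Y := by
            rw [mul_add, add_mul, mul_smul_comm, hPY, smul_mul_assoc, mul_sub Y 1 P, hYP, mul_one,
              sub_zero]
          simp only [Ξ, h4]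
          rw [sheared_corner_eq (hPX a) (hXP a) (by rw [mul_smul_comm, hPY])
            (by rw [smul_mul_assoc, hYP, smul_zero]), corner_smul_eq _ hsa]
          rfl
        rw [h3, norm_smul, Real.norm_of_nonneg hspos.le] at h2
        have h5 : ‖u a + s a • Y‖ ≤ ‖u a‖ + s a * ‖Y‖ := by
          refine (norm_add_le _ _).trans ?_
          rw [norm_smul, Real.norm_of_nonneg hspos.le]
        have h6 := mul_le_mul_of_nonneg_left h5 (Real.sqrt_nonneg ‖Ξ a 0‖)
        have h7 : s a * 1 ≤ s a * (‖G a‖ + √‖Ξ a 0‖ * ‖Y‖) := by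
          have : s a + √‖Ξ a 0‖ * ‖u a‖ ≤ s a * ‖G a‖ + √‖Ξ a 0‖ * ‖u a + s a • Y‖ := h2
          linarith
        exact le_of_mul_le_mul_left h7 hspos
      have h2 : Tendsto (fun a => ‖G a‖ + √‖Ξ a 0‖ * ‖Y‖) U (𝓝 0) := by
        simpa using hG.norm.add (ht.mul_const ‖Y‖)
      have := ge_of_tendsto h2 h1
      linarith

end Main

section LeftMul

variable {ι V : Type*} [NormedAddCommGroup V] [NormedSpace ℝ V] {A : ι → V →L[ℝ] V}

/-- The action of the operators `A i` on `End V` by left multiplication. -/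
def leftMul (A : ι → V →L[ℝ] V) (i : ι) : (V →L[ℝ] V) →L[ℝ] (V →L[ℝ] V) :=
  ContinuousLinearMap.mul ℝ (V →L[ℝ] V) (A i)

theorem word_leftMul {n : ℕ} (ω : Fin n → ι) (T : V →L[ℝ] V) :
    word (leftMul A) ω T = word A ω * T := by
  induction n generalizing T with
  | zero => simp [word]
  | succ n ih =>
    have := ih (Fin.tail ω) (A (ω 0) * T)
    simp only [word, Fin.tail] at this
    simp only [word, List.ofFn_succ, List.reverse_cons, List.prod_append, List.prod_singleton,
      mul_assoc]
    rw [← this]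
    rfl

theorem injective_leftMul (hA : ∀ i, Function.Injective (A i)) (i : ι) :
    Function.Injective (leftMul A i) := fun _ _ h =>
  ContinuousLinearMap.ext fun v => hA i (DFunLike.congr_fun h v)

end LeftMul

section GrowthRate

open Real

variable {ι V : Type*} [Fintype ι] [NormedAddCommGroup V] [NormedSpace ℝ V]
  {p : ι → ℝ} {A : ι → V →L[ℝ] V}

/-- The expectation of `log ‖A (ω (n-1)) ⋯ A (ω 0)‖`. -/
def meanLogNorm (p : ι → ℝ) (A : ι → V →L[ℝ] V) (n : ℕ) : ℝ :=
  ∑ ω : Fin n → ι, (∏ i, p (ω i)) * log ‖word A ω‖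

theorem meanLogNorm_eq_walk (n : ℕ) :
    meanLogNorm p A n = walk p (leftMul A) n (fun T => log ‖T‖) 1 := by
  simp only [meanLogNorm, walk_eq_sum_word, word_leftMul, mul_one]

theorem tendsto_meanLogNorm [Nontrivial V] {α : Type*} {F : Filter α} {p' : α → ι → ℝ}
    {A' : α → ι → V →L[ℝ] V} (hA : ∀ i, Function.Injective (A i)) (hp' : Tendsto p' F (𝓝 p))
    (hA' : Tendsto A' F (𝓝 A)) (n : ℕ) :
    Tendsto (fun a => meanLogNorm (p' a) (A' a) n) F (𝓝 (meanLogNorm p A n)) := by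
  simp only [meanLogNorm_eq_walk]
  refine tendsto_walk_log_norm (injective_leftMul hA) hp' ?_ tendsto_const_nhds one_ne_zero n
  rw [tendsto_pi_nhds] at hA' ⊢
  exact fun i => ((ContinuousLinearMap.mul ℝ (V →L[ℝ] V)).continuous.tendsto _).comp (hA' i)

theorem walk_log_norm_le (hp : IsWeight p) (hA : ∀ i, Function.Injective (A i)) (n : ℕ) {v : V}
    (hv : v ≠ 0) : walk p A n (fun x => log ‖x‖) v ≤ meanLogNorm p A n + log ‖v‖ := by
  rw [walk_eq_sum_word, meanLogNorm, ← one_mul (log ‖v‖), ← sum_weight_word hp n, Finset.sum_mul,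
    ← Finset.sum_add_distrib]
  refine Finset.sum_le_sum fun ω _ => ?_
  rw [← mul_add]
  refine mul_le_mul_of_nonneg_left ?_ (Finset.prod_nonneg fun i _ => (hp.pos _).le)
  have h0 : word A ω v ≠ 0 :=
    word_mem (T := {x | x ≠ 0}) (fun i x hx => apply_ne_zero_of_injective hA i x hx) ω hv
  have h1 : word A ω ≠ 0 := fun h => h0 (by rw [h]; rfl)
  rw [← log_mul (norm_ne_zero_iff.2 h1) (norm_ne_zero_iff.2 hv)]
  exact log_le_log (norm_pos_iff.2 h0) ((word A ω).le_opNorm v)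

theorem meanLogNorm_smul [Nontrivial V] (hp : IsWeight p) (hA : ∀ i, Function.Injective (A i))
    {c : ℝ} (hc : c ≠ 0) (n : ℕ) :
    meanLogNorm p (fun i => c • A i) n = meanLogNorm p A n + n * log |c| := by
  rw [meanLogNorm_eq_walk, meanLogNorm_eq_walk,
    ← walk_smul_log_norm (A := leftMul A) hp (injective_leftMul hA) hc n one_ne_zero]
  congr 1

theorem meanLogNorm_add_le [Nontrivial V] (hp : IsWeight p) (hA : ∀ i, Function.Injective (A i))
    (m n : ℕ) : meanLogNorm p A (m + n) ≤ meanLogNorm p A m + meanLogNorm p A n := by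
  have h2 : ∀ T : V →L[ℝ] V, T ≠ 0 → walk p (leftMul A) n (fun T => log ‖T‖) T ≤
      meanLogNorm p A n + log ‖T‖ := by
    intro T hT
    rw [walk_eq_sum_word, meanLogNorm, ← one_mul (log ‖T‖), ← sum_weight_word hp n,
      Finset.sum_mul, ← Finset.sum_add_distrib]
    refine Finset.sum_le_sum fun ω _ => ?_
    rw [← mul_add, word_leftMul]
    refine mul_le_mul_of_nonneg_left ?_ (Finset.prod_nonneg fun i _ => (hp.pos _).le)
    have h0 : word A ω * T ≠ 0 := by
      rw [← word_leftMul]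
      exact word_mem (T := {x | x ≠ 0})
        (fun i x hx => apply_ne_zero_of_injective (injective_leftMul hA) i x hx) ω hT
    have h1 : word A ω ≠ 0 := fun h => h0 (by rw [h, zero_mul])
    rw [← log_mul (norm_ne_zero_iff.2 h1) (norm_ne_zero_iff.2 hT)]
    exact log_le_log (norm_pos_iff.2 h0) (norm_mul_le _ _)
  rw [meanLogNorm_eq_walk (n := m + n), walk_add_time]
  refine (walk_mono_on (A := leftMul A) hp (T := {x | x ≠ 0})
    (fun i x hx => apply_ne_zero_of_injective (injective_leftMul hA) i x hx) h2 m
    one_ne_zero).trans ?_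
  rw [walk_add_fun, walk_const hp, ← meanLogNorm_eq_walk, add_comm]

theorem meanLogNorm_mul_le [Nontrivial V] (hp : IsWeight p) (hA : ∀ i, Function.Injective (A i))
    (N j : ℕ) : meanLogNorm p A (N * j) ≤ j * meanLogNorm p A N := by
  induction j with
  | zero => simp [meanLogNorm_eq_walk]
  | succ j ih =>
    have := meanLogNorm_add_le hp hA (N * j) N
    rw [mul_add_one]
    push_cast
    linarith

variable {Λ : ℝ}

theorem tendsto_along_multiples {u : ℕ → ℝ}
    (hu : Tendsto (fun n : ℕ => (n : ℝ)⁻¹ * u n) atTop (𝓝 Λ)) {N : ℕ} (hN : 1 ≤ N) :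
    Tendsto (fun j : ℕ => ((N * j : ℕ) : ℝ)⁻¹ * u (N * j)) atTop (𝓝 Λ) :=
  hu.comp (tendsto_id.const_mul_atTop' hN)

theorem tendsto_inv_mul_linear (τ C : ℝ) {N : ℕ} (hN : 1 ≤ N) :
    Tendsto (fun j : ℕ => ((N * j : ℕ) : ℝ)⁻¹ * (τ * (N * j : ℕ) + C)) atTop (𝓝 τ) := by
  refine tendsto_along_multiples (u := fun n : ℕ => τ * (n : ℝ) + C) ?_ hN
  have h1 : Tendsto (fun n : ℕ => τ + (n : ℝ)⁻¹ * C) atTop (𝓝 (τ + 0 * C)) :=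
    (tendsto_inv_atTop_nhds_zero_nat.mul_const C).const_add τ
  rw [zero_mul, add_zero] at h1
  refine h1.congr' ?_
  filter_upwards [eventually_ge_atTop 1] with n hn
  have : (n : ℝ) ≠ 0 := by positivity
  field_simp

theorem growthRate_le [Nontrivial V] (hp : IsWeight p) (hA : ∀ i, Function.Injective (A i))
    (hΛ : Tendsto (fun n : ℕ => (n : ℝ)⁻¹ * meanLogNorm p A n) atTop (𝓝 Λ)) {N : ℕ}
    (hN : 1 ≤ N) : Λ ≤ (N : ℝ)⁻¹ * meanLogNorm p A N := by
  refine le_of_tendsto (tendsto_along_multiples hΛ hN) ?_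
  filter_upwards [eventually_ge_atTop 1] with j hj
  have hN' : (0 : ℝ) < N := by positivity
  have hj' : (0 : ℝ) < j := by positivity
  refine (mul_le_mul_of_nonneg_left (meanLogNorm_mul_le hp hA N j) (by positivity)).trans_eq ?_
  push_cast
  field_simp

theorem slow_ne_top [FiniteDimensional ℝ V] (hp : IsWeight p) (hΛ0 : 0 < Λ)
    (hΛ : Tendsto (fun n : ℕ => (n : ℝ)⁻¹ * meanLogNorm p A n) atTop (𝓝 Λ)) :
    slow hp A ≠ ⊤ := by
  intro h
  obtain ⟨C, -, hC⟩ := exists_word_bound_on_slow hp (E := ⊤) h.ge (Λ / 2) (half_pos hΛ0)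
  have h1 := tendsto_along_multiples hΛ le_rfl
  have h2 := le_of_tendsto_of_tendsto' h1 (tendsto_inv_mul_linear (Λ / 2) C le_rfl) fun j => by
    refine mul_le_mul_of_nonneg_left ?_ (by positivity)
    obtain ⟨ρ, hρ, hb, hs⟩ := hC (1 * j)
    refine le_trans (Finset.sum_le_sum fun ω _ => mul_le_mul_of_nonneg_left ?_
      (Finset.prod_nonneg fun i _ => (hp.pos _).le)) hs
    have h3 : ‖word A ω‖ ≤ ρ ω :=
      ContinuousLinearMap.opNorm_le_bound _ (hρ ω) fun x => hb ω x trivial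
    exact (le_max_right 0 _).trans (posLog_le_posLog (norm_nonneg _) h3)
  linarith

theorem Grow.le_growthRate (hp : IsWeight p) (hA : ∀ i, Function.Injective (A i)) {t : ℝ}
    (hΛ : Tendsto (fun n : ℕ => (n : ℝ)⁻¹ * meanLogNorm p A n) atTop (𝓝 Λ))
    (hG : Grow p fun i => exp (-t) • A i) : t ≤ Λ := by
  obtain ⟨v, hv, N, hN, C, hC⟩ := hG
  refine le_of_tendsto_of_tendsto' (tendsto_inv_mul_linear t (-C - log ‖v‖) hN)
    (tendsto_along_multiples hΛ hN) fun j => mul_le_mul_of_nonneg_left ?_ (by positivity)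
  have h1 := hC j
  rw [walk_smul_log_norm hp hA (exp_ne_zero _) _ hv, abs_exp, log_exp] at h1
  have h2 := walk_log_norm_le hp hA (N * j) hv
  linarith

/-- The top Lyapunov exponent depends continuously on the weights and on the operators. -/
theorem tendsto_growthRate [FiniteDimensional ℝ V] [Nontrivial V] {α : Type*} {F : Filter α}
    {p' : α → ι → ℝ} {A' : α → ι → V →L[ℝ] V} {Λ' : α → ℝ} (hp : IsWeight p)
    (hA : ∀ i, Function.Injective (A i))
    (hΛ : Tendsto (fun n : ℕ => (n : ℝ)⁻¹ * meanLogNorm p A n) atTop (𝓝 Λ))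
    (hw : ∀ a, IsWeight (p' a)) (hi : ∀ a i, Function.Injective (A' a i))
    (hΛ' : ∀ a, Tendsto (fun n : ℕ => (n : ℝ)⁻¹ * meanLogNorm (p' a) (A' a) n) atTop (𝓝 (Λ' a)))
    (hp' : Tendsto p' F (𝓝 p)) (hA' : Tendsto A' F (𝓝 A)) : Tendsto Λ' F (𝓝 Λ) := by
  refine tendsto_order.2 ⟨fun b hb => ?_, fun b hb => ?_⟩
  · by_contra hcon
    obtain ⟨t, hbt, htΛ⟩ := exists_between hb
    have hne : (F ⊓ 𝓟 {a | ¬ b < Λ' a}).NeBot := frequently_mem_iff_neBot.1 (not_eventually.1 hcon)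
    let U := Ultrafilter.of (F ⊓ 𝓟 {a | ¬ b < Λ' a})
    have hU : ↑U ≤ F ⊓ 𝓟 {a | ¬ b < Λ' a} := Ultrafilter.of_le _
    have hUF := hU.trans inf_le_left
    have hUb : ∀ᶠ a in U, ¬ b < Λ' a := le_principal_iff.1 (hU.trans inf_le_right)
    have hinj : ∀ {B : ι → V →L[ℝ] V}, (∀ i, Function.Injective (B i)) →
        ∀ i, Function.Injective (exp (-t) • B i) := fun hB i =>
      (smul_right_injective V (exp_ne_zero (-t))).comp (hB i)
    have hslow : slow hp (fun i => exp (-t) • A i) ≠ ⊤ := by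
      refine slow_ne_top hp (sub_pos.2 htΛ) ((hΛ.sub_const t).congr' ?_)
      filter_upwards [eventually_ge_atTop 1] with n hn
      have : (n : ℝ) ≠ 0 := by positivity
      rw [meanLogNorm_smul hp hA (exp_ne_zero _), abs_exp, log_exp]
      field_simp
      ring
    have hlim : Tendsto (fun a i => exp (-t) • A' a i) U (𝓝 fun i => exp (-t) • A i) :=
      (hA'.mono_left hUF).const_smul (exp (-t))
    obtain ⟨a, hG, hab⟩ :=
      ((eventually_grow hp hw (hp'.mono_left hUF) (hinj hA) hslow hlim).and hUb).exists
    exact hab (hbt.trans_le (hG.le_growthRate (hw a) (hi a) (hΛ' a)))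
  · obtain ⟨N, hNb, hN⟩ := ((hΛ.eventually_lt_const hb).and (eventually_ge_atTop 1)).exists
    filter_upwards [((tendsto_meanLogNorm hA hp' hA' N).const_mul (N : ℝ)⁻¹).eventually_lt_const
      hNb] with a ha
    exact (growthRate_le (hw a) (hi a) (hΛ' a) hN).trans_lt ha

end GrowthRate

theorem injective_of_isUnit {V : Type*} [NormedAddCommGroup V] [NormedSpace ℝ V] {S : V →L[ℝ] V}
    (h : IsUnit S) : Function.Injective S := by
  obtain ⟨u, rfl⟩ := h
  exact Function.LeftInverse.injective (g := (↑u⁻¹ : V →L[ℝ] V)) fun v =>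
    DFunLike.congr_fun u.inv_mul v

theorem word_compoundMap {ι : Type*} (d l : ℕ) (A : ι → Matrix (Fin d) (Fin d) ℝ) {n : ℕ}
    (ω : Fin n → ι) : word (fun i => compoundMap d l (A i)) ω =
      compoundMap d l (List.ofFn fun i => A (ω i)).reverse.prod := by
  rw [word, map_list_prod, List.map_reverse, List.map_ofFn]
  rfl

theorem nontrivial_euclideanSpace_subsets {d l : ℕ} (hl : l ≤ d) :
    Nontrivial (EuclideanSpace ℝ {s : Finset (Fin d) // s.card = l}) := by
  obtain ⟨s, -, hs⟩ := Finset.exists_subset_card_eq (s := (Finset.univ : Finset (Fin d)))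
    (n := l) (by simpa using hl)
  have : Nonempty {s : Finset (Fin d) // s.card = l} := ⟨⟨s, hs⟩⟩
  infer_instance

theorem continuousOn_growthRate {d m : ℕ}
    {L : (Fin m → Matrix (Fin d) (Fin d) ℝ) → (Fin m → ℝ) → ℕ → ℝ}
    (hL : ∀ (A : Fin m → Matrix (Fin d) (Fin d) ℝ) (p : Fin m → ℝ),
      (∀ i, IsUnit (A i)) → (∀ i, 0 < p i) → (∑ i, p i = 1) →
      ∀ l : ℕ, l ≤ d →
        Tendsto (fun n : ℕ => (n : ℝ)⁻¹ *
            ∑ ω : Fin n → Fin m, (∏ i, p (ω i)) *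
              Real.log (matOpNorm (compound d l ((List.ofFn fun i => A (ω i)).reverse.prod))))
          atTop (𝓝 (L A p l)))
    {l : ℕ} (hl : l ≤ d) :
    ContinuousOn
      (fun x : (Fin m → Matrix (Fin d) (Fin d) ℝ) × (Fin m → ℝ) => L x.1 x.2 l)
      {x : (Fin m → Matrix (Fin d) (Fin d) ℝ) × (Fin m → ℝ) |
        (∀ i, IsUnit (x.1 i)) ∧ (∀ i, 0 < x.2 i) ∧ ∑ i, x.2 i = 1} := by
  rw [continuousOn_iff_continuous_domRestrict, continuous_iff_continuousAt]
  have := nontrivial_euclideanSpace_subsets hl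
  let S := {x : (Fin m → Matrix (Fin d) (Fin d) ℝ) × (Fin m → ℝ) |
    (∀ i, IsUnit (x.1 i)) ∧ (∀ i, 0 < x.2 i) ∧ ∑ i, x.2 i = 1}
  have hw : ∀ y : S, IsWeight y.1.2 := fun y => ⟨y.2.2.1, y.2.2.2⟩
  have hi : ∀ (y : S) i, Function.Injective (compoundMap d l (y.1.1 i)) := fun y i =>
    injective_of_isUnit ((y.2.1 i).map (compoundMap d l))
  have hΛ : ∀ y : S, Tendsto (fun n : ℕ => (n : ℝ)⁻¹ *
      meanLogNorm y.1.2 (fun i => compoundMap d l (y.1.1 i)) n) atTop (𝓝 (L y.1.1 y.1.2 l)) := by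
    intro y
    simp only [meanLogNorm, word_compoundMap]
    exact hL y.1.1 y.1.2 y.2.1 y.2.2.1 y.2.2.2 l hl
  intro x
  refine tendsto_growthRate (p' := fun y : S => y.1.2)
    (A' := fun (y : S) i => compoundMap d l (y.1.1 i)) (hw x) (hi x) (hΛ x) hw hi hΛ ?_ ?_
  · exact (continuous_snd.comp continuous_subtype_val).tendsto x
  · exact (continuous_pi fun i => (continuous_compoundMap d l).comp
      ((continuous_apply i).comp (continuous_fst.comp continuous_subtype_val))).tendsto x

/-- **Continuity of the Lyapunov exponents of random products of finitely many matrices**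
(Theorem A).  Fix `d ≥ 1`, `m ≥ 1`.  For `(A₁, …, A_m) ∈ GL(d,ℝ)^m` and `(p₁, …, p_m)` in the
open simplex `Δ_m`, let `ν = ∑ pᵢ δ_{Aᵢ}` and let
`L_l(ν) = lim_n (1/n) ∫ log ‖Λˡ (g_{n-1} ⋯ g₀)‖ dν^ℕ`
`      = lim_n (1/n) ∑_{ω : Fin n → Fin m} (∏ p_{ω i}) log ‖Λˡ (A_{ω(n-1)} ⋯ A_{ω 0})‖`
(the limits exist by subadditivity; `L₀ = 0`).  Then for each `1 ≤ j ≤ d` the `j`-th Lyapunov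
exponent `λ_j(ν) = L_j(ν) − L_{j−1}(ν)` depends continuously on `(A₁,…,A_m,p₁,…,p_m)` at every
point of `GL(d,ℝ)^m × Δ_m`. -/
theorem stmt0 (d m : ℕ) (hd : 1 ≤ d) (hm : 1 ≤ m)
    (L : (Fin m → Matrix (Fin d) (Fin d) ℝ) → (Fin m → ℝ) → ℕ → ℝ)
    (hL : ∀ (A : Fin m → Matrix (Fin d) (Fin d) ℝ) (p : Fin m → ℝ),
      (∀ i, IsUnit (A i)) → (∀ i, 0 < p i) → (∑ i, p i = 1) →
      ∀ l : ℕ, l ≤ d →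
        Tendsto (fun n : ℕ => (n : ℝ)⁻¹ *
            ∑ ω : Fin n → Fin m, (∏ i, p (ω i)) *
              Real.log (matOpNorm (compound d l ((List.ofFn fun i => A (ω i)).reverse.prod))))
          atTop (𝓝 (L A p l)))
    (j : ℕ) (hj1 : 1 ≤ j) (hjd : j ≤ d) :
    ContinuousOn
      (fun x : (Fin m → Matrix (Fin d) (Fin d) ℝ) × (Fin m → ℝ) =>
        L x.1 x.2 j - L x.1 x.2 (j - 1))
      {x : (Fin m → Matrix (Fin d) (Fin d) ℝ) × (Fin m → ℝ) |
        (∀ i, IsUnit (x.1 i)) ∧ (∀ i, 0 < x.2 i) ∧ ∑ i, x.2 i = 1} := by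
  exact (continuousOn_growthRate hL hjd).sub
    (continuousOn_growthRate hL ((Nat.sub_le j 1).trans hjd))

end
end

section
/- Let ν be a compactly supported Borel probability measure on G = GL(d,ℝ), and assume that ∫_{G×P} Φ d(ν×η) = λ₁(ν) for every ν-stationary Borel probability measure η on P. Then for any ε > 0 there exist constants C = C(ν,ε) > 0 and c = c(ν,ε) > 0 such that for any [v] ∈ P and any N ∈ ℕ there exists a measurable set ℰ ⊂ G^ℕ satisfying: (1) ν^ℕ(ℰ^c) ≤ C e^{−cN}, and (2) λ₁(ν) − ε < (1/n) log(‖g_{n−1}⋯g_0 v‖/‖v‖) < λ₁(ν) + ε for every 𝐠 = (g_0,g_1,…) ∈ ℰ, every n ≥ N, and any nonzero representative v of [v]. -/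
open MeasureTheory Filter Topology
open scoped ENNReal

noncomputable section

abbrev Euc (d : ℕ) := EuclideanSpace ℝ (Fin d)
abbrev Md (d : ℕ) := Euc d →L[ℝ] Euc d

/-- The group `G = GL(d,ℝ)`, realized as the group of units of the algebra of linear
endomorphisms of `ℝ^d`. -/
abbrev GLd (d : ℕ) := (Md d)ˣ

/-- The real projective space `P = P(ℝ^d)`. -/
abbrev Pd (d : ℕ) := Projectivization ℝ (Euc d)

instance (d : ℕ) : TopologicalSpace (Pd d) :=
  inferInstanceAs (TopologicalSpace (Quotient (projectivizationSetoid ℝ (Euc d))))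

instance (d : ℕ) : MeasurableSpace (Pd d) := borel _

/-- The projective action of `GL(d,ℝ)` on `P(ℝ^d)`: `g • [v] = [g v]`. -/
def pact {d : ℕ} (g : GLd d) (x : Pd d) : Pd d :=
  Projectivization.map ((g : Md d) : Euc d →ₗ[ℝ] Euc d)
    (by
      have h : Function.LeftInverse (⇑((g⁻¹ : GLd d) : Md d)) (⇑((g : GLd d) : Md d)) := by
        intro v
        have h1 : ((g⁻¹ : GLd d) : Md d) * ((g : GLd d) : Md d) = 1 := g.inv_mul
        calc ((g⁻¹ : GLd d) : Md d) (((g : GLd d) : Md d) v)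
            = (((g⁻¹ : GLd d) : Md d) * ((g : GLd d) : Md d)) v := rfl
          _ = v := by rw [h1]; rfl
      exact h.injective) x

/-- The function `Φ(g, [v]) = log (‖g v‖ / ‖v‖)` (computed on the canonical representative). -/
def Phi {d : ℕ} (g : GLd d) (x : Pd d) : ℝ :=
  Real.log (‖(g : Md d) x.rep‖ / ‖x.rep‖)

/-- The (topological) support of a measure. -/
def msupport {α : Type*} [TopologicalSpace α] [MeasurableSpace α] (μ : Measure α) : Set α :=
  {x | ∀ u : Set α, IsOpen u → x ∈ u → 0 < μ u}

/-- A Borel probability measure `η` on `P` is `ν`-stationary if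
`∫ ψ dη = ∫∫ ψ(g • x) dν(g) dη(x)` for every bounded measurable `ψ`. -/
def Stationary {d : ℕ} (ν : Measure (GLd d)) (η : Measure (Pd d)) : Prop :=
  ∀ ψ : Pd d → ℝ, Measurable ψ → (∃ C, ∀ x, |ψ x| ≤ C) →
    ∫ x, ψ x ∂η = ∫ p : GLd d × Pd d, ψ (pact p.1 p.2) ∂(ν.prod η)

theorem continuous_integral_of_ae_bounded {G X : Type*} [TopologicalSpace G] [MeasurableSpace G]
    [OpensMeasurableSpace G] [TopologicalSpace X] [FirstCountableTopology X]
    {ν : Measure G} [IsProbabilityMeasure ν]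
    {Ψ : G → X → ℝ} (hΨ : Continuous (Function.uncurry Ψ)) {M : ℝ}
    (hM : ∀ᵐ g ∂ν, ∀ x, |Ψ g x| ≤ M) : Continuous fun x => ∫ g, Ψ g x ∂ν := by
  refine continuous_of_dominated (bound := fun _ => M) (fun x => ?_) (fun x => ?_)
    (integrable_const M) (ae_of_all _ fun g => ?_)
  · exact (hΨ.comp (by fun_prop : Continuous fun g : G => (g, x))).aestronglyMeasurable
  · filter_upwards [hM] with g hg using hg x
  · exact hΨ.comp (by fun_prop : Continuous fun x : X => (g, x))

/-- A normalized positive linear functional on the continuous functions on a compact space is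
integration against a Borel probability measure. -/
theorem exists_probabilityMeasure_of_positive {X : Type*} [TopologicalSpace X] [CompactSpace X]
    [T2Space X] [MeasurableSpace X] [BorelSpace X] (Λ : C(X, ℝ) →ₗ[ℝ] ℝ)
    (hpos : ∀ f : C(X, ℝ), 0 ≤ f → 0 ≤ Λ f) (hone : Λ 1 = 1) :
    ∃ η : Measure X, IsProbabilityMeasure η ∧ ∀ f : C(X, ℝ), ∫ x, f x ∂η = Λ f := by
  let Λ' : CompactlySupportedContinuousMap X ℝ →ₗ[ℝ] ℝ :=
    { toFun := fun f => Λ f.toContinuousMap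
      map_add' := fun f g => Λ.map_add _ _
      map_smul' := fun c f => Λ.map_smul c _ }
  let L : CompactlySupportedContinuousMap X ℝ →ₚ[ℝ] ℝ :=
    PositiveLinearMap.mk₀ Λ' fun f hf => hpos _ hf
  have key : ∀ f : C(X, ℝ), ∫ x, f x ∂(RealRMK.rieszMeasure L) = Λ f := fun f =>
    RealRMK.integral_rieszMeasure L (CompactlySupportedContinuousMap.continuousMapEquiv f)
  refine ⟨RealRMK.rieszMeasure L, ⟨?_⟩, key⟩
  have h1 := key 1
  rw [hone] at h1
  simp only [ContinuousMap.one_apply, integral_const, smul_eq_mul, mul_one] at h1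
  exact (ENNReal.toReal_eq_one_iff _).1 h1

/-- If the average of the cocycle `Ψ` against every stationary measure is at most `lam`, then up to
`ε` its mean is bounded everywhere by `lam` after adding a continuous coboundary. -/
theorem exists_corrector {G X : Type*} [TopologicalSpace G] [MeasurableSpace G] [BorelSpace G]
    [SecondCountableTopology G] [TopologicalSpace X] [CompactSpace X] [T2Space X]
    [SecondCountableTopology X] [MeasurableSpace X] [BorelSpace X]
    {ν : Measure G} [IsProbabilityMeasure ν] {act : G → X → X}
    (hact : Continuous (Function.uncurry act)) {Ψ : G → X → ℝ}
    (hΨ : Continuous (Function.uncurry Ψ)) {M : ℝ} (hM : ∀ᵐ g ∂ν, ∀ x, |Ψ g x| ≤ M) {lam : ℝ}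
    (hstat : ∀ η : Measure X, IsProbabilityMeasure η →
      (ν.prod η).map (Function.uncurry act) = η → ∫ p, Ψ p.1 p.2 ∂(ν.prod η) ≤ lam)
    {ε : ℝ} (hε : 0 < ε) :
    ∃ h : C(X, ℝ), ∀ x, ∫ g, Ψ g x ∂ν + (∫ g, h (act g x) ∂ν - h x) < lam + ε := by
  have hbdd : ∀ h : C(X, ℝ), ∀ g x, |h (act g x)| ≤ ‖h‖ := fun h g x => h.norm_coe_le_norm _
  have hcont : ∀ h : C(X, ℝ), Continuous (Function.uncurry fun g x => h (act g x)) :=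
    fun h => h.continuous.comp hact
  have hint : ∀ (h : C(X, ℝ)) x, Integrable (fun g => h (act g x)) ν := fun h x =>
    Integrable.of_bound ((hcont h).comp
      (by fun_prop : Continuous fun g : G => (g, x))).aestronglyMeasurable ‖h‖
      (ae_of_all _ fun g => hbdd h g x)
  let φ : C(X, ℝ) := ⟨fun x => ∫ g, Ψ g x ∂ν, continuous_integral_of_ae_bounded hΨ hM⟩
  let A : C(X, ℝ) →ₗ[ℝ] C(X, ℝ) :=
    { toFun := fun h => ⟨fun x => ∫ g, h (act g x) ∂ν,
        continuous_integral_of_ae_bounded (hcont h) (ae_of_all _ fun g x => hbdd h g x)⟩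
      map_add' := fun h k => by
        ext x
        simp [integral_add (hint h x) (hint k x)]
      map_smul' := fun c h => by
        ext x
        simp [integral_const_mul] }
  by_contra hcon
  push Not at hcon
  let U : Set C(X, ℝ) := {f | Set.MapsTo f Set.univ (Set.Iio (lam + ε))}
  have hUo : IsOpen U := ContinuousMap.isOpen_setOfPred_mapsTo isCompact_univ isOpen_Iio
  have hUc : Convex ℝ U := fun f hf k hk a b ha hb hab x hx =>
    convex_Iio (𝕜 := ℝ) (lam + ε) (hf hx) (hk hx) ha hb hab
  let V : Set C(X, ℝ) := Set.range fun h : C(X, ℝ) => φ + (A h - h)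
  have hVc : Convex ℝ V := by
    rintro _ ⟨h, rfl⟩ _ ⟨k, rfl⟩ a b ha hb hab
    refine ⟨a • h + b • k, ?_⟩
    have : φ = (a + b) • φ := by rw [hab, one_smul]
    simp only [map_add, map_smul]
    nth_rewrite 1 [this]
    module
  have hdisj : Disjoint U V := by
    rw [Set.disjoint_left]
    rintro _ hf ⟨h, rfl⟩
    obtain ⟨x, hx⟩ := hcon h
    exact absurd (hf (Set.mem_univ x)) (not_lt.2 hx)
  obtain ⟨F, u, hFU, hFV⟩ := geometric_hahn_banach_open hUc hUo hVc hdisj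
  have bounded_below : ∀ a b c : ℝ, (∀ t : ℝ, 0 ≤ t → c ≤ b + t * a) → 0 ≤ a := by
    intro a b c h
    by_contra! ha
    have := h ((|c - b| + 1) / -a) (by have := neg_pos.2 ha; positivity)
    rw [div_mul_eq_mul_div, mul_div_assoc, div_neg, div_self ha.ne] at this
    linarith [neg_abs_le (c - b)]
  have hinv : ∀ h : C(X, ℝ), F (A h) = F h := by
    have hle : ∀ h : C(X, ℝ), 0 ≤ F (A h - h) := fun h =>
      bounded_below _ (F φ) u fun t _ => by
        have := hFV _ ⟨t • h, rfl⟩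
        simpa [← smul_sub, map_sub, mul_sub] using this
    intro h
    have h1 := hle h
    have h2 := hle (-h)
    simp only [map_neg, map_sub] at h1 h2
    linarith
  have hpos : ∀ f : C(X, ℝ), 0 ≤ f → 0 ≤ F f := by
    intro f hf
    refine bounded_below _ (-F ((lam + ε - 1) • (1 : C(X, ℝ)))) (-u) fun t ht => ?_
    have hmem : (lam + ε - 1) • (1 : C(X, ℝ)) - t • f ∈ U := by
      intro x _
      have : 0 ≤ t * f x := mul_nonneg ht (hf x)
      simp only [ContinuousMap.coe_sub, ContinuousMap.coe_smul, ContinuousMap.coe_one,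
        Pi.sub_apply, Pi.smul_apply, Pi.one_apply, smul_eq_mul, mul_one, Set.mem_Iio]
      linarith
    have := hFU _ hmem
    rw [map_sub, map_smul F t f, smul_eq_mul] at this
    linarith
  have hφ : u ≤ F φ := by simpa using hFV _ ⟨0, rfl⟩
  have h1pos : 0 < F 1 := by
    refine lt_of_le_of_ne (hpos 1 zero_le_one) fun h0 => ?_
    have hz : F φ ≤ 0 := by
      have := hpos (‖φ‖ • (1 : C(X, ℝ)) - φ) fun x => by
        simpa using (le_abs_self _).trans (φ.norm_coe_le_norm x)
      rw [map_sub, map_smul, ← h0] at this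
      simpa using this
    have hm : (lam + ε - 1) • (1 : C(X, ℝ)) ∈ U := fun x _ => by simp
    have := hFU _ hm
    rw [map_smul, ← h0, smul_zero] at this
    linarith
  obtain ⟨η, hη, hηF⟩ := exists_probabilityMeasure_of_positive
    ((F 1)⁻¹ • (F : C(X, ℝ) →ₗ[ℝ] ℝ)) (fun f hf => mul_nonneg (inv_pos.2 h1pos).le (hpos f hf))
    (inv_mul_cancel₀ h1pos.ne')
  have hηstat : (ν.prod η).map (Function.uncurry act) = η := by
    have := Measure.isProbabilityMeasure_map (μ := ν.prod η) hact.measurable.aemeasurable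
    refine ext_of_forall_integral_eq_of_IsFiniteMeasure fun f => ?_
    let f' : C(X, ℝ) := f.toContinuousMap
    rw [integral_map hact.measurable.aemeasurable f.continuous.aestronglyMeasurable,
      integral_prod_symm]
    · have e1 := hηF (A f')
      have e2 := hηF f'
      simp only [LinearMap.smul_apply, ContinuousLinearMap.coe_coe, hinv] at e1 e2
      exact e1.trans e2.symm
    · exact Integrable.of_bound (hcont f').aestronglyMeasurable ‖f'‖
        (ae_of_all _ fun p => hbdd f' p.1 p.2)
  have hle := hstat η hη hηstat
  have hΨint : Integrable (fun p : G × X => Ψ p.1 p.2) (ν.prod η) := by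
    refine Integrable.of_bound hΨ.aestronglyMeasurable M ?_
    filter_upwards [Measure.quasiMeasurePreserving_fst.ae hM] with p hp using hp p.2
  rw [integral_prod_symm _ hΨint] at hle
  have hφη : (F 1)⁻¹ * F φ ≤ lam := (hηF φ).symm.trans_le hle
  rw [inv_mul_le_iff₀ h1pos] at hφη
  have hcu : ∀ δ : ℝ, 0 < δ → (lam + ε - δ) * F 1 < u := fun δ hδ => by
    have hm : (lam + ε - δ) • (1 : C(X, ℝ)) ∈ U := fun x _ => by simpa using hδ
    simpa using hFU _ hm
  have := hcu ε hε
  simp only [add_sub_cancel_right] at this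
  linarith

/-- A bounded random variable of negative mean has a small exponential moment below `1`, uniformly
in the bound and the mean. -/
theorem exists_exp_moment_lt_one {B δ : ℝ} (hB : 1 ≤ B) (hδ : 0 < δ) (hδB : δ ≤ B) :
    ∃ t > 0, ∃ ρ, 0 < ρ ∧ ρ < 1 ∧ ∀ (Ω : Type*) [MeasurableSpace Ω] (P : Measure Ω)
      [IsProbabilityMeasure P] (Y : Ω → ℝ), AEStronglyMeasurable Y P → (∀ᵐ ω ∂P, |Y ω| ≤ B) →
      ∫ ω, Y ω ∂P ≤ -δ → ∫⁻ ω, ENNReal.ofReal (Real.exp (t * Y ω)) ∂P ≤ ENNReal.ofReal ρ := by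
  have hB0 : 0 < B := by linarith
  set t := δ / (2 * B ^ 2) with ht
  have ht0 : 0 < t := by positivity
  have htB : t * B ≤ 1 := by
    rw [ht, div_mul_eq_mul_div, div_le_one (by positivity)]
    nlinarith
  have htB2 : t ^ 2 * B ^ 2 = t * δ / 2 := by
    rw [ht]
    field_simp
  have htδ : t * δ < 1 := by
    have : t * δ ≤ t * B := by gcongr
    rcases this.trans htB |>.lt_or_eq with h | h
    · exact h
    · have h2 : t * B = 1 := le_antisymm htB (h ▸ this)
      have : (t * B) ^ 2 = t * δ / 2 := by rw [mul_pow, htB2]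
      rw [h2, h] at this
      norm_num at this
  refine ⟨t, ht0, 1 - t * δ / 2, by linarith, by nlinarith [mul_pos ht0 hδ], ?_⟩
  intro Ω _ P _ Y hYm hYB hY
  have hYi : Integrable Y P := Integrable.of_bound hYm B hYB
  have hle : ∀ᵐ ω ∂P, Real.exp (t * Y ω) ≤ 1 + t * Y ω + t * δ / 2 := by
    filter_upwards [hYB] with ω hω
    have h1 : |t * Y ω| ≤ 1 := by
      rw [abs_mul, abs_of_pos ht0]
      exact (by gcongr : t * |Y ω| ≤ t * B).trans htB
    have h2 := (abs_le.1 (Real.abs_exp_sub_one_sub_id_le h1)).2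
    have h3 : (t * Y ω) ^ 2 ≤ t * δ / 2 := by
      rw [mul_pow, ← htB2]
      gcongr t ^ 2 * ?_
      exact sq_le_sq' (abs_le.1 hω).1 (abs_le.1 hω).2
    linarith
  have hri : Integrable (fun ω => 1 + t * Y ω + t * δ / 2) P := by fun_prop
  calc ∫⁻ ω, ENNReal.ofReal (Real.exp (t * Y ω)) ∂P
      ≤ ∫⁻ ω, ENNReal.ofReal (1 + t * Y ω + t * δ / 2) ∂P :=
        lintegral_mono_ae (hle.mono fun ω h => ENNReal.ofReal_le_ofReal h)
    _ = ENNReal.ofReal (∫ ω, (1 + t * Y ω + t * δ / 2) ∂P) :=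
        (ofReal_integral_eq_lintegral_ofReal hri
          (hle.mono fun ω h => (Real.exp_pos _).le.trans h)).symm
    _ ≤ ENNReal.ofReal (1 - t * δ / 2) := by
        refine ENNReal.ofReal_le_ofReal ?_
        rw [integral_add (by fun_prop) (by fun_prop), integral_add (by fun_prop) (by fun_prop),
          integral_const_mul]
        simp only [integral_const, probReal_univ, smul_eq_mul, one_mul]
        nlinarith

/-- The sum of the cocycle `Ψ` along the first `n` steps of the orbit of `x` driven by `g`. -/
def cocycleSum {G X : Type*} (act : G → X → X) (Ψ : G → X → ℝ) :
    (n : ℕ) → (Fin n → G) → X → ℝ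
  | 0, _, _ => 0
  | n + 1, g, x => Ψ (g 0) x + cocycleSum act Ψ n (Fin.tail g) (act (g 0) x)

theorem continuous_cocycleSum {G X : Type*} [TopologicalSpace G] [TopologicalSpace X]
    {act : G → X → X} (hact : Continuous (Function.uncurry act)) {Ψ : G → X → ℝ}
    (hΨ : Continuous (Function.uncurry Ψ)) (n : ℕ) :
    Continuous fun p : (Fin n → G) × X => cocycleSum act Ψ n p.1 p.2 := by
  induction n with
  | zero => exact continuous_const
  | succ n ih =>
    have h0 : Continuous fun p : (Fin (n + 1) → G) × X => (p.1 0, p.2) := by fun_prop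
    have ht : Continuous fun p : (Fin (n + 1) → G) × X => Fin.tail p.1 := by
      unfold Fin.tail
      fun_prop
    exact (hΨ.comp h0).add (ih.comp (ht.prodMk (hact.comp h0)))

theorem cocycleSum_neg {G X : Type*} (act : G → X → X) (Ψ : G → X → ℝ) (n : ℕ) (g : Fin n → G)
    (x : X) : cocycleSum act (fun g x => -Ψ g x) n g x = -cocycleSum act Ψ n g x := by
  induction n generalizing x with
  | zero => simp [cocycleSum]
  | succ n ih => simp [cocycleSum, ih, add_comm]

/-- Adding a coboundary and a constant changes the sum by boundary terms and a linear drift. -/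
theorem cocycleSum_le_add_coboundary {G X : Type*} {act : G → X → X} {Ψ : G → X → ℝ} {h : X → ℝ}
    {K a : ℝ} (hK : ∀ x, |h x| ≤ K) (n : ℕ) (g : Fin n → G) (x : X) :
    cocycleSum act Ψ n g x - n * a - K - h x ≤
      cocycleSum act (fun g x => Ψ g x + (h (act g x) - h x) - a) n g x := by
  induction n generalizing x with
  | zero =>
    simp only [cocycleSum]
    rw [Nat.cast_zero, zero_mul]
    linarith [neg_le_of_abs_le (hK x)]
  | succ n ih =>
    have := ih (Fin.tail g) (act (g 0) x)
    simp only [cocycleSum]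
    push_cast
    linarith

/-- A uniform one-step bound on the exponential moment iterates along the walk. -/
theorem lintegral_exp_cocycleSum_le {G X : Type*} [TopologicalSpace G] [MeasurableSpace G]
    [BorelSpace G] [SecondCountableTopology G] [TopologicalSpace X]
    {ν : Measure G} [IsProbabilityMeasure ν] {act : G → X → X}
    (hact : Continuous (Function.uncurry act)) {Y : G → X → ℝ}
    (hY : Continuous (Function.uncurry Y)) {t : ℝ} {ρ : ℝ≥0∞}
    (hρ : ∀ x, ∫⁻ g, ENNReal.ofReal (Real.exp (t * Y g x)) ∂ν ≤ ρ) (n : ℕ) (x : X) :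
    ∫⁻ g, ENNReal.ofReal (Real.exp (t * cocycleSum act Y n g x)) ∂(Measure.pi fun _ : Fin n => ν)
      ≤ ρ ^ n := by
  induction n generalizing x with
  | zero => simp [cocycleSum]
  | succ n ih =>
    have hc := continuous_cocycleSum hact hY n
    have hxa : Continuous fun g : G => (g, x) := by fun_prop
    rw [← ((measurePreserving_piFinSuccAbove (fun _ : Fin (n + 1) => ν) 0).symm).lintegral_comp_emb
      (MeasurableEquiv.measurableEmbedding _)]
    simp only [MeasurableEquiv.piFinSuccAbove_symm_apply, Fin.insertNthEquiv, Fin.insertNth_zero,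
      Equiv.coe_fn_mk, cocycleSum, Fin.cons_zero, Fin.tail_cons, cast_eq,
      mul_add, Real.exp_add, ENNReal.ofReal_mul (Real.exp_pos _).le]
    rw [lintegral_prod]
    · calc _ ≤ ∫⁻ g, ENNReal.ofReal (Real.exp (t * Y g x)) * ρ ^ n ∂ν := by
            refine lintegral_mono fun g => ?_
            exact (lintegral_const_mul' (ENNReal.ofReal (Real.exp (t * Y g x)))
              (fun y => ENNReal.ofReal (Real.exp (t * cocycleSum act Y n y (act g x))))
              ENNReal.ofReal_ne_top).trans_le (by gcongr; exact ih _)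
        _ = (∫⁻ g, ENNReal.ofReal (Real.exp (t * Y g x)) ∂ν) * ρ ^ n := by
            refine lintegral_mul_const _ ?_
            exact (Real.measurable_exp.comp
              ((hY.comp hxa).measurable.const_mul t)).ennreal_ofReal
        _ ≤ ρ ^ (n + 1) := by
            rw [pow_succ']
            gcongr
            exact hρ x
    · have h1 : Continuous fun z : G × (Fin n → G) => Y z.1 x := hY.comp (hxa.comp continuous_fst)
      have h2 : Continuous fun z : G × (Fin n → G) => cocycleSum act Y n z.2 (act z.1 x) :=
        hc.comp (continuous_snd.prodMk (hact.comp (hxa.comp continuous_fst)))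
      exact (ENNReal.continuous_ofReal.comp (Real.continuous_exp.comp
        (h1.const_mul t))).measurable.aemeasurable.mul
        (ENNReal.continuous_ofReal.comp (Real.continuous_exp.comp
        (h2.const_mul t))).measurable.aemeasurable

/-- Uniform upper large deviations for a cocycle over a random walk on a compact space. -/
theorem exists_measure_cocycleSum_ge_le {G X : Type*} [TopologicalSpace G] [MeasurableSpace G]
    [BorelSpace G] [SecondCountableTopology G] [TopologicalSpace X] [CompactSpace X] [T2Space X]
    [SecondCountableTopology X] [MeasurableSpace X] [BorelSpace X]
    {ν : Measure G} [IsProbabilityMeasure ν] {act : G → X → X}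
    (hact : Continuous (Function.uncurry act)) {Ψ : G → X → ℝ}
    (hΨ : Continuous (Function.uncurry Ψ)) {M : ℝ} (hM : ∀ᵐ g ∂ν, ∀ x, |Ψ g x| ≤ M) {lam : ℝ}
    (hstat : ∀ η : Measure X, IsProbabilityMeasure η →
      (ν.prod η).map (Function.uncurry act) = η → ∫ p, Ψ p.1 p.2 ∂(ν.prod η) ≤ lam)
    {ε : ℝ} (hε : 0 < ε) :
    ∃ C > (0 : ℝ), ∃ ρ, 0 < ρ ∧ ρ < 1 ∧ ∀ x n, (Measure.pi fun _ : Fin n => ν)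
      {g | n * (lam + ε) ≤ cocycleSum act Ψ n g x} ≤ ENNReal.ofReal (C * ρ ^ n) := by
  obtain ⟨h, hh⟩ := exists_corrector hact hΨ hM hstat (half_pos hε)
  set Y : G → X → ℝ := fun g x => Ψ g x + (h (act g x) - h x) - (lam + ε) with hYdef
  have hhact : Continuous (Function.uncurry fun g x => h (act g x)) := h.continuous.comp hact
  have hY : Continuous (Function.uncurry Y) := by
    have h2 : Continuous fun p : G × X => h p.2 := by fun_prop
    exact (hΨ.add (hhact.sub h2)).sub continuous_const
  have hhb : ∀ x, |h x| ≤ ‖h‖ := fun x => h.norm_coe_le_norm x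
  have hYB : ∀ᵐ g ∂ν, ∀ x, |Y g x| ≤ 1 + ε + (|M| + 2 * ‖h‖ + |lam + ε|) := by
    filter_upwards [hM] with g hg x
    have h1 := abs_le.1 ((hg x).trans (le_abs_self M))
    have h2 := abs_le.1 (hhb x)
    have h3 := abs_le.1 (hhb (act g x))
    have h4 := le_abs_self (lam + ε)
    have h5 := neg_abs_le (lam + ε)
    rw [abs_le]
    constructor <;> simp only [hYdef] <;> linarith
  have hxa : ∀ x : X, Continuous fun g : G => (g, x) := fun x => by fun_prop
  have hYmean : ∀ x, ∫ g, Y g x ∂ν ≤ -(ε / 2) := by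
    intro x
    have hi1 : Integrable (fun g => Ψ g x) ν := Integrable.of_bound
      (hΨ.comp (hxa x)).aestronglyMeasurable M (hM.mono fun g hg => hg x)
    have hi2 : Integrable (fun g => h (act g x)) ν := Integrable.of_bound
      (hhact.comp (hxa x)).aestronglyMeasurable ‖h‖ (ae_of_all _ fun g => hhb _)
    have : ∫ g, Y g x ∂ν = ∫ g, Ψ g x ∂ν + (∫ g, h (act g x) ∂ν - h x) - (lam + ε) := by
      simp only [hYdef]
      have hi3 : Integrable (fun g => h (act g x) - h x) ν := hi2.sub (integrable_const _)
      have hi4 : Integrable (fun g => Ψ g x + (h (act g x) - h x)) ν := hi1.add hi3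
      rw [integral_sub hi4 (integrable_const _), integral_add hi1 hi3,
        integral_sub hi2 (integrable_const _)]
      simp
    rw [this]
    linarith [hh x]
  have hnn : 0 ≤ |M| + 2 * ‖h‖ + |lam + ε| := by positivity
  obtain ⟨t, ht, ρ, hρ0, hρ1, hρ⟩ := exists_exp_moment_lt_one
    (B := 1 + ε + (|M| + 2 * ‖h‖ + |lam + ε|)) (by linarith) (half_pos hε) (by linarith)
  refine ⟨Real.exp (t * (2 * ‖h‖)), Real.exp_pos _, ρ, hρ0, hρ1, fun x n => ?_⟩
  have hmom := lintegral_exp_cocycleSum_le (ν := ν) hact hY (fun x =>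
    hρ G ν (fun g => Y g x) (hY.comp (hxa x)).aestronglyMeasurable
      (hYB.mono fun g hg => hg x) (hYmean x)) n x
  have hmeas : Measurable fun g : Fin n → G =>
      ENNReal.ofReal (Real.exp (t * cocycleSum act Y n g x)) := by
    have : Continuous fun g : Fin n → G => cocycleSum act Y n g x :=
      (continuous_cocycleSum hact hY n).comp
        (by fun_prop : Continuous fun g : Fin n → G => (g, x))
    exact (ENNReal.continuous_ofReal.comp (Real.continuous_exp.comp
      (this.const_mul t))).measurable
  set c := ENNReal.ofReal (Real.exp (-(t * (2 * ‖h‖)))) with hc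
  have hsub : {g : Fin n → G | n * (lam + ε) ≤ cocycleSum act Ψ n g x} ⊆
      {g | c ≤ ENNReal.ofReal (Real.exp (t * cocycleSum act Y n g x))} := by
    intro g hg
    simp only [Set.mem_ofPred_eq] at hg ⊢
    refine ENNReal.ofReal_le_ofReal (Real.exp_le_exp.2 ?_)
    have h1 := cocycleSum_le_add_coboundary (act := act) (Ψ := Ψ) (h := h) (a := lam + ε) hhb n g x
    have h2 := abs_le.1 (hhb x)
    have h3 : -(2 * ‖h‖) ≤ cocycleSum act Y n g x := by simp only [hYdef]; linarith
    nlinarith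
  have hmul := (mul_meas_ge_le_lintegral hmeas c).trans hmom
  have hc1 : ENNReal.ofReal (Real.exp (t * (2 * ‖h‖))) * c = 1 := by
    rw [hc, ← ENNReal.ofReal_mul (Real.exp_pos _).le, ← Real.exp_add]
    simp
  calc _ ≤ _ := measure_mono hsub
    _ = ENNReal.ofReal (Real.exp (t * (2 * ‖h‖))) * (c * _) := by rw [← mul_assoc, hc1, one_mul]
    _ ≤ ENNReal.ofReal (Real.exp (t * (2 * ‖h‖))) * ENNReal.ofReal ρ ^ n := by gcongr
    _ = _ := by rw [ENNReal.ofReal_mul (Real.exp_pos _).le, ENNReal.ofReal_pow hρ0.le]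

section ProjectiveSpace

variable {d : ℕ}

instance : BorelSpace (Pd d) := ⟨rfl⟩

/-- The canonical projection from nonzero vectors to projective space. -/
def projMk (v : {v : Euc d // v ≠ 0}) : Pd d := Projectivization.mk ℝ (v : Euc d) v.2

theorem continuous_projMk : Continuous (projMk (d := d)) := continuous_quotient_mk'

theorem projMk_eq_iff (v w : {v : Euc d // v ≠ 0}) :
    projMk v = projMk w ↔ |inner ℝ (v : Euc d) (w : Euc d)| = ‖(v : Euc d)‖ * ‖(w : Euc d)‖ := by
  rw [← Real.norm_eq_abs, norm_inner_eq_norm_iff v.2 w.2, eq_comm (a := projMk v)]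
  refine (Projectivization.mk_eq_mk_iff' ℝ _ _ w.2 v.2).trans ⟨?_, ?_⟩
  · rintro ⟨a, ha⟩
    exact ⟨a, fun h0 => w.2 (by rw [← ha, h0, zero_smul]), ha.symm⟩
  · rintro ⟨r, -, hr⟩
    exact ⟨r, hr.symm⟩

theorem isOpenQuotientMap_projMk : IsOpenQuotientMap (projMk (d := d)) := by
  refine ⟨fun x => ⟨⟨x.rep, x.rep_nonzero⟩, x.mk_rep⟩, continuous_projMk, fun U hU => ?_⟩
  have hsat : projMk ⁻¹' (projMk '' U) =
      ⋃ a : ℝˣ, (fun v : {v : Euc d // v ≠ 0} =>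
        (⟨a • (v : Euc d), (smul_ne_zero_iff_ne a).2 v.2⟩ : {v : Euc d // v ≠ 0})) ⁻¹' U := by
    ext v
    simp only [Set.mem_preimage, Set.mem_image, Set.mem_iUnion]
    constructor
    · rintro ⟨w, hw, hwv⟩
      obtain ⟨a, ha⟩ := (Projectivization.mk_eq_mk_iff ℝ _ _ w.2 v.2).1 hwv
      exact ⟨a, by simpa only [ha] using hw⟩
    · rintro ⟨a, ha⟩
      exact ⟨_, ha, (Projectivization.mk_eq_mk_iff ℝ _ _ _ _).2 ⟨a, rfl⟩⟩
  have hopen : IsOpen (projMk ⁻¹' (projMk '' U)) := by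
    rw [hsat]
    refine isOpen_iUnion fun a => hU.preimage ?_
    exact Continuous.subtype_mk (continuous_subtype_val.const_smul a) _
  exact hopen

instance : T2Space (Pd d) := by
  rw [t2Space_iff_of_isOpenQuotientMap isOpenQuotientMap_projMk]
  simp only [projMk_eq_iff]
  exact isClosed_eq (by fun_prop) (by fun_prop)

instance : SecondCountableTopology (Pd d) :=
  isOpenQuotientMap_projMk.isQuotientMap.secondCountableTopology isOpenQuotientMap_projMk.isOpenMap

instance : CompactSpace (Pd d) := by
  have hne : ∀ v : Metric.sphere (0 : Euc d) 1, (v : Euc d) ≠ 0 := fun v =>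
    ne_zero_of_mem_unit_sphere v
  have hc : Continuous fun v : Metric.sphere (0 : Euc d) 1 => projMk (d := d) ⟨v, hne v⟩ :=
    continuous_projMk.comp (continuous_subtype_val.subtype_mk hne)
  have hs : Function.Surjective fun v : Metric.sphere (0 : Euc d) 1 => projMk (d := d) ⟨v, hne v⟩ := by
    intro x
    have hx : ‖x.rep‖ ≠ 0 := norm_ne_zero_iff.2 x.rep_nonzero
    refine ⟨⟨‖x.rep‖⁻¹ • x.rep, by simp [norm_smul, hx]⟩, ?_⟩
    refine Eq.trans ?_ x.mk_rep
    exact (Projectivization.mk_eq_mk_iff' ℝ _ _ _ _).2 ⟨‖x.rep‖⁻¹, rfl⟩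
  exact hs.compactSpace hc

theorem GLd.apply_ne_zero (g : GLd d) {v : Euc d} (hv : v ≠ 0) : (g : Md d) v ≠ 0 := by
  intro h
  have : (((g⁻¹ : GLd d) : Md d) * (g : Md d)) v = 0 :=
    (congrArg ((g⁻¹ : GLd d) : Md d) h).trans (map_zero _)
  rw [g.inv_mul] at this
  exact hv this

theorem pact_projMk (g : GLd d) (v : {v : Euc d // v ≠ 0}) :
    pact g (projMk v) = projMk ⟨(g : Md d) v, g.apply_ne_zero v.2⟩ := rfl

theorem Phi_mk (g : GLd d) (v : Euc d) (hv : v ≠ 0) :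
    Phi g (Projectivization.mk ℝ v hv) = Real.log (‖(g : Md d) v‖ / ‖v‖) := by
  obtain ⟨a, ha⟩ := Projectivization.exists_smul_eq_mk_rep ℝ v hv
  have ha0 : |(a : ℝ)| ≠ 0 := abs_ne_zero.2 a.ne_zero
  rw [Phi, ← ha, Units.smul_def, map_smul, norm_smul, norm_smul, Real.norm_eq_abs,
    mul_div_mul_left _ _ ha0]

theorem continuous_GLd_apply :
    Continuous fun p : GLd d × {v : Euc d // v ≠ 0} => (p.1 : Md d) (p.2 : Euc d) :=
  (Units.continuous_val.comp continuous_fst).clm_apply (continuous_subtype_val.comp continuous_snd)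

theorem continuous_pact : Continuous (Function.uncurry (pact (d := d))) := by
  rw [← (IsOpenQuotientMap.id.prodMap isOpenQuotientMap_projMk).continuous_comp_iff]
  exact continuous_projMk.comp (continuous_GLd_apply.subtype_mk fun p => p.1.apply_ne_zero p.2.2)

theorem continuous_Phi : Continuous (Function.uncurry (Phi (d := d))) := by
  rw [← (IsOpenQuotientMap.id.prodMap isOpenQuotientMap_projMk).continuous_comp_iff]
  have : Function.uncurry (Phi (d := d)) ∘ Prod.map id projMk = fun p =>
      Real.log (‖(p.1 : Md d) (p.2 : Euc d)‖ / ‖(p.2 : Euc d)‖) := by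
    ext ⟨g, v⟩
    exact Phi_mk g v v.2
  rw [this]
  have h2 : Continuous fun p : GLd d × {v : Euc d // v ≠ 0} => ‖(p.2 : Euc d)‖ := by fun_prop
  refine (continuous_GLd_apply.norm.div h2 fun p => norm_ne_zero_iff.2 p.2.2).log fun p => ?_
  exact div_ne_zero (norm_ne_zero_iff.2 (p.1.apply_ne_zero p.2.2)) (norm_ne_zero_iff.2 p.2.2)

theorem abs_Phi_le (g : GLd d) (x : Pd d) :
    |Phi g x| ≤ ‖(g : Md d)‖ + ‖((g⁻¹ : GLd d) : Md d)‖ := by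
  have hx : 0 < ‖x.rep‖ := norm_pos_iff.2 x.rep_nonzero
  have hgx : 0 < ‖(g : Md d) x.rep‖ := norm_pos_iff.2 (g.apply_ne_zero x.rep_nonzero)
  have log_le : ∀ r : ℝ, 0 < r → Real.log r ≤ r := fun r hr =>
    (Real.log_le_sub_one_of_pos hr).trans (sub_le_self _ zero_le_one)
  have h1 : ‖(g : Md d) x.rep‖ / ‖x.rep‖ ≤ ‖(g : Md d)‖ := (g : Md d).ratio_le_opNorm _
  have h2 : ‖x.rep‖ / ‖(g : Md d) x.rep‖ ≤ ‖((g⁻¹ : GLd d) : Md d)‖ := by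
    rw [div_le_iff₀ hgx]
    have h := ((g⁻¹ : GLd d) : Md d).le_opNorm ((g : Md d) x.rep)
    rwa [← mul_apply_eq_comp, g.inv_mul, one_apply_eq_self] at h
  have h3 := log_le _ (div_pos hgx hx)
  have h4 := log_le _ (div_pos hx hgx)
  have h5 : Real.log (‖x.rep‖ / ‖(g : Md d) x.rep‖) =
      -Real.log (‖(g : Md d) x.rep‖ / ‖x.rep‖) := by rw [← Real.log_inv, inv_div]
  rw [abs_le, Phi]
  constructor <;> linarith [norm_nonneg (g : Md d), norm_nonneg ((g⁻¹ : GLd d) : Md d)]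

instance : SecondCountableTopology (GLd d) :=
  have : ProperSpace (Md d) := FiniteDimensional.proper ℝ _
  (Units.isOpenEmbedding_val (R := Md d)).isEmbedding.secondCountableTopology

instance : BorelSpace (GLd d) :=
  ⟨by
    rw [(Units.isOpenEmbedding_val (R := Md d)).isInducing.eq_induced, borel_comap]
    exact congrArg _ (BorelSpace.measurable_eq (α := Md d))⟩

theorem exists_ae_abs_Phi_le {ν : Measure (GLd d)} (hcs : IsCompact (msupport ν)) :
    ∃ M, ∀ᵐ g ∂ν, ∀ x, |Phi g x| ≤ M := by
  have hcont : Continuous fun g : GLd d => ‖(g : Md d)‖ + ‖((g⁻¹ : GLd d) : Md d)‖ :=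
    Units.continuous_val.norm.add (Units.continuous_val.comp continuous_inv).norm
  obtain ⟨M, hM⟩ := (hcs.image hcont).bddAbove
  have hsupp : ν.support ⊆ msupport ν := fun g hg u hu hgu =>
    (Measure.mem_support_iff_forall g).1 hg u (hu.mem_nhds hgu)
  refine ⟨M, ?_⟩
  filter_upwards [Measure.support_mem_ae (μ := ν)] with g hg x
  exact (abs_Phi_le g x).trans (hM ⟨g, hsupp hg, rfl⟩)

theorem stationary_of_map_eq {ν : Measure (GLd d)} {η : Measure (Pd d)}
    (h : (ν.prod η).map (Function.uncurry pact) = η) : Stationary ν η := by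
  intro ψ hψ _
  nth_rewrite 1 [← h]
  exact integral_map continuous_pact.measurable.aemeasurable hψ.aestronglyMeasurable

theorem cocycleSum_Phi (n : ℕ) (g : Fin n → GLd d) (v : Euc d) (hv : v ≠ 0) :
    cocycleSum pact Phi n g (Projectivization.mk ℝ v hv) =
      Real.log (‖((List.ofFn fun i => ((g i : GLd d) : Md d)).reverse.prod) v‖ / ‖v‖) := by
  induction n generalizing v with
  | zero => simp [cocycleSum, hv]
  | succ n ih =>
    have hgv := (g 0).apply_ne_zero hv
    have hprod : ∀ (l : List (GLd d)) (w : Euc d), w ≠ 0 →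
        (l.map fun a => ((a : GLd d) : Md d)).prod w ≠ 0 := by
      intro l w hw
      have : (l.map fun a => ((a : GLd d) : Md d)).prod = (l.prod : GLd d) :=
        (map_list_prod (Units.coeHom (Md d)) l).symm
      rw [this]
      exact l.prod.apply_ne_zero hw
    have hne : (List.ofFn fun i : Fin n => ((g i.succ : GLd d) : Md d)).reverse.prod
        ((g 0 : Md d) v) ≠ 0 := by
      have := hprod (List.ofFn fun i : Fin n => g i.succ).reverse _ hgv
      rwa [List.map_reverse, List.map_ofFn] at this
    rw [cocycleSum, Phi_mk]
    refine (congrArg _ (ih (Fin.tail g) _ hgv)).trans ?_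
    simp only [Fin.tail]
    rw [List.ofFn_succ, List.reverse_cons, List.prod_append, List.prod_singleton,
      mul_apply_eq_comp,
      ← Real.log_mul (div_ne_zero (norm_ne_zero_iff.2 hgv) (norm_ne_zero_iff.2 hv))
        (div_ne_zero (norm_ne_zero_iff.2 hne) (norm_ne_zero_iff.2 hgv))]
    congr 1
    have := norm_ne_zero_iff.2 hgv
    field_simp

end ProjectiveSpace

/-- **Theorem 4.1 (uniform large deviations for the top Lyapunov exponent).**
Let `ν` be a compactly supported Borel probability measure on `G = GL(d,ℝ)` with top Lyapunov
exponent `λ₁(ν)` (characterized by `λ₁(ν) = lim (1/n) ∫ log ‖g_{n−1} ⋯ g₀‖ dν^ℕ`, i.e. by the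
convergence of the integrals against the `n`-fold product measures), and let `μ = ν^ℕ` be the
Bernoulli measure on `G^ℕ` (characterized by its finite-dimensional marginals).  Assume that
`∫ Φ d(ν × η) = λ₁(ν)` for every `ν`-stationary Borel probability measure `η` on `P`.  Then for
any `ε > 0` there are `C = C(ν,ε) > 0` and `c = c(ν,ε) > 0` such that for any `[v] ∈ P` and any
`N ∈ ℕ` there is a measurable set `ℰ ⊆ G^ℕ` with `ν^ℕ(ℰᶜ) ≤ C e^{−cN}` and
`λ₁(ν) − ε < (1/n) log (‖g_{n−1} ⋯ g₀ v‖/‖v‖) < λ₁(ν) + ε` for every `𝐠 ∈ ℰ`, every `n ≥ N`,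
and any nonzero representative `v` of `[v]`. -/
theorem stmt2 (d : ℕ) (ν : Measure (GLd d)) [IsProbabilityMeasure ν]
    (hcs : IsCompact (msupport ν))
    (lam1 : ℝ)
    (hlam1 : Tendsto (fun n : ℕ => (n : ℝ)⁻¹ *
        ∫ g : Fin n → GLd d,
          Real.log ‖((List.ofFn fun i => ((g i : GLd d) : Md d)).reverse.prod)‖
          ∂(Measure.pi fun _ : Fin n => ν)) atTop (𝓝 lam1))
    (hstat : ∀ η : Measure (Pd d), IsProbabilityMeasure η → Stationary ν η →
      ∫ p : GLd d × Pd d, Phi p.1 p.2 ∂(ν.prod η) = lam1)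
    (μ : Measure (ℕ → GLd d)) [IsProbabilityMeasure μ]
    (hμ : ∀ n : ℕ, μ.map (fun g (i : Fin n) => g (i : ℕ)) = Measure.pi fun _ : Fin n => ν)
    (ε : ℝ) (hε : 0 < ε) :
    ∃ C > (0 : ℝ), ∃ c > (0 : ℝ), ∀ x : Pd d, ∀ N : ℕ,
      ∃ E : Set (ℕ → GLd d), MeasurableSet E ∧
        μ Eᶜ ≤ ENNReal.ofReal (C * Real.exp (-c * N)) ∧
        ∀ gs ∈ E, ∀ n : ℕ, N ≤ n → ∀ (v : Euc d) (hv : v ≠ 0),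
          Projectivization.mk ℝ v hv = x →
          (n : ℝ)⁻¹ *
              Real.log
                (‖((List.ofFn fun i : Fin n => ((gs (i : ℕ) : GLd d) : Md d)).reverse.prod) v‖ /
                  ‖v‖) ∈ Set.Ioo (lam1 - ε) (lam1 + ε) := by
  obtain ⟨M, hM⟩ := exists_ae_abs_Phi_le hcs
  have hstat' : ∀ η : Measure (Pd d), IsProbabilityMeasure η →
      (ν.prod η).map (Function.uncurry pact) = η → ∫ p, Phi p.1 p.2 ∂(ν.prod η) = lam1 :=
    fun η hη h => hstat η hη (stationary_of_map_eq h)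
  obtain ⟨C₁, hC₁, ρ₁, hρ₁, hρ₁', hup⟩ := exists_measure_cocycleSum_ge_le continuous_pact
    continuous_Phi hM (fun η hη h => (hstat' η hη h).le) hε
  obtain ⟨C₂, hC₂, ρ₂, hρ₂, hρ₂', hlow⟩ := exists_measure_cocycleSum_ge_le continuous_pact
    (Ψ := fun g x => -Phi g x) continuous_Phi.neg (M := M) (by simpa only [abs_neg] using hM)
    (lam := -lam1) (fun η hη h => by rw [integral_neg, hstat' η hη h]) hε
  simp only [cocycleSum_neg] at hlow
  set ρ := max ρ₁ ρ₂
  have hρ : 0 < ρ := lt_max_of_lt_left hρ₁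
  have hρ' : ρ < 1 := max_lt hρ₁' hρ₂'
  have h1ρ : 0 < 1 - ρ := sub_pos.2 hρ'
  refine ⟨(C₁ + C₂) / (1 - ρ), by positivity, -Real.log ρ, neg_pos.2 (Real.log_neg hρ hρ'),
    fun x N => ?_⟩
  let S : (n : ℕ) → (Fin n → GLd d) → ℝ := fun n g => cocycleSum pact Phi n g x
  have hS : ∀ n, Measurable (S n) := fun n =>
    ((continuous_cocycleSum continuous_pact continuous_Phi n).comp
      (by fun_prop : Continuous fun g : Fin n → GLd d => (g, x))).measurable
  have hrestrict : ∀ n : ℕ, Measurable fun (g : ℕ → GLd d) (i : Fin n) => g (i : ℕ) :=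
    fun n => by fun_prop
  let good : (n : ℕ) → Set (Fin n → GLd d) := fun n =>
    S n ⁻¹' Set.Ioo (n * (lam1 - ε)) (n * (lam1 + ε))
  have hgood : ∀ n, MeasurableSet (good n) := fun n => hS n measurableSet_Ioo
  let E : ℕ → Set (ℕ → GLd d) := fun n => (fun g (i : Fin n) => g (i : ℕ)) ⁻¹' good n
  have hE : ∀ n, MeasurableSet (E n) := fun n => hrestrict n (hgood n)
  have hbad : ∀ n, μ (E n)ᶜ ≤ ENNReal.ofReal ((C₁ + C₂) * ρ ^ n) := by
    intro n
    have hpre : (E n)ᶜ = (fun g (i : Fin n) => g (i : ℕ)) ⁻¹' (good n)ᶜ := rfl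
    rw [hpre, ← Measure.map_apply (hrestrict n) (hgood n).compl, hμ n]
    have hsub : (good n)ᶜ ⊆ {g | n * (lam1 + ε) ≤ cocycleSum pact Phi n g x} ∪
        {g | n * (-lam1 + ε) ≤ -cocycleSum pact Phi n g x} := by
      intro g hg
      by_contra hcon
      simp only [Set.mem_union, Set.mem_ofPred_eq, not_or, not_le] at hcon
      exact hg ⟨by simp only [S]; linarith, hcon.1⟩
    calc _ ≤ ENNReal.ofReal (C₁ * ρ₁ ^ n) + ENNReal.ofReal (C₂ * ρ₂ ^ n) :=
          (measure_mono hsub).trans ((measure_union_le _ _).trans (add_le_add (hup x n) (hlow x n)))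
      _ = ENNReal.ofReal (C₁ * ρ₁ ^ n + C₂ * ρ₂ ^ n) :=
          (ENNReal.ofReal_add (by positivity) (by positivity)).symm
      _ ≤ _ := by
          rw [add_mul]
          gcongr
          · exact le_max_left _ _
          · exact le_max_right _ _
  refine ⟨⋂ k, E (N + k), MeasurableSet.iInter fun k => hE _, ?_, ?_⟩
  · rw [Set.compl_iInter]
    have hsum : HasSum (fun k => (C₁ + C₂) * ρ ^ (N + k)) ((C₁ + C₂) * ρ ^ N * (1 - ρ)⁻¹) := by
      simpa only [pow_add, mul_assoc] using
        (hasSum_geometric_of_lt_one hρ.le hρ').mul_left ((C₁ + C₂) * ρ ^ N)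
    calc μ (⋃ k, (E (N + k))ᶜ) ≤ ∑' k, μ (E (N + k))ᶜ := measure_iUnion_le _
      _ ≤ ∑' k, ENNReal.ofReal ((C₁ + C₂) * ρ ^ (N + k)) := ENNReal.tsum_le_tsum fun k => hbad _
      _ = ENNReal.ofReal ((C₁ + C₂) * ρ ^ N * (1 - ρ)⁻¹) := by
          rw [← ENNReal.ofReal_tsum_of_nonneg (fun k => by positivity) hsum.summable, hsum.tsum_eq]
      _ = _ := by
          rw [neg_neg, mul_comm (Real.log ρ), Real.exp_nat_mul, Real.exp_log hρ]
          congr 1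
          ring
  · rintro gs hgs n hn v hv rfl
    obtain ⟨k, rfl⟩ := Nat.exists_eq_add_of_le hn
    have hmem : cocycleSum pact Phi (N + k) (fun i => gs (i : ℕ)) (Projectivization.mk ℝ v hv) ∈
        Set.Ioo (((N + k : ℕ) : ℝ) * (lam1 - ε)) (((N + k : ℕ) : ℝ) * (lam1 + ε)) :=
      Set.mem_iInter.1 hgs k
    rw [cocycleSum_Phi] at hmem
    have hpos : (0 : ℝ) < ((N + k : ℕ) : ℝ) := by
      refine lt_of_le_of_ne (Nat.cast_nonneg _) fun h0 => ?_
      rw [← h0] at hmem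
      exact absurd (hmem.1.trans hmem.2) (by simp)
    exact ⟨(lt_inv_mul_iff₀ hpos).2 hmem.1, (inv_mul_lt_iff₀ hpos).2 hmem.2⟩

end
end

section
/- Given any non-negative φ ∈ C(S×P) and any ε > 0 there exist ψ, ξ ∈ C(S×P) such that φ = Q_ν ψ − ψ + ξ and sup|ξ| ≤ Σ(ν,φ) + ε. -/
open MeasureTheory Filter Topology
open scoped ENNReal

noncomputable section

/-- The measure `ν`, viewed as a measure on its (compact) support `S`. -/
def nuS {d : ℕ} (ν : Measure (GLd d)) : Measure (↥(msupport ν)) :=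
  ν.comap Subtype.val

/-- The operator `Q_ν` on functions on `S × P`:
`(Q_ν ψ)(g′, x) = ∫_S ψ(g, g • x) dν(g)` (the value does not depend on `g′`). -/
def Qop {d : ℕ} (ν : Measure (GLd d)) (ψ : ↥(msupport ν) × Pd d → ℝ) :
    ↥(msupport ν) × Pd d → ℝ :=
  fun p => ∫ g : ↥(msupport ν), ψ (g, pact (g : GLd d) p.2) ∂(nuS ν)

/-- A Borel probability measure `lam` on `S × P` is `Q_ν`-invariant if
`∫ Q_ν ψ dlam = ∫ ψ dlam` for every continuous (bounded) `ψ`. -/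
def QInv {d : ℕ} (ν : Measure (GLd d)) (lam : Measure (↥(msupport ν) × Pd d)) : Prop :=
  ∀ ψ : BoundedContinuousFunction (↥(msupport ν) × Pd d) ℝ,
    ∫ p, Qop ν (⇑ψ) p ∂lam = ∫ p, ψ p ∂lam

/-- `Σ(ν,φ) = sup { ∫ φ dlam : lam a Q_ν-invariant Borel probability measure on S × P }`. -/
def SigmaSup {d : ℕ} (ν : Measure (GLd d))
    (φ : BoundedContinuousFunction (↥(msupport ν) × Pd d) ℝ) : ℝ :=
  sSup {r : ℝ | ∃ lam : Measure (↥(msupport ν) × Pd d),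
    IsProbabilityMeasure lam ∧ QInv ν lam ∧ r = ∫ p, φ p ∂lam}


lemma abs_le_norm_of_positive {X : Type*} [TopologicalSpace X]
    (L : BoundedContinuousFunction X ℝ →ₗ[ℝ] ℝ) (hpos : ∀ f, (∀ x, 0 ≤ f x) → 0 ≤ L f)
    (hone : L 1 = 1) (f : BoundedContinuousFunction X ℝ) : |L f| ≤ ‖f‖ := by
  have h1 := hpos (‖f‖ • 1 - f) fun x => by
    have := (abs_le.1 (f.norm_coe_le_norm x)).2
    simpa using this
  have h2 := hpos (‖f‖ • 1 + f) fun x => by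
    have := (abs_le.1 (f.norm_coe_le_norm x)).1
    simp only [BoundedContinuousFunction.coe_add, BoundedContinuousFunction.coe_smul,
      BoundedContinuousFunction.coe_one, Pi.add_apply, Pi.one_apply, smul_eq_mul, mul_one]
    linarith
  simp only [map_sub, map_add, map_smul, hone, smul_eq_mul, mul_one] at h1 h2
  exact abs_le.2 ⟨by linarith, by linarith⟩

/-- Weak-* compactness of the set of probability measures on a compact Hausdorff space. -/
lemma exists_isProbabilityMeasure_tendsto {X ι : Type*} [TopologicalSpace X] [CompactSpace X]
    [T2Space X] [MeasurableSpace X] [BorelSpace X] (U : Ultrafilter ι)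
    (L : ι → BoundedContinuousFunction X ℝ →ₗ[ℝ] ℝ)
    (hpos : ∀ i f, (∀ x, 0 ≤ f x) → 0 ≤ L i f) (hone : ∀ i, L i 1 = 1) :
    ∃ μ : Measure X, IsProbabilityMeasure μ ∧
      ∀ f : BoundedContinuousFunction X ℝ, Tendsto (fun i => L i f) U (𝓝 (∫ x, f x ∂μ)) := by
  have hlim : ∀ f, ∃ a, Tendsto (fun i => L i f) U (𝓝 a) := fun f => by
    obtain ⟨a, -, ha⟩ := (isCompact_Icc (a := -‖f‖) (b := ‖f‖)).ultrafilter_le_nhds'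
      (U.map fun i => L i f) (Ultrafilter.mem_map.2 (Filter.univ_mem' fun i =>
        abs_le.1 (abs_le_norm_of_positive (L i) (hpos i) (hone i) f)))
    exact ⟨a, ha⟩
  choose l hl using hlim
  let toB : CompactlySupportedContinuousMap X ℝ → BoundedContinuousFunction X ℝ :=
    fun f => BoundedContinuousFunction.mkOfCompact f.toContinuousMap
  let Λ₀ : CompactlySupportedContinuousMap X ℝ →ₗ[ℝ] ℝ :=
    { toFun := fun f => l (toB f)
      map_add' := fun f g => tendsto_nhds_unique (hl (toB (f + g))) <| by
        have h : toB (f + g) = toB f + toB g := rfl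
        simpa only [h, map_add] using (hl (toB f)).add (hl (toB g))
      map_smul' := fun c f => tendsto_nhds_unique (hl (toB (c • f))) <| by
        have h : toB (c • f) = c • toB f := rfl
        simpa only [h, map_smul, RingHom.id_apply] using (hl (toB f)).const_smul c }
  let Λ : CompactlySupportedContinuousMap X ℝ →ₚ[ℝ] ℝ :=
    PositiveLinearMap.mk₀ Λ₀ fun f hf =>
      ge_of_tendsto (hl (toB f)) (.of_forall fun i => hpos i _ fun x => hf x)
  have hint : ∀ f : BoundedContinuousFunction X ℝ, ∫ x, f x ∂(RealRMK.rieszMeasure Λ) = l f :=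
    fun f => RealRMK.integral_rieszMeasure Λ
      (CompactlySupportedContinuousMap.continuousMapEquiv f.toContinuousMap)
  refine ⟨RealRMK.rieszMeasure Λ, ⟨?_⟩, fun f => hint f ▸ hl f⟩
  have h1 : l 1 = 1 := tendsto_nhds_unique (hl 1) (by simp only [hone]; exact tendsto_const_nhds)
  have h2 := hint 1
  rw [h1] at h2
  simpa [Measure.real, ENNReal.toReal_eq_one_iff] using h2

/-- The average of the first `n + 1` iterates of a linear operator. -/
def birkhoffMean {E : Type*} [AddCommGroup E] [Module ℝ E] (T : E →ₗ[ℝ] E) (n : ℕ) : E →ₗ[ℝ] E :=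
  (n + 1 : ℝ)⁻¹ • ∑ k ∈ Finset.range (n + 1), T ^ k

lemma birkhoffMean_map_sub {E : Type*} [AddCommGroup E] [Module ℝ E] (T : E →ₗ[ℝ] E) (n : ℕ)
    (f : E) : birkhoffMean T n (T f - f) = (n + 1 : ℝ)⁻¹ • ((T ^ (n + 1)) f - f) := by
  have h := Finset.sum_range_sub (fun k => (T ^ k) f) (n + 1)
  simp only [pow_zero, Module.End.one_apply] at h
  rw [← h, Finset.sum_sub_distrib]
  simp only [birkhoffMean, LinearMap.smul_apply, LinearMap.sum_apply, map_sub, smul_sub,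
    pow_succ, Module.End.mul_apply]

lemma exists_eq_map_sub_add_birkhoffMean {E : Type*} [AddCommGroup E] [Module ℝ E]
    (T : E →ₗ[ℝ] E) (n : ℕ) (f : E) : ∃ g, f = T g - g + birkhoffMean T n f := by
  have key : ∀ k, ∃ g, f - (T ^ k) f = T g - g := fun k => by
    induction k with
    | zero => exact ⟨0, by simp⟩
    | succ k ih =>
      obtain ⟨g, hg⟩ := ih
      refine ⟨g - (T ^ k) f, ?_⟩
      rw [pow_succ', Module.End.mul_apply, map_sub, ← sub_add_sub_cancel f ((T ^ k) f), hg]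
      abel
  choose g hg using key
  refine ⟨(n + 1 : ℝ)⁻¹ • ∑ k ∈ Finset.range (n + 1), g k, ?_⟩
  have hn : (n + 1 : ℝ) ≠ 0 := by positivity
  rw [← sub_eq_iff_eq_add, map_smul, map_sum, ← smul_sub, ← Finset.sum_sub_distrib]
  simp only [← hg, Finset.sum_sub_distrib, Finset.sum_const, Finset.card_range, smul_sub,
    birkhoffMean, LinearMap.smul_apply, LinearMap.sum_apply]
  rw [← Nat.cast_smul_eq_nsmul ℝ, smul_smul, Nat.cast_add, Nat.cast_one, inv_mul_cancel₀ hn,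
    one_smul]

/-- A non-negative continuous function is cohomologous, with respect to a Markov operator, to a
function whose norm exceeds the maximal integral over invariant probabilities arbitrarily
little. -/
lemma exists_eq_map_sub_add_norm_le {X : Type*} [TopologicalSpace X] [CompactSpace X]
    [T2Space X] [MeasurableSpace X] [BorelSpace X]
    (T : BoundedContinuousFunction X ℝ →ₗ[ℝ] BoundedContinuousFunction X ℝ)
    (hpos : ∀ f, (∀ x, 0 ≤ f x) → ∀ x, 0 ≤ T f x) (hone : T 1 = 1)
    (φ : BoundedContinuousFunction X ℝ) (hφ : ∀ x, 0 ≤ φ x) (c : ℝ) (hc : 0 ≤ c)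
    (hinv : ∀ μ : Measure X, IsProbabilityMeasure μ →
      (∀ ψ : BoundedContinuousFunction X ℝ, ∫ x, T ψ x ∂μ = ∫ x, ψ x ∂μ) → ∫ x, φ x ∂μ ≤ c)
    (ε : ℝ) (hε : 0 < ε) :
    ∃ ψ ξ : BoundedContinuousFunction X ℝ, φ = T ψ - ψ + ξ ∧ ‖ξ‖ ≤ c + ε := by
  have hpos' : ∀ k f, (∀ x, 0 ≤ f x) → ∀ x, 0 ≤ (T ^ k) f x := fun k => by
    induction k with
    | zero => exact fun f hf => hf
    | succ k ih =>
      intro f hf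
      rw [pow_succ, Module.End.mul_apply]
      exact ih _ (hpos f hf)
  have hone' : ∀ k, (T ^ k) 1 = 1 := fun k => by
    induction k with
    | zero => rfl
    | succ k ih => rw [pow_succ, Module.End.mul_apply, hone, ih]
  have happ : ∀ n f x, birkhoffMean T n f x
      = (n + 1 : ℝ)⁻¹ * ∑ k ∈ Finset.range (n + 1), (T ^ k) f x := fun n f x => by
    simp [birkhoffMean, BoundedContinuousFunction.sum_apply]
  have hmpos : ∀ n f, (∀ x, 0 ≤ f x) → ∀ x, 0 ≤ birkhoffMean T n f x := fun n f hf x => by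
    rw [happ]
    exact mul_nonneg (by positivity) (Finset.sum_nonneg fun k _ => hpos' k f hf x)
  suffices h : ∃ n, ∀ x, birkhoffMean T n φ x ≤ c + ε by
    obtain ⟨n, hn⟩ := h
    obtain ⟨ψ, hψ⟩ := exists_eq_map_sub_add_birkhoffMean T n φ
    refine ⟨ψ, _, hψ, (BoundedContinuousFunction.norm_le (by positivity)).2 fun x => ?_⟩
    rw [Real.norm_of_nonneg (hmpos n φ hφ x)]
    exact hn x
  by_contra! hcon
  choose p hp using hcon
  let ev : X → BoundedContinuousFunction X ℝ →ₗ[ℝ] ℝ := fun x =>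
    { toFun := fun f => f x, map_add' := fun _ _ => rfl, map_smul' := fun _ _ => rfl }
  obtain ⟨μ, hμ, hlim⟩ := exists_isProbabilityMeasure_tendsto (hyperfilter ℕ)
    (fun n => ev (p n) ∘ₗ birkhoffMean T n) (fun n f hf => hmpos n f hf (p n)) fun n => by
      change birkhoffMean T n 1 (p n) = 1
      have hn : (n + 1 : ℝ) ≠ 0 := by positivity
      simp [happ, hone', hn]
  have hle : (hyperfilter ℕ : Filter ℕ) ≤ atTop := Nat.hyperfilter_le_atTop
  have h1 : ∫ x, φ x ∂μ ≤ c := hinv μ hμ fun ψ => by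
    have h0 : Tendsto (fun n => birkhoffMean T n (T ψ - ψ) (p n)) (hyperfilter ℕ) (𝓝 0) := by
      have hz : Tendsto (fun n : ℕ => (1 / ((n : ℝ) + 1)) * (2 * ‖ψ‖)) atTop (𝓝 0) := by
        simpa using tendsto_one_div_add_atTop_nhds_zero_nat.mul_const (2 * ‖ψ‖)
      refine squeeze_zero_norm (fun n => ?_) (hz.mono_left hle)
      have hb := abs_le_norm_of_positive (ev (p n) ∘ₗ T ^ (n + 1))
        (fun f hf => hpos' _ f hf _) (by simp [hone', ev]) ψ
      change |(T ^ (n + 1)) ψ (p n)| ≤ ‖ψ‖ at hb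
      have hb' : |ψ (p n)| ≤ ‖ψ‖ := ψ.norm_coe_le_norm _
      rw [birkhoffMean_map_sub]
      simp only [BoundedContinuousFunction.coe_smul, BoundedContinuousFunction.coe_sub,
        Pi.sub_apply, smul_eq_mul, norm_mul, Real.norm_eq_abs]
      rw [abs_of_nonneg (by positivity : (0 : ℝ) ≤ ((n : ℝ) + 1)⁻¹), one_div]
      gcongr
      exact (abs_sub _ _).trans (by linarith)
    have h2 := tendsto_nhds_unique h0 (hlim (T ψ - ψ))
    simp only [BoundedContinuousFunction.coe_sub, Pi.sub_apply] at h2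
    rw [integral_sub ((T ψ).integrable μ) (ψ.integrable μ)] at h2
    linarith
  have h3 : c + ε ≤ ∫ x, φ x ∂μ := ge_of_tendsto (hlim φ) (.of_forall fun n => (hp n).le)
  linarith

/-- The class `[v]` of a non-zero vector `v`. -/
def projClass (d : ℕ) (v : {v : Euc d // v ≠ 0}) : Pd d := Projectivization.mk ℝ v.1 v.2

lemma isOpenQuotientMap_projClass (d : ℕ) : IsOpenQuotientMap (projClass d) := by
  refine .of_isOpenMap_isQuotientMap (fun U hU => ?_) isQuotientMap_quot_mk
  refine (isQuotientMap_quot_mk (r := (projectivizationSetoid ℝ (Euc d)).r)).isOpen_preimage.1 ?_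
  let m : ℝˣ → {v : Euc d // v ≠ 0} → {v : Euc d // v ≠ 0} :=
    fun a v => ⟨a • v.1, (smul_ne_zero_iff_ne a).2 v.2⟩
  have hm : ∀ a, Continuous (m a) := fun a =>
    (continuous_subtype_val.const_smul a).subtype_mk _
  have h : projClass d ⁻¹' (projClass d '' U) = ⋃ a, m a ⁻¹' U := by
    ext v
    simp only [Set.mem_preimage, Set.mem_image, Set.mem_iUnion]
    constructor
    · rintro ⟨w, hw, hwv⟩
      obtain ⟨a, ha⟩ := (Projectivization.mk_eq_mk_iff ℝ _ _ w.2 v.2).1 hwv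
      refine ⟨a, ?_⟩
      have : m a v = w := Subtype.ext ha
      rwa [this]
    · rintro ⟨a, ha⟩
      exact ⟨m a v, ha, (Projectivization.mk_eq_mk_iff ℝ _ _ _ v.2).2 ⟨a, rfl⟩⟩
  change IsOpen (projClass d ⁻¹' (projClass d '' U))
  rw [h]
  exact isOpen_iUnion fun a => hU.preimage (hm a)

instance (d : ℕ) : BorelSpace (Pd d) := ⟨rfl⟩

instance (d : ℕ) : SecondCountableTopology (Pd d) :=
  (isOpenQuotientMap_projClass d).isQuotientMap.secondCountableTopology
    (isOpenQuotientMap_projClass d).isOpenMap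

instance (d : ℕ) : CompactSpace (Pd d) := by
  let f : Metric.sphere (0 : Euc d) 1 → Pd d :=
    fun v => projClass d ⟨v, ne_zero_of_mem_unit_sphere v⟩
  have hf : Continuous f := (isOpenQuotientMap_projClass d).continuous.comp
    (continuous_subtype_val.subtype_mk _)
  have hsurj : Function.Surjective f := fun x => by
    obtain ⟨v, rfl⟩ := (isOpenQuotientMap_projClass d).surjective x
    have hv : ‖v.1‖ ≠ 0 := norm_ne_zero_iff.2 v.2
    refine ⟨⟨‖v.1‖⁻¹ • v.1, by simp [norm_smul, hv]⟩, ?_⟩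
    exact (Projectivization.mk_eq_mk_iff' ℝ _ _ _ v.2).2 ⟨‖v.1‖⁻¹, rfl⟩
  exact hsurj.compactSpace hf

instance (d : ℕ) : T2Space (Pd d) := by
  rw [t2Space_iff_of_isOpenQuotientMap (isOpenQuotientMap_projClass d)]
  have h : {q : {v : Euc d // v ≠ 0} × {v : Euc d // v ≠ 0} | projClass d q.1 = projClass d q.2}
      = {q | inner ℝ q.2.1 q.2.1 • q.1.1 = inner ℝ q.2.1 q.1.1 • q.2.1} := by
    ext ⟨v, w⟩
    have hw : inner ℝ w.1 w.1 ≠ 0 := inner_self_ne_zero.2 w.2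
    simp only [Set.mem_ofPred_eq, projClass, Projectivization.mk_eq_mk_iff']
    constructor
    · rintro ⟨a, ha⟩
      rw [← ha, inner_smul_right, smul_smul, mul_comm]
    · intro h
      refine ⟨(inner ℝ w.1 w.1)⁻¹ * inner ℝ w.1 v.1, ?_⟩
      rw [mul_smul, ← h, smul_smul, inv_mul_cancel₀ hw, one_smul]
  rw [h]
  exact isClosed_eq (by fun_prop) (by fun_prop)

instance (d : ℕ) : SecondCountableTopology (GLd d) :=
  (Units.isOpenEmbedding_val (R := Md d)).isInducing.secondCountableTopology

instance (d : ℕ) : BorelSpace (GLd d) :=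
  ⟨by
    rw [(Units.isOpenEmbedding_val (R := Md d)).eq_induced, borel_comap,
      ← BorelSpace.measurable_eq (α := Md d)]
    rfl⟩

lemma continuous_pact_s3 (d : ℕ) : Continuous fun q : GLd d × Pd d => pact q.1 q.2 := by
  rw [← (IsOpenQuotientMap.id.prodMap (isOpenQuotientMap_projClass d)).continuous_comp_iff]
  have hne : ∀ q : GLd d × {v : Euc d // v ≠ 0}, (q.1 : Md d) q.2.1 ≠ 0 := fun q h => q.2.2 <| by
    have h1 : ((q.1⁻¹ : GLd d) : Md d) * (q.1 : Md d) = 1 := q.1.inv_mul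
    have h2 := congrArg ((q.1⁻¹ : GLd d) : Md d) h
    rw [map_zero] at h2
    exact (congrArg (fun T : Md d => T q.2.1) h1).symm.trans h2
  have hc : Continuous fun q : GLd d × {v : Euc d // v ≠ 0} => (q.1 : Md d) q.2.1 :=
    (Units.continuous_val.comp continuous_fst).clm_apply
      (continuous_subtype_val.comp continuous_snd)
  exact (isOpenQuotientMap_projClass d).continuous.comp (hc.subtype_mk hne)

lemma msupport_eq_support {α : Type*} [TopologicalSpace α] [MeasurableSpace α] (μ : Measure α) :
    msupport μ = μ.support := by
  ext x
  rw [Measure.mem_support_iff_forall]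
  refine ⟨fun h U hU => ?_, fun h u hu hx => h u (hu.mem_nhds hx)⟩
  obtain ⟨V, hVU, hV, hx⟩ := mem_nhds_iff.1 hU
  exact (h V hV hx).trans_le (measure_mono hVU)

instance {d : ℕ} (ν : Measure (GLd d)) [IsProbabilityMeasure ν] :
    IsProbabilityMeasure (nuS ν) := by
  have hcl : IsClosed (msupport ν) := msupport_eq_support ν ▸ Measure.isClosed_support
  refine (MeasurableEmbedding.subtype_coe hcl.measurableSet).isProbabilityMeasure_comap ?_
  rw [Subtype.range_coe, msupport_eq_support]
  exact Measure.support_mem_ae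

section

variable {d : ℕ} (ν : Measure (GLd d)) (ψ : BoundedContinuousFunction (↥(msupport ν) × Pd d) ℝ)

lemma continuous_comp_pact :
    Continuous fun q : ↥(msupport ν) × Pd d => ψ (q.1, pact (q.1 : GLd d) q.2) :=
  ψ.continuous.comp (continuous_fst.prodMk
    ((continuous_pact_s3 d).comp (continuous_subtype_val.prodMap continuous_id)))

variable [IsProbabilityMeasure ν]

lemma integrable_comp_pact (x : Pd d) :
    Integrable (fun g : ↥(msupport ν) => ψ (g, pact (g : GLd d) x)) (nuS ν) :=
  .of_bound ((continuous_comp_pact ν ψ).comp (.prodMk_left x)).aestronglyMeasurable ‖ψ‖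
    (.of_forall fun _ => ψ.norm_coe_le_norm _)

lemma continuous_Qop : Continuous (Qop ν ψ) := by
  have h : Continuous fun x : Pd d => ∫ g : ↥(msupport ν), ψ (g, pact (g : GLd d) x) ∂(nuS ν) :=
    continuous_of_dominated (fun x => (integrable_comp_pact ν ψ x).aestronglyMeasurable)
      (fun _ => .of_forall fun _ => ψ.norm_coe_le_norm _) (integrable_const ‖ψ‖)
      (.of_forall fun g => (continuous_comp_pact ν ψ).comp (.prodMk_right g))
  exact h.comp continuous_snd

lemma norm_Qop_le (p : ↥(msupport ν) × Pd d) : ‖Qop ν ψ p‖ ≤ ‖ψ‖ := by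
  simpa [Qop] using norm_integral_le_of_norm_le_const (μ := nuS ν)
    (.of_forall fun g : ↥(msupport ν) => ψ.norm_coe_le_norm (g, pact (g : GLd d) p.2))

end

/-- `Q_ν` as a linear operator on `C(S × P)`. -/
def QopLinear {d : ℕ} (ν : Measure (GLd d)) [IsProbabilityMeasure ν] :
    BoundedContinuousFunction (↥(msupport ν) × Pd d) ℝ →ₗ[ℝ]
      BoundedContinuousFunction (↥(msupport ν) × Pd d) ℝ where
  toFun ψ := .ofNormedAddCommGroup (Qop ν ψ) (continuous_Qop ν ψ) ‖ψ‖ (norm_Qop_le ν ψ)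
  map_add' ψ χ := BoundedContinuousFunction.ext fun p =>
    integral_add (integrable_comp_pact ν ψ p.2) (integrable_comp_pact ν χ p.2)
  map_smul' c ψ := BoundedContinuousFunction.ext fun p =>
    integral_const_mul c fun g : ↥(msupport ν) => ψ (g, pact (g : GLd d) p.2)

/-- **Lemma 4.2.** Let `ν` be a compactly supported Borel probability measure on `G = GL(d,ℝ)`
with support `S`.  Given any non-negative `φ ∈ C(S × P)` and any `ε > 0` there exist
`ψ, ξ ∈ C(S × P)` such that `φ = Q_ν ψ − ψ + ξ` and `sup |ξ| ≤ Σ(ν,φ) + ε`. -/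
theorem stmt3 (d : ℕ) (ν : Measure (GLd d)) [IsProbabilityMeasure ν]
    (hcs : IsCompact (msupport ν))
    (φ : BoundedContinuousFunction (↥(msupport ν) × Pd d) ℝ) (hφ : ∀ p, 0 ≤ φ p)
    (ε : ℝ) (hε : 0 < ε) :
    ∃ ψ ξ : BoundedContinuousFunction (↥(msupport ν) × Pd d) ℝ,
      (∀ p, φ p = Qop ν (⇑ψ) p - ψ p + ξ p) ∧ ‖ξ‖ ≤ SigmaSup ν φ + ε := by
  have : CompactSpace ↥(msupport ν) := isCompact_iff_compactSpace.1 hcs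
  have hbdd : BddAbove {r : ℝ | ∃ lam : Measure (↥(msupport ν) × Pd d),
      IsProbabilityMeasure lam ∧ QInv ν lam ∧ r = ∫ p, φ p ∂lam} := by
    refine ⟨‖φ‖, ?_⟩
    rintro r ⟨lam, hlam, -, rfl⟩
    exact (le_abs_self _).trans (φ.norm_integral_le_norm lam)
  have hnonneg : 0 ≤ SigmaSup ν φ := Real.sSup_nonneg <| by
    rintro r ⟨lam, -, -, rfl⟩
    exact integral_nonneg hφ
  obtain ⟨ψ, ξ, h, hξ⟩ := exists_eq_map_sub_add_norm_le (QopLinear ν)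
    (fun f hf p => integral_nonneg fun g => hf _)
    (BoundedContinuousFunction.ext fun p => by
      change ∫ _ : ↥(msupport ν), (1 : ℝ) ∂(nuS ν) = 1
      simp)
    φ hφ (SigmaSup ν φ) hnonneg
    (fun lam hlam hinv => le_csSup hbdd ⟨lam, hlam, hinv, rfl⟩) ε hε
  exact ⟨ψ, ξ, fun p => DFunLike.congr_fun h p, hξ⟩

end
end

section
/- Let (Ω,μ) be a probability space and Y_n : Ω → ℝ, n ≥ 1, be measurable functions such that A = sup_n ‖Y_n‖_∞ is finite and ∫ Y_{i_1} ⋯ Y_{i_k} dμ = 0 for every finite tuple of indices 1 ≤ i_1 < ⋯ < i_k. Then for any s > 0 and n ∈ ℕ, μ({ω : |Y_1(ω) + ⋯ + Y_n(ω)| ≥ s}) ≤ 2 exp(−s²/(2nA²)). -/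
open MeasureTheory

open ProbabilityTheory

section

variable {Ω ι : Type*} [MeasurableSpace Ω] {μ : Measure Ω}

/-- A finite product of almost surely bounded measurable functions is integrable. -/
theorem integrable_prod_of_ae_abs_le [IsFiniteMeasure μ] {Y : ι → Ω → ℝ} {S : Finset ι} {A : ℝ}
    (hY : ∀ i ∈ S, Measurable (Y i)) (hA : ∀ i ∈ S, ∀ᵐ ω ∂μ, |Y i ω| ≤ A) :
    Integrable (fun ω ↦ ∏ i ∈ S, Y i ω) μ := by
  refine Integrable.of_bound (Finset.measurable_fun_prod S hY).aestronglyMeasurable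
    (A ^ S.card) ?_
  filter_upwards [(Finset.eventually_all S).2 hA] with ω hω
  rw [Real.norm_eq_abs, Finset.abs_prod]
  exact (Finset.prod_le_prod (fun i _ ↦ abs_nonneg _) hω).trans_eq (Finset.prod_const A)

/-- Affine functions of a multiplicative system have multiplicative expectation. -/
theorem integral_prod_add_mul_eq_pow [IsProbabilityMeasure μ] {Y : ι → Ω → ℝ} {S : Finset ι}
    (hint : ∀ T ⊆ S, Integrable (fun ω ↦ ∏ i ∈ T, Y i ω) μ)
    (hzero : ∀ T ⊆ S, T.Nonempty → ∫ ω, ∏ i ∈ T, Y i ω ∂μ = 0) (b c : ℝ) :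
    Integrable (fun ω ↦ ∏ i ∈ S, (b * Y i ω + c)) μ ∧
      ∫ ω, ∏ i ∈ S, (b * Y i ω + c) ∂μ = c ^ S.card := by
  classical
  have hexp (ω : Ω) : ∏ i ∈ S, (b * Y i ω + c) =
      ∑ T ∈ S.powerset, b ^ T.card * c ^ (S \ T).card * ∏ i ∈ T, Y i ω := by
    rw [Finset.prod_add]
    refine Finset.sum_congr rfl fun T _ ↦ ?_
    rw [Finset.prod_mul_distrib, Finset.prod_const, Finset.prod_const]
    ring
  have hterm : ∀ T ∈ S.powerset,
      Integrable (fun ω ↦ b ^ T.card * c ^ (S \ T).card * ∏ i ∈ T, Y i ω) μ :=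
    fun T hT ↦ (hint T (Finset.mem_powerset.1 hT)).const_mul _
  simp_rw [hexp]
  refine ⟨integrable_finsetSum _ hterm, ?_⟩
  rw [integral_finsetSum _ hterm, Finset.sum_eq_single ∅]
  · simp
  · intro T hT hne
    rw [integral_const_mul, hzero T (Finset.mem_powerset.1 hT) (Finset.nonempty_iff_ne_empty.2 hne),
      mul_zero]
  · simp

/-- On `[-A, A]` the exponential lies below its chord. -/
theorem exp_mul_le_chord {A y : ℝ} (hy : |y| ≤ A) (t : ℝ) :
    Real.exp (t * y) ≤ Real.sinh (t * A) / A * y + Real.cosh (t * A) := by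
  rcases ((abs_nonneg y).trans hy).eq_or_lt with rfl | hA
  · simp [abs_nonpos_iff.1 hy]
  · have h : |y / A| ≤ 1 := by
      rw [abs_div, abs_of_pos hA]
      exact (div_le_one hA).2 hy
    have h' := Real.exp_mul_le_cosh_add_mul_sinh h (t * A)
    rw [show y / A * (t * A) = t * y by field_simp] at h'
    exact h'.trans_eq (by ring)

/-- The sum of a bounded multiplicative system is sub-Gaussian. -/
theorem hasSubgaussianMGF_sum_of_integral_prod_eq_zero [IsProbabilityMeasure μ]
    {Y : ι → Ω → ℝ} {S : Finset ι} {A : ℝ} (hY : ∀ i ∈ S, Measurable (Y i))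
    (hA : ∀ i ∈ S, ∀ᵐ ω ∂μ, |Y i ω| ≤ A)
    (hzero : ∀ T ⊆ S, T.Nonempty → ∫ ω, ∏ i ∈ T, Y i ω ∂μ = 0) :
    HasSubgaussianMGF (fun ω ↦ ∑ i ∈ S, Y i ω) (S.card * (A ^ 2).toNNReal) μ := by
  have hprod (t : ℝ) := integral_prod_add_mul_eq_pow
    (fun T hT ↦ integrable_prod_of_ae_abs_le (fun i hi ↦ hY i (hT hi)) fun i hi ↦ hA i (hT hi))
    hzero (Real.sinh (t * A) / A) (Real.cosh (t * A))
  have hle (t : ℝ) : ∀ᵐ ω ∂μ, Real.exp (t * ∑ i ∈ S, Y i ω) ≤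
      ∏ i ∈ S, (Real.sinh (t * A) / A * Y i ω + Real.cosh (t * A)) := by
    filter_upwards [(Finset.eventually_all S).2 hA] with ω hω
    rw [Finset.mul_sum, Real.exp_sum]
    exact Finset.prod_le_prod (fun i _ ↦ (Real.exp_pos _).le)
      fun i hi ↦ exp_mul_le_chord (hω i hi) t
  have hint (t : ℝ) : Integrable (fun ω ↦ Real.exp (t * ∑ i ∈ S, Y i ω)) μ := by
    refine (hprod t).1.mono'
      (((Finset.measurable_fun_sum S hY).const_mul t).exp).aestronglyMeasurable ?_
    filter_upwards [hle t] with ω hω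
    rwa [Real.norm_eq_abs, Real.abs_exp]
  refine ⟨hint, fun t ↦ ?_⟩
  calc mgf (fun ω ↦ ∑ i ∈ S, Y i ω) μ t
      ≤ Real.cosh (t * A) ^ S.card :=
        (integral_mono_ae (hint t) (hprod t).1 (hle t)).trans_eq (hprod t).2
    _ ≤ Real.exp ((t * A) ^ 2 / 2) ^ S.card :=
        pow_le_pow_left₀ (Real.cosh_pos _).le (Real.cosh_le_exp_half_sq _) _
    _ = Real.exp (((S.card * (A ^ 2).toNNReal : NNReal) : ℝ) * t ^ 2 / 2) := by
        rw [← Real.exp_nat_mul, NNReal.coe_mul, NNReal.coe_natCast,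
          Real.coe_toNNReal _ (sq_nonneg A)]
        ring_nf

/-- Two-sided tail bound for sub-Gaussian random variables. -/
theorem measure_le_abs_le_of_hasSubgaussianMGF {X : Ω → ℝ} {c : NNReal} [IsFiniteMeasure μ]
    (h : HasSubgaussianMGF X c μ) {ε : ℝ} (hε : 0 ≤ ε) :
    μ {ω | ε ≤ |X ω|} ≤ ENNReal.ofReal (2 * Real.exp (-ε ^ 2 / (2 * c))) := by
  have hunion : {ω | ε ≤ |X ω|} = {ω | ε ≤ X ω} ∪ {ω | ε ≤ (-X) ω} := by
    ext ω
    simp [le_abs]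
  rw [← ofReal_measureReal, hunion]
  refine ENNReal.ofReal_le_ofReal ((measureReal_union_le _ _).trans ?_)
  linarith [h.measure_ge_le hε, h.neg.measure_ge_le hε]

end

/-- **Azuma–Hoeffding type inequality.**
Let `(Ω, μ)` be a probability space and `Y n : Ω → ℝ`, `n ≥ 1`, measurable functions such that
`A = sup_n ‖Y n‖_∞` is finite and `∫ Y i₁ ⋯ Y i_k dμ = 0` for every finite tuple of indices
`1 ≤ i₁ < ⋯ < i_k`. Then for any `s > 0` and `n ∈ ℕ`,
`μ {ω : |Y 1 ω + ⋯ + Y n ω| ≥ s} ≤ 2 exp (−s²/(2 n A²))`. -/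
theorem stmt4 {Ω : Type*} [MeasurableSpace Ω] (μ : Measure Ω) [IsProbabilityMeasure μ]
    (Y : ℕ → Ω → ℝ) (hYmeas : ∀ n, 1 ≤ n → Measurable (Y n)) (A : ℝ)
    (hA : ∀ n, 1 ≤ n → ∀ᵐ ω ∂μ, |Y n ω| ≤ A)
    (hzero : ∀ (k : ℕ) (i : Fin (k + 1) → ℕ), StrictMono i → (∀ j, 1 ≤ i j) →
      ∫ ω, ∏ j, Y (i j) ω ∂μ = 0)
    (s : ℝ) (hs : 0 < s) (n : ℕ) :
    μ {ω | s ≤ |∑ j ∈ Finset.Icc 1 n, Y j ω|} ≤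
      ENNReal.ofReal (2 * Real.exp (-s ^ 2 / (2 * n * A ^ 2))) := by
  have hpos {j : ℕ} (hj : j ∈ Finset.Icc 1 n) : 1 ≤ j := (Finset.mem_Icc.1 hj).1
  have hprod : ∀ T ⊆ Finset.Icc 1 n, T.Nonempty → ∫ ω, ∏ j ∈ T, Y j ω ∂μ = 0 := by
    intro T hT hne
    obtain ⟨k, hk⟩ := Nat.exists_eq_succ_of_ne_zero hne.card_pos.ne'
    rw [← hzero k (T.orderEmbOfFin hk) (T.orderEmbOfFin hk).strictMono
      fun j ↦ hpos (hT (T.orderEmbOfFin_mem hk j))]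
    congr with ω
    exact (congrArg (fun U ↦ ∏ j ∈ U, Y j ω) (Finset.map_orderEmbOfFin_univ T hk)).symm.trans
      (Finset.prod_map _ _ _)
  have h := measure_le_abs_le_of_hasSubgaussianMGF
    (hasSubgaussianMGF_sum_of_integral_prod_eq_zero (fun j hj ↦ hYmeas j (hpos hj))
      (fun j hj ↦ hA j (hpos hj)) hprod) hs.le
  simpa [Real.coe_toNNReal _ (sq_nonneg A), mul_assoc] using h
end
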